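/- Assume the Riemann hypothesis: every nontrivial zero of the Riemann zeta function ζ(s) has real part 1/2. Assume moreover that all nontrivial zeros of ζ are simple and that there exists θ with 1 ≤ θ < 3 − √3 such that J_{−1}(T) := ∑_{0<γ≤T} |ζ′(1/2+iγ)|^{−2} ≪ T^θ, the sum being over nontrivial zeros ρ = 1/2+iγ with 0 < γ ≤ T. Then for every α ∈ [0,1] the function E_3(y,α) possesses a limiting distribution on ℝ, where L_α(x) = ∑_{n≤x} λ(n)/n^α with λ the Liouville function, and E_3(y,α) = e^{y(α−1/2)} L_α(e^y) if 0 ≤ α < 1/2, E_3(y,1/2) = L_{1/2}(e^y) − y/(2ζ(1/2)), and E_3(y,α) = e^{y(α−1/2)} (L_α(e^y) − ζ(2α)/ζ(α)) if 1/2 < α ≤ 1 (with the constant ζ(2α)/ζ(α) interpreted as 0 at α = 1, where ζ has its pole). -/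

import Mathlib

open MeasureTheory Filter Topology

/-- `φ` possesses a limiting distribution on `ℝ`. -/
def HasLimitingDist (φ : ℝ → ℝ) : Prop :=
  ∃ μ : Measure ℝ, IsProbabilityMeasure μ ∧
    ∀ f : BoundedContinuousFunction ℝ ℝ,
      Tendsto (fun Y : ℝ => (1 / Y) * ∫ y in (0:ℝ)..Y, f (φ y)) atTop
        (𝓝 (∫ x, f x ∂μ))

/-- The Liouville function `λ(n) = (-1)^{Ω(n)}`. -/
noncomputable def liouville (n : ℕ) : ℝ := (-1) ^ (ArithmeticFunction.cardFactors n)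

/-- `L_α(x) = ∑_{n ≤ x} λ(n)/n^α`, the weighted summatory function of the Liouville
function. -/
noncomputable def Lweight (α x : ℝ) : ℝ :=
  ∑ n ∈ Finset.Icc 1 ⌊x⌋₊, liouville n / (n : ℝ) ^ α

/-- The error term `E₃(y, α)`; for `1/2 < α ≤ 1` the constant `ζ(2α)/ζ(α)` is
subtracted (interpreted as `0` at `α = 1`, where `ζ` has its pole), and at `α = 1/2`
the secondary term `y/(2ζ(1/2))` is subtracted. -/
noncomputable def E₃ (α y : ℝ) : ℝ :=
  if α < 1 / 2 then Real.exp (y * (α - 1 / 2)) * Lweight α (Real.exp y)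
  else if α = 1 / 2 then
    Lweight (1 / 2) (Real.exp y) - y / (2 * (riemannZeta (1 / 2 : ℂ)).re)
  else Real.exp (y * (α - 1 / 2)) *
    (Lweight α (Real.exp y) -
      if α = 1 then 0 else (riemannZeta (2 * α) / riemannZeta α).re)

/-- The Cesàro mean `(1/Y) ∫_0^Y g`. -/
noncomputable def avg (g : ℝ → ℂ) (Y : ℝ) : ℂ := (1 / Y : ℝ) • ∫ y in (0:ℝ)..Y, g y

lemma exists_tendsto_of_approx {A : ℝ → ℂ}
    (h : ∀ ε : ℝ, 0 < ε → ∃ (B : ℝ → ℂ) (b : ℂ), Tendsto B atTop (𝓝 b) ∧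
      ∀ᶠ Y in atTop, ‖A Y - B Y‖ ≤ ε) : ∃ a, Tendsto A atTop (𝓝 a) := by
  apply cauchy_map_iff_exists_tendsto.1
  rw [Metric.cauchy_iff]
  refine ⟨inferInstance, fun ε hε => ?_⟩
  obtain ⟨B, b, hB, hAB⟩ := h (ε / 5) (by positivity)
  have h1 : ∀ᶠ Y in atTop, dist (B Y) b < ε / 5 := Metric.tendsto_nhds.1 hB _ (by positivity)
  refine ⟨A '' {Y | ‖A Y - B Y‖ ≤ ε / 5 ∧ dist (B Y) b < ε / 5},
    image_mem_map (hAB.and h1), ?_⟩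
  rintro _ ⟨x, ⟨hx1, hx2⟩, rfl⟩ _ ⟨y, ⟨hy1, hy2⟩, rfl⟩
  rw [← dist_eq_norm] at hx1 hy1
  have := dist_triangle4 (A x) (B x) (B y) (A y)
  have h3 := dist_triangle_right (B x) (B y) b
  rw [dist_comm (B y) (A y)] at this
  linarith

lemma norm_avg_sub_le {g k : ℝ → ℂ} {Y M : ℝ} (hY : 0 < Y)
    (hg : IntervalIntegrable g volume 0 Y) (hk : IntervalIntegrable k volume 0 Y)
    (h : ∫ y in (0:ℝ)..Y, ‖g y - k y‖ ≤ M * Y) : ‖avg g Y - avg k Y‖ ≤ M := by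
  unfold avg
  rw [← smul_sub, ← intervalIntegral.integral_sub hg hk, norm_smul, Real.norm_eq_abs,
    abs_of_pos (by positivity)]
  calc 1 / Y * ‖∫ y in (0:ℝ)..Y, (g y - k y)‖ ≤ 1 / Y * (M * Y) := by
        gcongr
        exact (intervalIntegral.norm_integral_le_integral_norm hY.le).trans h
    _ = M := by field_simp

/-- The character `y ↦ e^{iγy}`. -/
noncomputable def expChar (γ : ℝ) : BoundedContinuousFunction ℝ ℂ :=
  BoundedContinuousFunction.ofNormedAddCommGroup (fun y : ℝ => Complex.exp (Complex.I * (γ * y : ℝ)))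
    (by fun_prop) 1 (fun y => by rw [Complex.norm_exp_I_mul_ofReal])

@[simp] lemma expChar_apply (γ y : ℝ) :
    expChar γ y = Complex.exp (Complex.I * (γ * y : ℝ)) := rfl

lemma expChar_mul (a b : ℝ) : expChar a * expChar b = expChar (a + b) := by
  ext y
  simp only [BoundedContinuousFunction.coe_mul, Pi.mul_apply, expChar_apply, ← Complex.exp_add]
  congr 1; push_cast; ring

lemma expChar_zero : expChar 0 = 1 := by ext y; simp

lemma exists_tendsto_avg_expChar (γ : ℝ) : ∃ a, Tendsto (avg (expChar γ)) atTop (𝓝 a) := by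
  by_cases h : γ = 0
  · subst h
    refine ⟨1, tendsto_const_nhds.congr' ?_⟩
    filter_upwards [eventually_gt_atTop 0] with Y hY
    simp [avg, hY.ne']
  · refine ⟨0, ?_⟩
    have hc : Complex.I * γ ≠ 0 := by simp [h]
    have h1 : ∀ Y : ℝ, 0 < Y → ‖avg (expChar γ) Y‖ ≤ (1 / Y) * (2 / |γ|) := by
      intro Y hY
      unfold avg
      rw [norm_smul, Real.norm_eq_abs, abs_of_pos (by positivity)]
      gcongr
      have : ∀ y : ℝ, expChar γ y = Complex.exp ((Complex.I * γ) * y) := by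
        intro y; simp [mul_assoc]
      simp_rw [this]
      rw [integral_exp_mul_complex hc, norm_div]
      simp only [norm_mul, Complex.norm_I, one_mul, Complex.norm_real, Real.norm_eq_abs]
      gcongr
      refine (norm_sub_le _ _).trans ?_
      rw [show Complex.I * γ * Y = Complex.I * (γ * Y : ℝ) by push_cast; ring,
        Complex.norm_exp_I_mul_ofReal]
      simp; norm_num
    rw [tendsto_zero_iff_norm_tendsto_zero]
    refine squeeze_zero' (Eventually.of_forall fun _ => norm_nonneg _)
      ((eventually_gt_atTop 0).mono h1) ?_
    have := (tendsto_inv_atTop_zero (𝕜 := ℝ)).mul_const (2 / |γ|)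
    simpa using this

/-- The algebra of trigonometric polynomials. -/
noncomputable def trigAlg : Subalgebra ℂ (BoundedContinuousFunction ℝ ℂ) :=
  Algebra.adjoin ℂ (Set.range expChar)

lemma trigAlg_eq_span :
    Subalgebra.toSubmodule trigAlg = Submodule.span ℂ (Set.range expChar) := by
  unfold trigAlg
  rw [Algebra.adjoin_eq_span]
  congr 1
  apply le_antisymm
  · change Submonoid.closure (Set.range expChar) ≤
      ({ carrier := Set.range expChar
         mul_mem' := by
           rintro _ _ ⟨a, rfl⟩ ⟨b, rfl⟩; exact ⟨a + b, (expChar_mul a b).symm⟩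
         one_mem' := ⟨0, expChar_zero⟩ } : Submonoid _)
    rw [Submonoid.closure_le]
    rfl
  · exact Submonoid.subset_closure

lemma bcf_intervalIntegrable (g : BoundedContinuousFunction ℝ ℂ) (a b : ℝ) :
    IntervalIntegrable g volume a b := g.continuous.intervalIntegrable _ _

lemma exists_tendsto_avg_of_mem_trigAlg {g : BoundedContinuousFunction ℝ ℂ} (hg : g ∈ trigAlg) :
    ∃ a, Tendsto (avg g) atTop (𝓝 a) := by
  rw [← Subalgebra.mem_toSubmodule, trigAlg_eq_span] at hg
  induction hg using Submodule.span_induction with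
  | mem x h => obtain ⟨γ, rfl⟩ := h; exact exists_tendsto_avg_expChar γ
  | zero =>
    refine ⟨0, tendsto_const_nhds.congr fun Y => ?_⟩
    simp [avg]
  | add x y _ _ hx hy =>
    obtain ⟨a, ha⟩ := hx
    obtain ⟨b, hb⟩ := hy
    refine ⟨a + b, (ha.add hb).congr fun Y => ?_⟩
    simp only [avg, BoundedContinuousFunction.coe_add, Pi.add_apply]
    rw [intervalIntegral.integral_add (bcf_intervalIntegrable _ _ _)
      (bcf_intervalIntegrable _ _ _), smul_add]
  | smul c x _ hx =>
    obtain ⟨a, ha⟩ := hx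
    refine ⟨c * a, (ha.const_mul c).congr fun Y => ?_⟩
    simp [avg]; ring

lemma exists_tendsto_avg_of_mem_closure {g : BoundedContinuousFunction ℝ ℂ}
    (hg : g ∈ trigAlg.topologicalClosure) : ∃ a, Tendsto (avg g) atTop (𝓝 a) := by
  apply exists_tendsto_of_approx
  intro ε hε
  obtain ⟨p, hp, hgp⟩ := Metric.mem_closure_iff.1 hg ε hε
  obtain ⟨b, hb⟩ := exists_tendsto_avg_of_mem_trigAlg hp
  refine ⟨_, b, hb, ?_⟩
  filter_upwards [eventually_gt_atTop 0] with Y hY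
  apply norm_avg_sub_le hY (bcf_intervalIntegrable _ _ _) (bcf_intervalIntegrable _ _ _)
  have : ∫ y in (0:ℝ)..Y, ‖g y - p y‖ ≤ ∫ y in (0:ℝ)..Y, ε := by
    apply intervalIntegral.integral_mono_on hY.le
    · exact (by fun_prop : Continuous fun y => ‖g y - p y‖).intervalIntegrable _ _
    · simp
    · intro y _
      rw [← dist_eq_norm]
      exact (BoundedContinuousFunction.dist_coe_le_dist y).trans hgp.le
  simpa [mul_comm] using this

/-- For a trigonometric polynomial `P`, the function `e^{i t Re P}` has a mean. -/
lemma exists_tendsto_avg_exp_re {P : BoundedContinuousFunction ℝ ℂ} (hP : P ∈ trigAlg)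
    (hPs : star P ∈ trigAlg) (t : ℝ) :
    ∃ a, Tendsto (avg fun y => Complex.exp (Complex.I * (t * (P y).re : ℝ))) atTop (𝓝 a) := by
  set q : BoundedContinuousFunction ℝ ℂ := (Complex.I * t / 2) • (P + star P)
  have hq : q ∈ trigAlg.topologicalClosure :=
    Subalgebra.le_topologicalClosure _ (Subalgebra.smul_mem _ (add_mem hP hPs) _)
  have he : NormedSpace.exp q ∈ trigAlg.topologicalClosure :=
    NormedSpace.exp_mem (R := ℂ) (Subalgebra.isClosed_topologicalClosure _) hq
  obtain ⟨a, ha⟩ := exists_tendsto_avg_of_mem_closure he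
  refine ⟨a, ha.congr fun Y => ?_⟩
  congr 1
  ext y
  let ev : BoundedContinuousFunction ℝ ℂ →+* ℂ :=
    { toFun := fun g => g y, map_one' := rfl, map_mul' := fun _ _ => rfl, map_zero' := rfl,
      map_add' := fun _ _ => rfl }
  have hev : Continuous ev := (BoundedContinuousFunction.lipschitz_eval_const y).continuous
  have h1 : ev (NormedSpace.exp q) = NormedSpace.exp (ev q) :=
    NormedSpace.map_exp ev hev q
  change ev (NormedSpace.exp q) = _
  rw [h1, ← Complex.exp_eq_exp_ℂ]
  congr 1
  change (Complex.I * t / 2) * (P y + star (P y)) = _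
  have := Complex.add_conj (P y)
  rw [show star (P y) = (starRingEnd ℂ) (P y) from rfl, this]
  push_cast; ring

/-- The distribution of `φ(y)` for `y` uniform in `(0, Y]`. -/
noncomputable def occupation (φ : ℝ → ℝ) (Y : ℝ) : Measure ℝ :=
  (ENNReal.ofReal (1 / Y) • volume.restrict (Set.Ioc 0 Y)).map φ

lemma isProbabilityMeasure_occupation {φ : ℝ → ℝ} (hm : Measurable φ) {Y : ℝ} (hY : 0 < Y) :
    IsProbabilityMeasure (occupation φ Y) := by
  constructor
  rw [occupation, Measure.map_apply hm MeasurableSet.univ]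
  simp only [Set.preimage_univ, Measure.smul_apply, Measure.restrict_apply_univ,
    Real.volume_Ioc, smul_eq_mul, sub_zero]
  rw [← ENNReal.ofReal_mul (by positivity), one_div, inv_mul_cancel₀ hY.ne', ENNReal.ofReal_one]

lemma integral_occupation {E : Type*} [NormedAddCommGroup E] [NormedSpace ℝ E]
    {φ : ℝ → ℝ} (hm : Measurable φ) {Y : ℝ} (hY : 0 < Y)
    {f : ℝ → E} (hf : StronglyMeasurable f) :
    ∫ x, f x ∂(occupation φ Y) = (1 / Y) • ∫ y in (0:ℝ)..Y, f (φ y) := by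
  rw [occupation, integral_map hm.aemeasurable hf.aestronglyMeasurable, integral_smul_measure,
    intervalIntegral.integral_of_le hY.le, ENNReal.toReal_ofReal (by positivity)]

lemma norm_exp_I_mul_sub_le (a b : ℝ) :
    ‖Complex.exp (Complex.I * a) - Complex.exp (Complex.I * b)‖ ≤ |a - b| := by
  have : Complex.exp (Complex.I * a) - Complex.exp (Complex.I * b) =
      Complex.exp (Complex.I * b) * (Complex.exp (Complex.I * (a - b : ℝ)) - 1) := by
    rw [mul_sub, ← Complex.exp_add, mul_one]
    congr 2; push_cast; ring
  rw [this, norm_mul, Complex.norm_exp_I_mul_ofReal, one_mul]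
  exact Real.norm_exp_I_mul_ofReal_sub_one_le

/-- A function that is approximated in the mean by trigonometric polynomials has a limiting
distribution. -/
theorem hasLimitingDist_of_approx {φ : ℝ → ℝ} (hm : Measurable φ)
    (hb : ∀ Y, ∃ B, ∀ y ∈ Set.Icc 0 Y, |φ y| ≤ B)
    (h : ∀ ε : ℝ, 0 < ε → ∃ P ∈ trigAlg, star P ∈ trigAlg ∧
      ∀ᶠ Y in atTop, ∫ y in (0:ℝ)..Y, ‖(φ y : ℂ) - P y‖ ≤ ε * Y) : HasLimitingDist φ := by
  have hφi : ∀ Y : ℝ, 0 < Y → IntervalIntegrable φ volume 0 Y := by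
    intro Y hY
    obtain ⟨B, hB⟩ := hb Y
    rw [intervalIntegrable_iff_integrableOn_Ioc_of_le hY.le]
    refine Measure.integrableOn_of_bounded (M := B) (by simp) hm.aestronglyMeasurable ?_
    filter_upwards [ae_restrict_mem measurableSet_Ioc] with y hy
    exact hB y ⟨hy.1.le, hy.2⟩
  have hφd : ∀ (P : BoundedContinuousFunction ℝ ℂ) (Y : ℝ), 0 < Y →
      IntervalIntegrable (fun y => ‖(φ y : ℂ) - P y‖) volume 0 Y := fun P Y hY =>
    (IntervalIntegrable.sub (f := fun y => (φ y : ℂ))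
      ⟨(hφi Y hY).1.ofReal, (hφi Y hY).2.ofReal⟩ (bcf_intervalIntegrable P 0 Y)).norm
  have hei : ∀ (f : ℝ → ℝ), Measurable f → ∀ (t Y : ℝ),
      IntervalIntegrable (fun y => Complex.exp (Complex.I * (t * f y : ℝ))) volume 0 Y := by
    intro f hf t Y
    rw [intervalIntegrable_iff]
    refine Measure.integrableOn_of_bounded (M := 1) (by simp) ?_ ?_
    · exact Measurable.aestronglyMeasurable (by fun_prop)
    · exact Eventually.of_forall fun y => (Complex.norm_exp_I_mul_ofReal _).le
  -- the characteristic functions converge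
  have hF : ∀ t : ℝ, ∃ a, Tendsto
      (avg fun y => Complex.exp (Complex.I * (t * φ y : ℝ))) atTop (𝓝 a) := by
    intro t
    apply exists_tendsto_of_approx
    intro ε hε
    obtain ⟨P, hP, hPs, hPa⟩ := h (ε / (|t| + 1)) (by positivity)
    obtain ⟨b, hb⟩ := exists_tendsto_avg_exp_re hP hPs t
    refine ⟨_, b, hb, ?_⟩
    filter_upwards [hPa, eventually_gt_atTop 0] with Y hY hY0
    apply norm_avg_sub_le hY0 (hei φ hm t Y)
      (hei (fun y => (P y).re) (Complex.measurable_re.comp P.continuous.measurable) t Y)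
    have h1 : ∫ y in (0:ℝ)..Y, ‖Complex.exp (Complex.I * (t * φ y : ℝ)) -
        Complex.exp (Complex.I * (t * (P y).re : ℝ))‖ ≤
        ∫ y in (0:ℝ)..Y, |t| * ‖(φ y : ℂ) - P y‖ := by
      apply intervalIntegral.integral_mono_on hY0.le
      · exact ((hei φ hm t Y).sub (hei (fun y => (P y).re)
          (Complex.measurable_re.comp P.continuous.measurable) t Y)).norm
      · exact (hφd P Y hY0).const_mul _
      · intro y _
        refine (norm_exp_I_mul_sub_le _ _).trans ?_
        rw [← mul_sub, abs_mul]
        gcongr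
        simpa using Complex.abs_re_le_norm ((φ y : ℂ) - P y)
    refine h1.trans ?_
    rw [intervalIntegral.integral_const_mul]
    calc |t| * ∫ y in (0:ℝ)..Y, ‖(φ y : ℂ) - P y‖ ≤ (|t| + 1) * (ε / (|t| + 1) * Y) := by
          gcongr
          · exact intervalIntegral.integral_nonneg hY0.le fun _ _ => norm_nonneg _
          · linarith
      _ = ε * Y := by field_simp
  choose F hF using hF
  -- first moment bound
  obtain ⟨C, hC⟩ : ∃ C : ℝ, ∀ᶠ Y in atTop, ∫ y in (0:ℝ)..Y, |φ y| ≤ C * Y := by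
    obtain ⟨P, -, -, hPa⟩ := h 1 one_pos
    refine ⟨1 + ‖P‖, ?_⟩
    filter_upwards [hPa, eventually_gt_atTop 0] with Y hY hY0
    have : ∫ y in (0:ℝ)..Y, |φ y| ≤ ∫ y in (0:ℝ)..Y, (‖(φ y : ℂ) - P y‖ + ‖P‖) := by
      apply intervalIntegral.integral_mono_on hY0.le (hφi Y hY0).abs
        ((hφd P Y hY0).add intervalIntegrable_const)
      intro y _
      calc |φ y| = ‖(φ y : ℂ)‖ := by simp
        _ = ‖((φ y : ℂ) - P y) + P y‖ := by simp
        _ ≤ _ := (norm_add_le _ _).trans (by gcongr; exact P.norm_coe_le_norm y)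
    rw [intervalIntegral.integral_add (hφd P Y hY0) intervalIntegrable_const] at this
    simp at this
    linarith
  have hone : ∀ Y : ℝ, 0 < Y → avg (fun _ => (1 : ℂ)) Y = 1 := by
    intro Y hY
    simp [avg, hY.ne']
  have hFb : ∀ t, ‖F t - 1‖ ≤ |t| * C := by
    intro t
    refine le_of_tendsto ((hF t).sub_const 1).norm ?_
    filter_upwards [hC, eventually_gt_atTop 0] with Y hY hY0
    rw [← hone Y hY0]
    apply norm_avg_sub_le hY0 (hei φ hm t Y) intervalIntegrable_const
    have : ∫ y in (0:ℝ)..Y, ‖Complex.exp (Complex.I * (t * φ y : ℝ)) - 1‖ ≤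
        ∫ y in (0:ℝ)..Y, |t| * |φ y| := by
      apply intervalIntegral.integral_mono_on hY0.le
      · exact ((hei φ hm t Y).sub intervalIntegrable_const).norm
      · exact (hφi Y hY0).abs.const_mul _
      · intro y _
        rw [← abs_mul]
        exact Real.norm_exp_I_mul_ofReal_sub_one_le
    rw [intervalIntegral.integral_const_mul] at this
    calc _ ≤ _ := this
      _ ≤ |t| * (C * Y) := by gcongr
      _ = _ := by ring
  have hF0 : F 0 = 1 := by
    have := hFb 0
    simp only [abs_zero, zero_mul, norm_le_zero_iff] at this
    exact sub_eq_zero.1 this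
  have hFc : ContinuousAt F 0 := by
    rw [ContinuousAt, hF0, tendsto_iff_norm_sub_tendsto_zero]
    refine squeeze_zero (fun _ => norm_nonneg _) hFb ?_
    have : Tendsto (fun t : ℝ => |t| * C) (𝓝 0) (𝓝 (|0| * C)) :=
      (continuous_abs.mul continuous_const).tendsto 0
    simpa using this
  have hch : ∀ Y : ℝ, 0 < Y → ∀ t, charFun (occupation φ Y) t =
      avg (fun y => Complex.exp (Complex.I * (t * φ y : ℝ))) Y := by
    intro Y hY t
    rw [charFun_apply_real, integral_occupation hm hY (by fun_prop), avg]
    congr 2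
    ext y
    congr 1
    push_cast; ring
  -- probability measures indexed by sequences
  have key : ∀ u : ℕ → ℝ, (∀ n, 0 < u n) → Tendsto u atTop atTop →
      ∀ t, Tendsto (fun n => charFun (occupation φ (u n)) t) atTop (𝓝 (F t)) := by
    intro u hu hlim t
    simp_rw [fun n => hch (u n) (hu n) t]
    exact (hF t).comp hlim
  let ν : {Y : ℝ // 0 < Y} → ProbabilityMeasure ℝ := fun Y =>
    ⟨occupation φ Y, isProbabilityMeasure_occupation hm Y.2⟩
  obtain ⟨μ, hμ⟩ : ∃ μ : ProbabilityMeasure ℝ, ∀ t, charFun (μ : Measure ℝ) t = F t := by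
    let u : ℕ → ℝ := fun n => n + 1
    have hu : ∀ n, 0 < u n := fun n => by positivity
    have hul : Tendsto u atTop atTop :=
      tendsto_atTop_add_const_right _ _ tendsto_natCast_atTop_atTop
    have := fun n => isProbabilityMeasure_occupation hm (hu n)
    have ht := isTightMeasureSet_of_tendsto_charFun (μ := fun n => occupation φ (u n)) hFc
      (key u hu hul)
    let S : Set (ProbabilityMeasure ℝ) := Set.range fun n => ν ⟨u n, hu n⟩
    have hS : IsCompact (closure S) := by
      apply isCompact_closure_of_isTightMeasureSet
      convert ht using 1
      ext m
      constructor
      · rintro ⟨_, ⟨n, rfl⟩, rfl⟩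
        exact ⟨n, rfl⟩
      · rintro ⟨n, rfl⟩
        exact ⟨_, ⟨n, rfl⟩, rfl⟩
    obtain ⟨μ, -, ψ, hψ, hlim⟩ := hS.tendsto_subseq
      (x := fun n => ν ⟨u n, hu n⟩) (fun n => subset_closure ⟨n, rfl⟩)
    refine ⟨μ, fun t => ?_⟩
    have h1 := ProbabilityMeasure.tendsto_iff_tendsto_charFun.1 hlim t
    have h2 := (key u hu hul t).comp hψ.tendsto_atTop
    exact tendsto_nhds_unique h1 h2
  refine ⟨μ, inferInstance, fun f => ?_⟩
  rw [tendsto_iff_seq_tendsto]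
  intro u hu
  obtain ⟨N, hN⟩ : ∃ N, ∀ n ≥ N, 0 < u n := eventually_atTop.1 (hu.eventually_gt_atTop 0)
  rw [← tendsto_add_atTop_iff_nat N]
  let v : ℕ → ℝ := fun n => u (n + N)
  have hv : ∀ n, 0 < v n := fun n => hN _ (by omega)
  have hvl : Tendsto v atTop atTop := (tendsto_add_atTop_iff_nat N).2 hu
  have h1 : Tendsto (fun n => ν ⟨v n, hv n⟩) atTop (𝓝 μ) := by
    rw [ProbabilityMeasure.tendsto_iff_tendsto_charFun]
    intro t
    rw [hμ t]
    exact key v hv hvl t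
  have h2 := ProbabilityMeasure.tendsto_iff_forall_integral_tendsto.1 h1 f
  refine h2.congr fun n => ?_
  change ∫ x, f x ∂(occupation φ (v n)) = _
  rw [integral_occupation hm (hv n) f.continuous.stronglyMeasurable]
  rfl

open scoped FourierTransform SchwartzMap ContDiff

/-- Plancherel's theorem for functions in `L¹ ∩ L²`. -/
lemma lintegral_enorm_sq_fourier {u : ℝ → ℂ} (h1 : Integrable u) (h2 : MemLp u 2 volume) :
    ∫⁻ y, ‖𝓕 u y‖ₑ ^ 2 = ∫⁻ t, ‖u t‖ₑ ^ 2 := by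
  set U : Lp (α := ℝ) ℂ 2 volume := h2.toLp u
  have hcont : Continuous (𝓕 u) := by
    simpa [Real.fourier_eq'] using!
      VectorFourier.fourierIntegral_continuous Real.continuous_fourierChar
        (L := innerₗ ℝ) continuous_inner h1
  have hae : ∀ᵐ y, (𝓕 U : Lp (α := ℝ) ℂ 2 volume) y = 𝓕 u y := by
    apply ae_eq_of_integral_contDiff_smul_eq
    · exact (Lp.memLp _).locallyIntegrable (by norm_num)
    · exact hcont.locallyIntegrable
    intro g hg hgs
    have hg1 : HasCompactSupport (Complex.ofRealCLM ∘ g) := hgs.comp_left rfl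
    have hg2 : ContDiff ℝ ∞ (Complex.ofRealCLM ∘ g) := by fun_prop
    let φ : 𝓢(ℝ, ℂ) := hg1.toSchwartzMap hg2
    have hφ : ∀ y, φ y = g y := fun y => rfl
    have e1 : ∫ y, φ y • (𝓕 U : Lp (α := ℝ) ℂ 2 volume) y = ∫ y, (𝓕 φ) y • U y := by
      rw [← Lp.toTemperedDistribution_apply, ← Lp.toTemperedDistribution_apply,
        ← Lp.fourier_toTemperedDistribution_eq]
      rfl
    have e2 : ∫ y, (𝓕 φ) y • U y = ∫ y, (𝓕 φ) y • u y := by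
      apply integral_congr_ae
      filter_upwards [h2.coeFn_toLp] with y hy
      rw [hy]
    have e3 : ∫ y, (𝓕 φ) y • u y = ∫ y, φ y • 𝓕 u y := by
      have := VectorFourier.integral_fourierIntegral_smul_eq_flip (L := innerₗ ℝ)
        Real.continuous_fourierChar continuous_inner (φ.integrable (μ := volume)) h1
      simpa [SchwartzMap.fourier_coe] using! this
    have := e1.trans (e2.trans e3)
    simpa [hφ] using! this
  have hn : ‖(𝓕 U : Lp (α := ℝ) ℂ 2 volume)‖ = ‖U‖ := Lp.norm_fourier_eq U
  have hl : ∀ V : Lp (α := ℝ) ℂ 2 volume, ∫⁻ y, ‖V y‖ₑ ^ 2 = ‖V‖ₑ ^ 2 := by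
    intro V
    rw [Lp.enorm_def, eLpNorm_eq_lintegral_rpow_enorm_toReal (by norm_num) (by norm_num)]
    rw [← ENNReal.rpow_natCast, ← ENNReal.rpow_mul]
    simp
  calc ∫⁻ y, ‖𝓕 u y‖ₑ ^ 2 = ∫⁻ y, ‖(𝓕 U : Lp (α := ℝ) ℂ 2 volume) y‖ₑ ^ 2 := by
        apply lintegral_congr_ae
        filter_upwards [hae] with y hy
        rw [hy]
    _ = ∫⁻ y, ‖U y‖ₑ ^ 2 := by
        rw [hl, hl, ← ofReal_norm, hn, ofReal_norm]
    _ = _ := by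
        apply lintegral_congr_ae
        filter_upwards [h2.coeFn_toLp] with y hy
        rw [hy]

/-- Shifting a vertical line of integration. -/
lemma integral_vertical_eq {F : ℂ → ℂ} {a b : ℝ} (hab : a ≤ b)
    (hd : ∀ s : ℂ, a ≤ s.re → s.re ≤ b → DifferentiableAt ℂ F s)
    {D : ℝ → ℝ} (hD : Tendsto D atTop (𝓝 0))
    (hF : ∀ s : ℂ, a ≤ s.re → s.re ≤ b → ‖F s‖ ≤ D |s.im|)
    (ha : Integrable fun t : ℝ => F (a + t * Complex.I))
    (hb : Integrable fun t : ℝ => F (b + t * Complex.I)) :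
    ∫ t : ℝ, F (a + t * Complex.I) = ∫ t : ℝ, F (b + t * Complex.I) := by
  have h1 := intervalIntegral_tendsto_integral ha tendsto_neg_atTop_atBot tendsto_id
  have h2 := intervalIntegral_tendsto_integral hb tendsto_neg_atTop_atBot tendsto_id
  have h3 : Tendsto (fun T : ℝ => (∫ t in (-T)..T, F (b + t * Complex.I)) -
      ∫ t in (-T)..T, F (a + t * Complex.I)) atTop (𝓝 0) := by
    rw [tendsto_zero_iff_norm_tendsto_zero]
    have hlim : Tendsto (fun T => D T * |b - a| + D T * |b - a|) atTop (𝓝 0) := by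
      simpa using (hD.mul_const |b - a|).add (hD.mul_const |b - a|)
    refine squeeze_zero' (Eventually.of_forall fun _ => norm_nonneg _) ?_ hlim
    filter_upwards [eventually_ge_atTop 0] with T hT
    have hr := Complex.integral_boundary_rect_eq_zero_of_differentiableOn F
      (a + (-T : ℝ) * Complex.I) (b + T * Complex.I) (by
        intro s hs
        simp only [Complex.mem_reProdIm, Complex.add_re, Complex.ofReal_re, Complex.mul_re,
          Complex.I_re, mul_zero, Complex.ofReal_im, Complex.I_im, mul_one, sub_self,
          add_zero, Set.uIcc_of_le hab] at hs
        exact (hd s hs.1.1 hs.1.2).differentiableWithinAt)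
    simp only [Complex.add_re, Complex.ofReal_re, Complex.mul_re, Complex.I_re, mul_zero,
      Complex.ofReal_im, Complex.I_im, mul_one, sub_self, add_zero, Complex.add_im,
      Complex.mul_im, zero_add, smul_eq_mul] at hr
    have hx : ∀ τ : ℝ, |τ| = T →
        ‖∫ x in a..b, F (x + τ * Complex.I)‖ ≤ D T * |b - a| := by
      intro τ hτ
      apply intervalIntegral.norm_integral_le_of_norm_le_const
      intro x hx
      rw [Set.uIoc_of_le hab] at hx
      have := hF (x + τ * Complex.I) (by simpa using hx.1.le) (by simpa using hx.2)
      simpa [hτ] using this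
    have e : Complex.I * ((∫ t in (-T)..T, F (b + t * Complex.I)) -
        ∫ t in (-T)..T, F (a + t * Complex.I)) =
        (∫ x in a..b, F (x + T * Complex.I)) - ∫ x in a..b, F (x + (-T : ℝ) * Complex.I) := by
      rw [mul_sub]; linear_combination hr
    have e2 := congrArg norm e
    rw [norm_mul, Complex.norm_I, one_mul] at e2
    rw [e2]
    refine (norm_sub_le _ _).trans (add_le_add (hx T (abs_of_nonneg hT)) ?_)
    exact hx (-T) (by rw [abs_neg, abs_of_nonneg hT])
  have h4 := tendsto_nhds_unique h3 (h2.sub h1)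
  exact (sub_eq_zero.1 h4.symm).symm

lemma exp_abs_mul_gaussian_le (M : ℝ) {c : ℝ} (hc : 0 < c) (t : ℝ) :
    Real.exp (M * |t|) * Real.exp (-c * t ^ 2) ≤
      Real.exp (M ^ 2 / (2 * c)) * Real.exp (-(c / 2) * t ^ 2) := by
  rw [← Real.exp_add, ← Real.exp_add]
  apply Real.exp_le_exp.2
  have h : 0 ≤ (c * |t| - M) ^ 2 / (2 * c) := by positivity
  have h2 : (c * |t| - M) ^ 2 / (2 * c) = c / 2 * t ^ 2 - M * |t| + M ^ 2 / (2 * c) := by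
    rw [← sq_abs t]
    field_simp
    ring
  linarith

/-- Gaussian means of the Fourier transform recover the function at points of continuity. -/
lemma tendsto_integral_cexp_mul_fourier {f : ℝ → ℂ} (hf : Integrable f) {y : ℝ}
    (hy : ContinuousAt f y) :
    Tendsto (fun c : ℝ => ∫ w : ℝ, Complex.exp (-c⁻¹ * w ^ 2 + 2 * Real.pi * Complex.I * (y * w)) *
      𝓕 f w) atTop (𝓝 (f y)) := by
  refine (Real.tendsto_integral_gaussian_smul' hf hy).congr' ?_
  filter_upwards [Ioi_mem_atTop 0] with c (hc : 0 < c)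
  have J : Integrable (fun w : ℝ ↦ Complex.exp (-c⁻¹ * ‖w‖ ^ 2 +
      2 * Real.pi * Complex.I * inner ℝ y w)) :=
    GaussianFourier.integrable_cexp_neg_mul_sq_norm_add (by simpa) _ _
  have := VectorFourier.integral_fourierIntegral_smul_eq_flip (L := innerₗ ℝ)
      Real.continuous_fourierChar continuous_inner J hf
  have e1 : ∫ w : ℝ, Complex.exp (-c⁻¹ * w ^ 2 + 2 * Real.pi * Complex.I * (y * w)) * 𝓕 f w =
      ∫ w : ℝ, Complex.exp (-c⁻¹ * ‖w‖ ^ 2 + 2 * Real.pi * Complex.I * inner ℝ y w) • 𝓕 f w := by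
    congr 1; ext w
    rw [smul_eq_mul]
    congr 3
    · norm_cast; simp
    · simp [mul_comm]
  have e2 : ∫ w : ℝ, Complex.exp (-c⁻¹ * ‖w‖ ^ 2 + 2 * Real.pi * Complex.I * inner ℝ y w) • 𝓕 f w =
      ∫ w : ℝ, 𝓕 (fun w : ℝ ↦ Complex.exp (-c⁻¹ * ‖w‖ ^ 2 +
        2 * Real.pi * Complex.I * inner ℝ y w)) w • f w := by
    simpa using! this.symm
  rw [e1, e2]
  congr with w
  rw [fourier_gaussian_innerProductSpace' (by simpa)]
  congr 2
  · congr 1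
    simp [div_eq_mul_inv]
  · congr 1
    push_cast
    field_simp

lemma tendsto_gaussian_atTop {c : ℝ} (hc : 0 < c) (D : ℝ) :
    Tendsto (fun t : ℝ => D * Real.exp (-c * t ^ 2)) atTop (𝓝 0) := by
  have : Tendsto (fun t : ℝ => Real.exp (-c * t ^ 2)) atTop (𝓝 0) := by
    apply Real.tendsto_exp_atBot.comp
    have := (tendsto_pow_atTop (α := ℝ) two_ne_zero).const_mul_atTop_of_neg (neg_lt_zero.2 hc)
    exact this
  simpa using this.const_mul D

/-- A Laplace transform that continues analytically bounds the weighted `L²` norm of the original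
function on the left of its half-plane of absolute convergence. -/
theorem lintegral_laplace_le {h : ℝ → ℂ} {K σ : ℝ} (hσK : σ ≤ K)
    (hint : Integrable fun y : ℝ => h y * Complex.exp (-(K : ℂ) * y))
    (hcont : ∀ᵐ y, ContinuousAt h y) {G : ℂ → ℂ}
    (hd : ∀ s : ℂ, σ ≤ s.re → s.re ≤ K → DifferentiableAt ℂ G s)
    (hL : ∀ t : ℝ, G (K + t * Complex.I) =
      ∫ y : ℝ, h y * Complex.exp (-(K + t * Complex.I) * y)) {A : ℝ}
    (hA : ∀ s : ℂ, σ ≤ s.re → s.re ≤ K → ‖G s‖ ≤ A * Real.exp |s.im|) :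
    ∫⁻ y : ℝ, ‖h y * Complex.exp (-(σ : ℂ) * y)‖ₑ ^ 2 ≤
      ∫⁻ w : ℝ, ‖G (σ + (2 * Real.pi * w : ℝ) * Complex.I)‖ₑ ^ 2 := by
  set f : ℝ → ℂ := fun y => h y * Complex.exp (-(K : ℂ) * y) with hf
  have hA0 : 0 ≤ A := by
    have h1 := (norm_nonneg _).trans (hA σ (by simp) (by simpa))
    have : (0:ℝ) < Real.exp |(σ:ℂ).im| := Real.exp_pos _
    exact nonneg_of_mul_nonneg_left h1 this
  set k : ℝ := K / (2 * Real.pi) with hk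
  set a : ℝ := σ / (2 * Real.pi) with ha
  have hpi := Real.pi_pos
  have h2k : 2 * Real.pi * k = K := by rw [hk]; field_simp
  have h2a : 2 * Real.pi * a = σ := by rw [ha]; field_simp
  have hak : a ≤ k := by rw [ha, hk]; gcongr
  have hfour : ∀ w : ℝ, 𝓕 f w = G (K + (2 * Real.pi * w : ℝ) * Complex.I) := by
    intro w
    rw [hL, Real.fourier_eq']
    congr 1; ext y
    simp only [hf, smul_eq_mul]
    rw [mul_comm, mul_assoc, ← Complex.exp_add]
    congr 2
    simp
    ring
  -- the shifted kernel
  set u : ℝ → ℝ → ℂ := fun c w => Complex.exp (c⁻¹ * ((a - k : ℝ) + w * Complex.I) ^ 2) *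
    G (σ + (2 * Real.pi * w : ℝ) * Complex.I) with hu
  have hre : ∀ (c x τ : ℝ), ‖Complex.exp (c⁻¹ * ((x : ℝ) + τ * Complex.I) ^ 2)‖ =
      Real.exp (c⁻¹ * x ^ 2) * Real.exp (-c⁻¹ * τ ^ 2) := by
    intro c x τ
    rw [Complex.norm_exp, ← Real.exp_add]
    congr 1
    simp [pow_two, Complex.mul_re, Complex.mul_im]
    ring
  have hGcont : ∀ x : ℝ, σ ≤ x → x ≤ K → Continuous fun w : ℝ =>
      G (x + (2 * Real.pi * w : ℝ) * Complex.I) := by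
    intro x h1 h2
    rw [continuous_iff_continuousAt]
    intro w
    have h3 : ContinuousAt G (x + (2 * Real.pi * w : ℝ) * Complex.I) :=
      (hd _ (by simpa using h1) (by simpa using h2)).continuousAt
    exact ContinuousAt.comp (f := fun w : ℝ => (x + (2 * Real.pi * w : ℝ) * Complex.I : ℂ)) h3
      (by fun_prop)
  have hucont : ∀ c, Continuous (u c) := by
    intro c
    exact Continuous.mul (by fun_prop) (hGcont σ le_rfl hσK)
  have hub : ∀ c : ℝ, 0 < c → ∃ D, ∀ w, ‖u c w‖ ≤ D * Real.exp (-(c⁻¹ / 2) * w ^ 2) := by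
    intro c hc
    refine ⟨Real.exp (c⁻¹ * (a - k) ^ 2) * A * Real.exp ((2 * Real.pi) ^ 2 / (2 * c⁻¹)), ?_⟩
    intro w
    have h1 := hA (σ + (2 * Real.pi * w : ℝ) * Complex.I) (by simp) (by simpa using hσK)
    have h2 := exp_abs_mul_gaussian_le (2 * Real.pi) (inv_pos.2 hc) w
    rw [hu]; simp only
    rw [norm_mul, hre]
    simp only [Complex.add_im, Complex.ofReal_im, Complex.mul_im, Complex.ofReal_re, Complex.I_im,
      mul_one, Complex.I_re, mul_zero, add_zero, zero_add] at h1
    rw [abs_mul, abs_of_pos (by positivity : 0 < 2 * Real.pi)] at h1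
    calc _ ≤ Real.exp (c⁻¹ * (a - k) ^ 2) * Real.exp (-c⁻¹ * w ^ 2) *
          (A * Real.exp (2 * Real.pi * |w|)) := by gcongr
      _ = Real.exp (c⁻¹ * (a - k) ^ 2) * A *
          (Real.exp (2 * Real.pi * |w|) * Real.exp (-c⁻¹ * w ^ 2)) := by ring
      _ ≤ Real.exp (c⁻¹ * (a - k) ^ 2) * A * (Real.exp ((2 * Real.pi) ^ 2 / (2 * c⁻¹)) *
          Real.exp (-(c⁻¹ / 2) * w ^ 2)) := by gcongr
      _ = _ := by ring
  have huint : ∀ c : ℝ, 0 < c → Integrable (u c) := by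
    intro c hc
    obtain ⟨D, hD⟩ := hub c hc
    exact ((integrable_exp_neg_mul_sq (by positivity : 0 < c⁻¹ / 2)).const_mul D).mono'
      (hucont c).aestronglyMeasurable (Eventually.of_forall hD)
  have hu2 : ∀ c : ℝ, 0 < c → MemLp (u c) 2 volume := by
    intro c hc
    obtain ⟨D, hD⟩ := hub c hc
    rw [memLp_two_iff_integrable_sq_norm (hucont c).aestronglyMeasurable]
    refine ((integrable_exp_neg_mul_sq (by positivity : 0 < c⁻¹)).const_mul (D ^ 2)).mono'
      ((hucont c).norm.pow 2).aestronglyMeasurable (Eventually.of_forall fun w => ?_)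
    rw [Real.norm_of_nonneg (by positivity)]
    calc ‖u c w‖ ^ 2 ≤ (D * Real.exp (-(c⁻¹ / 2) * w ^ 2)) ^ 2 := by gcongr; exact hD w
      _ = _ := by rw [mul_pow, ← Real.exp_nat_mul]; congr 2; push_cast; ring
  -- contour shift
  have hshift : ∀ c : ℝ, 0 < c → ∀ y : ℝ,
      ∫ w : ℝ, Complex.exp (-c⁻¹ * w ^ 2 + 2 * Real.pi * Complex.I * (y * w)) * 𝓕 f w =
        Complex.exp (((σ - K) * y : ℝ)) * 𝓕⁻ (u c) y := by
    intro c hc y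
    set F : ℂ → ℂ := fun z => Complex.exp (c⁻¹ * (z - k) ^ 2 + 2 * Real.pi * y * (z - k)) *
      G (2 * Real.pi * z) with hFdef
    have eK : ∀ w : ℝ, F (k + w * Complex.I) =
        Complex.exp (-c⁻¹ * w ^ 2 + 2 * Real.pi * Complex.I * (y * w)) * 𝓕 f w := by
      intro w
      rw [hfour, hFdef]
      simp only
      congr 2
      · have : (w * Complex.I) ^ 2 = -(w : ℂ) ^ 2 := by rw [mul_pow, Complex.I_sq]; ring
        rw [add_sub_cancel_left, this]; ring
      · rw [← h2k]; push_cast; ring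
    have eσ : ∀ w : ℝ, F (a + w * Complex.I) = Complex.exp (((σ - K) * y : ℝ)) *
        (Complex.exp (2 * Real.pi * (w * y) * Complex.I) * u c w) := by
      intro w
      rw [hFdef, hu]
      simp only
      rw [← mul_assoc, ← mul_assoc, ← Complex.exp_add, ← Complex.exp_add]
      congr 2
      · rw [← h2k, ← h2a]; push_cast; ring
      · rw [← h2a]; push_cast; ring
    have hFb : ∃ D, ∀ s : ℂ, a ≤ s.re → s.re ≤ k →
        ‖F s‖ ≤ D * Real.exp (-(c⁻¹ / 2) * |s.im| ^ 2) := by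
      refine ⟨Real.exp (c⁻¹ * (k - a) ^ 2) * Real.exp (2 * Real.pi * |y| * (k - a)) * A *
        Real.exp ((2 * Real.pi) ^ 2 / (2 * c⁻¹)), ?_⟩
      intro s h1 h2
      have h3 := hA (2 * Real.pi * s) (by
        simp; rw [← h2a]; gcongr) (by simp; rw [← h2k]; gcongr)
      have h4 : |(2 * Real.pi * s : ℂ).im| = 2 * Real.pi * |s.im| := by
        simp [abs_mul, abs_of_pos hpi]
      rw [h4] at h3
      have h5 := exp_abs_mul_gaussian_le (2 * Real.pi) (inv_pos.2 hc) s.im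
      have h6 : ‖Complex.exp (c⁻¹ * (s - k) ^ 2 + 2 * Real.pi * y * (s - k))‖ =
          Real.exp (c⁻¹ * (k - s.re) ^ 2) * Real.exp (-c⁻¹ * s.im ^ 2) *
            Real.exp (2 * Real.pi * y * (s.re - k)) := by
        rw [Complex.norm_exp, ← Real.exp_add, ← Real.exp_add]
        congr 1
        simp [pow_two, Complex.mul_re, Complex.mul_im]
        ring
      have h7 : (k - s.re) ^ 2 ≤ (k - a) ^ 2 := by
        have : 0 ≤ k - s.re := by linarith
        gcongr
      have h8 : 2 * Real.pi * y * (s.re - k) ≤ 2 * Real.pi * |y| * (k - a) := by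
        have : y * (s.re - k) ≤ |y| * (k - a) := by
          calc y * (s.re - k) ≤ |y * (s.re - k)| := le_abs_self _
            _ = |y| * (k - s.re) := by rw [abs_mul, abs_of_nonpos (by linarith : s.re - k ≤ 0)]; ring
            _ ≤ _ := by gcongr
        nlinarith
      rw [hFdef]; simp only
      rw [norm_mul, h6, sq_abs]
      calc _ ≤ Real.exp (c⁻¹ * (k - a) ^ 2) * Real.exp (-c⁻¹ * s.im ^ 2) *
            Real.exp (2 * Real.pi * |y| * (k - a)) * (A * Real.exp (2 * Real.pi * |s.im|)) := by
            gcongr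
        _ = Real.exp (c⁻¹ * (k - a) ^ 2) * Real.exp (2 * Real.pi * |y| * (k - a)) * A *
            (Real.exp (2 * Real.pi * |s.im|) * Real.exp (-c⁻¹ * s.im ^ 2)) := by ring
        _ ≤ Real.exp (c⁻¹ * (k - a) ^ 2) * Real.exp (2 * Real.pi * |y| * (k - a)) * A *
            (Real.exp ((2 * Real.pi) ^ 2 / (2 * c⁻¹)) * Real.exp (-(c⁻¹ / 2) * s.im ^ 2)) := by
            gcongr
        _ = _ := by ring
    have hFd : ∀ s : ℂ, a ≤ s.re → s.re ≤ k → DifferentiableAt ℂ F s := by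
      intro s h1 h2
      have h3 : DifferentiableAt ℂ G (2 * Real.pi * s) := hd _ (by
        simp; rw [← h2a]; gcongr) (by simp; rw [← h2k]; gcongr)
      have h4 : DifferentiableAt ℂ (fun z : ℂ => G (2 * Real.pi * z)) s :=
        DifferentiableAt.comp (g := G) s h3 (by fun_prop)
      exact DifferentiableAt.mul (by fun_prop) h4
    obtain ⟨D, hD⟩ := hFb
    have hFi : ∀ x : ℝ, a ≤ x → x ≤ k → Integrable fun t : ℝ => F (x + t * Complex.I) := by
      intro x h1 h2
      have hc1 : Continuous fun t : ℝ => F (x + t * Complex.I) := by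
        rw [continuous_iff_continuousAt]
        intro t
        exact ContinuousAt.comp (f := fun t : ℝ => (x + t * Complex.I : ℂ))
          (hFd _ (by simpa using h1) (by simpa using h2)).continuousAt (by fun_prop)
      refine ((integrable_exp_neg_mul_sq (by positivity : 0 < c⁻¹ / 2)).const_mul D).mono'
        hc1.aestronglyMeasurable (Eventually.of_forall fun t => ?_)
      simpa using hD (x + t * Complex.I) (by simpa using h1) (by simpa using h2)
    have := integral_vertical_eq hak hFd
      (tendsto_gaussian_atTop (by positivity : 0 < c⁻¹ / 2) D) hD (hFi a le_rfl hak)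
      (hFi k hak le_rfl)
    simp_rw [eK, eσ] at this
    rw [← this, integral_const_mul, Real.fourierInv_eq']
    congr 1
    congr 1; ext w
    simp [mul_comm, mul_left_comm]
  -- the lintegral bound for each `c`
  have hc1 : ∀ c : ℝ, 0 < c → ∫⁻ y : ℝ, ‖𝓕⁻ (u c) y‖ₑ ^ 2 ≤
      ENNReal.ofReal (Real.exp (c⁻¹ * (a - k) ^ 2)) ^ 2 *
      ∫⁻ w : ℝ, ‖G (σ + (2 * Real.pi * w : ℝ) * Complex.I)‖ₑ ^ 2 := by
    intro c hc
    have h1 : ∫⁻ y : ℝ, ‖𝓕⁻ (u c) y‖ₑ ^ 2 = ∫⁻ y : ℝ, ‖𝓕 (u c) y‖ₑ ^ 2 := by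
      rw [← lintegral_neg_eq_self (fun y => ‖𝓕 (u c) y‖ₑ ^ 2)]
      simp_rw [Real.fourierInv_eq_fourier_neg]
    rw [h1, lintegral_enorm_sq_fourier (huint c hc) (hu2 c hc),
      ← lintegral_const_mul' _ _ (by simp)]
    apply lintegral_mono
    intro w
    simp only
    rw [← mul_pow]
    gcongr
    rw [hu]; simp only
    rw [enorm_mul]
    gcongr
    rw [← ofReal_norm, hre]
    apply ENNReal.ofReal_le_ofReal
    have : Real.exp (-c⁻¹ * w ^ 2) ≤ 1 := by
      rw [Real.exp_le_one_iff]
      have : 0 ≤ c⁻¹ * w ^ 2 := by positivity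
      linarith
    calc _ ≤ Real.exp (c⁻¹ * (a - k) ^ 2) * 1 := by gcongr
      _ = _ := mul_one _
  -- Fatou
  set X := ∫⁻ w : ℝ, ‖G (σ + (2 * Real.pi * w : ℝ) * Complex.I)‖ₑ ^ 2
  have hlim : ∀ᵐ y : ℝ, Tendsto (fun n : ℕ => ‖𝓕⁻ (u ((n : ℝ) + 1)) y‖ₑ ^ 2) atTop
      (𝓝 (‖h y * Complex.exp (-(σ : ℂ) * y)‖ₑ ^ 2)) := by
    filter_upwards [hcont] with y hy
    have hfy : ContinuousAt f y := hy.mul (by fun_prop)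
    have h1 := (tendsto_integral_cexp_mul_fourier hint hfy).comp
      (tendsto_atTop_add_const_right atTop (1:ℝ) tendsto_natCast_atTop_atTop)
    have h2 := h1.const_mul (Complex.exp (((K - σ) * y : ℝ)))
    have h3 : Tendsto (fun n : ℕ => 𝓕⁻ (u ((n : ℝ) + 1)) y) atTop
        (𝓝 (h y * Complex.exp (-(σ : ℂ) * y))) := by
      have e : Complex.exp (((K - σ) * y : ℝ)) * f y = h y * Complex.exp (-(σ : ℂ) * y) := by
        rw [hf]; simp only
        rw [mul_left_comm, ← Complex.exp_add]
        congr 2; push_cast; ring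
      rw [← e]
      refine h2.congr fun n => ?_
      simp only [Function.comp]
      have := hshift (n + 1) (by positivity) y
      push_cast at this ⊢
      rw [this, ← mul_assoc, ← Complex.exp_add]
      have : ((K:ℂ) - σ) * y + (σ - K) * y = 0 := by ring
      rw [this, Complex.exp_zero, one_mul]
    exact (ENNReal.continuous_pow 2).continuousAt.tendsto.comp h3.enorm
  have hmeas : ∀ n : ℕ, AEMeasurable (fun y => ‖𝓕⁻ (u ((n : ℝ) + 1)) y‖ₑ ^ 2) := by
    intro n
    have hcont : Continuous (𝓕⁻ (u ((n : ℝ) + 1))) := by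
      have : 𝓕⁻ (u ((n : ℝ) + 1)) = fun y => 𝓕 (u ((n : ℝ) + 1)) (-y) := by
        ext y; rw [Real.fourierInv_eq_fourier_neg]
      rw [this]
      have : Continuous (𝓕 (u ((n : ℝ) + 1))) :=
        VectorFourier.fourierIntegral_continuous Real.continuous_fourierChar
          (L := innerₗ ℝ) continuous_inner (huint _ (by positivity))
      fun_prop
    exact (hcont.enorm.measurable.pow_const 2).aemeasurable
  have hX : Tendsto (fun n : ℕ => ENNReal.ofReal (Real.exp (((n : ℝ) + 1)⁻¹ * (a - k) ^ 2)) ^ 2 * X)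
      atTop (𝓝 X) := by
    have h1 : Tendsto (fun n : ℕ => ((n : ℝ) + 1)⁻¹ * (a - k) ^ 2) atTop (𝓝 0) := by
      have := (tendsto_inv_atTop_zero.comp (tendsto_atTop_add_const_right atTop (1:ℝ)
        tendsto_natCast_atTop_atTop)).mul_const ((a - k) ^ 2)
      simpa using this
    have h2 : Tendsto (fun n : ℕ => ENNReal.ofReal (Real.exp (((n : ℝ) + 1)⁻¹ * (a - k) ^ 2)) ^ 2)
        atTop (𝓝 1) := by
      have := (ENNReal.continuous_pow 2).continuousAt.tendsto.comp
        (ENNReal.tendsto_ofReal ((Real.continuous_exp.tendsto 0).comp h1))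
      simpa [Function.comp_def] using this
    simpa using ENNReal.Tendsto.mul_const h2 (Or.inl one_ne_zero)
  calc ∫⁻ y : ℝ, ‖h y * Complex.exp (-(σ : ℂ) * y)‖ₑ ^ 2
      = ∫⁻ y : ℝ, liminf (fun n : ℕ => ‖𝓕⁻ (u ((n : ℝ) + 1)) y‖ₑ ^ 2) atTop := by
        apply lintegral_congr_ae
        filter_upwards [hlim] with y hy
        exact hy.liminf_eq.symm
    _ ≤ liminf (fun n : ℕ => ∫⁻ y : ℝ, ‖𝓕⁻ (u ((n : ℝ) + 1)) y‖ₑ ^ 2) atTop :=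
        lintegral_liminf_le' hmeas
    _ ≤ liminf (fun n : ℕ => ENNReal.ofReal (Real.exp (((n : ℝ) + 1)⁻¹ * (a - k) ^ 2)) ^ 2 * X)
          atTop := by
        exact liminf_le_liminf (Eventually.of_forall fun n => hc1 _ (by positivity))
    _ = X := hX.liminf_eq

/-- A bound for the exponentially damped `L²` norm bounds the `L¹` mean. -/
lemma intervalIntegral_norm_le_of_lintegral {h : ℝ → ℂ} (hm : Measurable h) {Y η δ : ℝ}
    (hY : 0 < Y) (hη : 0 ≤ η) (hδ : 0 < δ)
    (hX : ∫⁻ y : ℝ, ‖h y * Complex.exp (-((1 / Y : ℝ) : ℂ) * y)‖ₑ ^ 2 ≤ ENNReal.ofReal (η * Y)) :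
    ∫ y in (0:ℝ)..Y, ‖h y‖ ≤ (δ + Real.exp 2 * η / δ) * Y := by
  rw [intervalIntegral.integral_of_le hY.le,
    integral_eq_lintegral_of_nonneg_ae (Eventually.of_forall fun _ => norm_nonneg _)
      hm.norm.aestronglyMeasurable]
  apply ENNReal.toReal_le_of_le_ofReal (by positivity)
  have hpt : ∀ y ∈ Set.Ioc 0 Y, ENNReal.ofReal ‖h y‖ ≤ ENNReal.ofReal δ +
      ENNReal.ofReal (Real.exp 2 / δ) *
        ‖h y * Complex.exp (-((1 / Y : ℝ) : ℂ) * y)‖ₑ ^ 2 := by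
    intro y hy
    have h1 : ‖h y * Complex.exp (-((1 / Y : ℝ) : ℂ) * y)‖ = ‖h y‖ * Real.exp (-(y / Y)) := by
      rw [norm_mul, Complex.norm_exp]
      congr 2
      rw [← Complex.ofReal_neg, Complex.re_ofReal_mul, Complex.ofReal_re]
      ring
    rw [← ofReal_norm, ← ENNReal.ofReal_pow (norm_nonneg _),
      ← ENNReal.ofReal_mul (by positivity), ← ENNReal.ofReal_add hδ.le (by positivity)]
    apply ENNReal.ofReal_le_ofReal
    rw [h1, mul_pow, ← Real.exp_nat_mul]
    have h2 : 1 ≤ Real.exp 2 * Real.exp ((2:ℕ) * -(y / Y)) := by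
      rw [← Real.exp_add, Real.one_le_exp_iff]
      have : y / Y ≤ 1 := (div_le_one hY).2 hy.2
      push_cast; linarith
    have h3 : ‖h y‖ ≤ δ + ‖h y‖ ^ 2 / δ := by
      rw [← sub_nonneg]
      have : δ + ‖h y‖ ^ 2 / δ - ‖h y‖ = ((δ - ‖h y‖) ^ 2 + δ * ‖h y‖) / δ := by
        field_simp; ring
      rw [this]; positivity
    calc ‖h y‖ ≤ δ + ‖h y‖ ^ 2 / δ * 1 := by rwa [mul_one]
      _ ≤ δ + ‖h y‖ ^ 2 / δ * (Real.exp 2 * Real.exp ((2:ℕ) * -(y / Y))) := by gcongr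
      _ = _ := by ring
  calc ∫⁻ y in Set.Ioc 0 Y, ENNReal.ofReal ‖h y‖
      ≤ ∫⁻ y in Set.Ioc 0 Y, (ENNReal.ofReal δ + ENNReal.ofReal (Real.exp 2 / δ) *
        ‖h y * Complex.exp (-((1 / Y : ℝ) : ℂ) * y)‖ₑ ^ 2) :=
        setLIntegral_mono' measurableSet_Ioc hpt
    _ = ENNReal.ofReal δ * ENNReal.ofReal Y + ENNReal.ofReal (Real.exp 2 / δ) *
        ∫⁻ y in Set.Ioc 0 Y, ‖h y * Complex.exp (-((1 / Y : ℝ) : ℂ) * y)‖ₑ ^ 2 := by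
        rw [lintegral_add_left measurable_const, lintegral_const_mul' _ _ (by simp)]
        simp
    _ ≤ ENNReal.ofReal δ * ENNReal.ofReal Y + ENNReal.ofReal (Real.exp 2 / δ) *
        ENNReal.ofReal (η * Y) := by
        gcongr
        exact (setLIntegral_le_lintegral _ _).trans hX
    _ = ENNReal.ofReal ((δ + Real.exp 2 * η / δ) * Y) := by
        rw [← ENNReal.ofReal_mul hδ.le, ← ENNReal.ofReal_mul (by positivity),
          ← ENNReal.ofReal_add (by positivity) (by positivity)]
        congr 1; ring

/-- The `n`-th term of the Abel-type series for `(s - 1) ζ(s) - 1`. -/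
noncomputable def zetaTerm (n : ℕ) (s : ℂ) : ℂ :=
  (s - 1) * ((n + 1 : ℝ) : ℂ) ^ (-s) + ((n + 2 : ℝ) : ℂ) ^ (1 - s) - ((n + 1 : ℝ) : ℂ) ^ (1 - s)

lemma norm_cpow_neg_sub_le {N x : ℝ} (hN : 0 < N) (hx : x ∈ Set.Icc N (N + 1)) {s : ℂ}
    (hs : 0 ≤ s.re) :
    ‖(N : ℂ) ^ (-s) - (x : ℂ) ^ (-s)‖ ≤ ‖s‖ * N ^ (-(s.re + 1)) := by
  have hd : ∀ y ∈ Set.Icc N (N + 1), HasDerivWithinAt (fun y : ℝ => (y : ℂ) ^ (-s))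
      (-s * (y : ℂ) ^ (-s - 1)) (Set.Icc N (N + 1)) y := by
    intro y hy
    have hy0 : 0 < y := hN.trans_le hy.1
    by_cases h0 : s = 0
    · subst h0
      simpa using (hasDerivWithinAt_const y (Set.Icc N (N + 1)) (1 : ℂ))
    · exact (hasDerivAt_ofReal_cpow_const hy0.ne' (neg_ne_zero.mpr h0)).hasDerivWithinAt
  have h := norm_image_sub_le_of_norm_deriv_le_segment' (C := ‖s‖ * N ^ (-(s.re + 1))) hd
    (by
      intro y hy
      have hy0 : 0 < y := hN.trans_le hy.1
      rw [norm_mul, norm_neg, Complex.norm_cpow_eq_rpow_re_of_pos hy0]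
      gcongr
      have : (-s - 1).re = -(s.re + 1) := by simp; ring
      rw [this]
      exact Real.rpow_le_rpow_of_nonpos hN hy.1 (by linarith)) x hx
  rw [norm_sub_rev]
  refine h.trans ?_
  have : 0 ≤ ‖s‖ * N ^ (-(s.re + 1)) := by positivity
  nlinarith [hx.2]

lemma norm_zetaTerm_le {p : ℝ} (hp0 : 0 ≤ p) (hp1 : p ≤ 1) (n : ℕ) {s : ℂ} (hs : 0 ≤ s.re) :
    ‖zetaTerm n s‖ ≤ 2 * ‖s - 1‖ * ‖s‖ ^ p * (n + 1 : ℝ) ^ (-(s.re + p)) := by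
  set N : ℝ := n + 1 with hNdef
  have hN : 0 < N := by positivity
  have hN1 : 1 ≤ N := by rw [hNdef]; linarith [n.cast_nonneg (α := ℝ)]
  rcases eq_or_ne s 1 with rfl | hs1
  · have : zetaTerm n 1 = 0 := by simp [zetaTerm]
    rw [this]; simp
  have hd : ∀ y ∈ Set.Icc N (N + 1), HasDerivWithinAt
      (fun y : ℝ => (s - 1) * (N : ℂ) ^ (-s) * y + (y : ℂ) ^ (1 - s))
      ((s - 1) * ((N : ℂ) ^ (-s) - (y : ℂ) ^ (-s))) (Set.Icc N (N + 1)) y := by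
    intro y hy
    have hy0 : 0 < y := hN.trans_le hy.1
    have h1 := hasDerivAt_ofReal_cpow_const (r := 1 - s) hy0.ne' (sub_ne_zero.mpr hs1.symm)
    have h2 : HasDerivAt (fun y : ℝ => (s - 1) * (N : ℂ) ^ (-s) * y)
        ((s - 1) * (N : ℂ) ^ (-s) * 1) y := (Complex.ofRealCLM.hasDerivAt (x := y)).const_mul _
    have h3 := (h2.add h1).hasDerivWithinAt (s := Set.Icc N (N + 1))
    rw [show (s - 1) * (N : ℂ) ^ (-s) * 1 + (1 - s) * (y : ℂ) ^ (1 - s - 1) =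
      (s - 1) * ((N : ℂ) ^ (-s) - (y : ℂ) ^ (-s)) by
        rw [show (1 : ℂ) - s - 1 = -s by ring]; ring] at h3
    exact h3
  have hb : ∀ y ∈ Set.Icc N (N + 1), ‖(N : ℂ) ^ (-s) - (y : ℂ) ^ (-s)‖ ≤
      2 * ‖s‖ ^ p * N ^ (-(s.re + p)) := by
    intro y hy
    have h1 := norm_cpow_neg_sub_le hN hy hs
    have hy0 : 0 < y := hN.trans_le hy.1
    have h2 : ‖(N : ℂ) ^ (-s) - (y : ℂ) ^ (-s)‖ ≤ 2 * N ^ (-s.re) := by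
      refine (norm_sub_le _ _).trans ?_
      rw [Complex.norm_cpow_eq_rpow_re_of_pos hN, Complex.norm_cpow_eq_rpow_re_of_pos hy0,
        Complex.neg_re]
      have := Real.rpow_le_rpow_of_nonpos hN hy.1 (show -s.re ≤ 0 by linarith)
      linarith
    have e1 : N ^ (-(s.re + p)) = N ^ (-s.re) * N ^ (-p) := by
      rw [← Real.rpow_add hN]; ring_nf
    have e2 : N ^ (-(s.re + 1)) = N ^ (-s.re) * N ^ (-1 : ℝ) := by
      rw [← Real.rpow_add hN]; ring_nf
    have e3 : ‖s‖ ^ p * N ^ (-p) = (‖s‖ / N) ^ p := by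
      rw [Real.div_rpow (norm_nonneg _) hN.le, Real.rpow_neg hN.le]; rfl
    rw [e1, show 2 * ‖s‖ ^ p * (N ^ (-s.re) * N ^ (-p)) =
      N ^ (-s.re) * (2 * (‖s‖ ^ p * N ^ (-p))) by ring, e3]
    have hpos : 0 < N ^ (-s.re) := by positivity
    rcases le_total (‖s‖ / N) 1 with h | h
    · refine h1.trans ?_
      rw [e2, Real.rpow_neg_one, show ‖s‖ * (N ^ (-s.re) * N⁻¹) = N ^ (-s.re) * (‖s‖ / N) by
        rw [div_eq_mul_inv]; ring]
      gcongr
      have h0 : 0 ≤ ‖s‖ / N := by positivity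
      have : ‖s‖ / N ≤ (‖s‖ / N) ^ p := by
        conv_lhs => rw [← Real.rpow_one (‖s‖ / N)]
        rcases h0.eq_or_lt with h0 | h0
        · rw [← h0, Real.zero_rpow one_ne_zero]; positivity
        · exact Real.rpow_le_rpow_of_exponent_ge h0 h hp1
      have : 0 ≤ (‖s‖ / N) ^ p := by positivity
      linarith
    · refine h2.trans ?_
      have := Real.one_le_rpow h hp0
      nlinarith
  have h := norm_image_sub_le_of_norm_deriv_le_segment'
    (C := ‖s - 1‖ * (2 * ‖s‖ ^ p * N ^ (-(s.re + p)))) hd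
    (by
      intro y hy
      rw [norm_mul]
      gcongr
      exact hb y ⟨hy.1, hy.2.le⟩) (N + 1) ⟨by linarith, le_rfl⟩
  have e : zetaTerm n s = (s - 1) * (N : ℂ) ^ (-s) * ((N + 1 : ℝ) : ℂ) + ((N + 1 : ℝ) : ℂ) ^ (1 - s)
      - ((s - 1) * (N : ℂ) ^ (-s) * (N : ℂ) + (N : ℂ) ^ (1 - s)) := by
    have : N + 1 = n + 2 := by rw [hNdef]; ring
    rw [zetaTerm, this, ← hNdef, ← this]
    push_cast
    ring
  rw [e]
  refine h.trans (le_of_eq ?_)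
  ring

lemma differentiable_zetaTerm (n : ℕ) : Differentiable ℂ (zetaTerm n) := by
  unfold zetaTerm
  have h1 : ((n + 1 : ℝ) : ℂ) ≠ 0 := by exact_mod_cast (by positivity : (n + 1 : ℝ) ≠ 0)
  have h2 : ((n + 2 : ℝ) : ℂ) ≠ 0 := by exact_mod_cast (by positivity : (n + 2 : ℝ) ≠ 0)
  intro s
  have a1 : DifferentiableAt ℂ (fun s : ℂ => ((n + 1 : ℝ) : ℂ) ^ (-s)) s :=
    (differentiableAt_id.neg).const_cpow (Or.inl h1)
  have a2 : DifferentiableAt ℂ (fun s : ℂ => ((n + 2 : ℝ) : ℂ) ^ (1 - s)) s :=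
    (differentiableAt_id.const_sub 1).const_cpow (Or.inl h2)
  have a3 : DifferentiableAt ℂ (fun s : ℂ => ((n + 1 : ℝ) : ℂ) ^ (1 - s)) s :=
    (differentiableAt_id.const_sub 1).const_cpow (Or.inl h1)
  exact (((differentiableAt_id.sub_const 1).mul a1).add a2).sub a3

lemma summable_succ_rpow {c : ℝ} (hc : 1 < c) : Summable fun n : ℕ => (n + 1 : ℝ) ^ (-c) := by
  have := (summable_nat_add_iff 1).mpr (Real.summable_nat_rpow.mpr (show -c < -1 by linarith))
  simpa using this

lemma summable_zetaTerm {s : ℂ} (hs : 0 < s.re) : Summable fun n => zetaTerm n s :=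
  Summable.of_norm_bounded ((summable_succ_rpow (c := s.re + 1) (by linarith)).mul_left
    (2 * ‖s - 1‖ * ‖s‖ ^ (1 : ℝ))) fun n => norm_zetaTerm_le zero_le_one le_rfl n hs.le

lemma riemannZeta₁_eq_one_add_tsum_of_one_lt {s : ℂ} (hs : 1 < s.re) :
    riemannZeta₁ s = 1 + ∑' n, zetaTerm n s := by
  have hs1 : s ≠ 1 := by rintro rfl; simp at hs
  have hz : riemannZeta₁ s = (s - 1) * riemannZeta s := by
    rw [riemannZeta_eq_inv_sub_mul hs1, ← mul_assoc, mul_inv_cancel₀ (sub_ne_zero.mpr hs1), one_mul]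
  have hsum : HasSum (fun n : ℕ => ((n + 1 : ℝ) : ℂ) ^ (-s)) (riemannZeta s) := by
    rw [zeta_eq_tsum_one_div_nat_add_one_cpow hs]
    have : (fun n : ℕ => ((n + 1 : ℝ) : ℂ) ^ (-s)) = fun n : ℕ => 1 / ((n : ℂ) + 1) ^ s := by
      funext n
      rw [Complex.cpow_neg, one_div]; push_cast; rfl
    rw [this]
    exact ((summable_nat_add_iff 1).mpr (Complex.summable_one_div_nat_cpow.mpr hs)).congr
      (fun n => by push_cast; rfl) |>.hasSum
  have h1 := (hsum.mul_left (s - 1)).tendsto_sum_nat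
  have h2 : Tendsto (fun n : ℕ => ((n + 1 : ℝ) : ℂ) ^ (1 - s)) atTop (𝓝 0) := by
    rw [tendsto_zero_iff_norm_tendsto_zero]
    have : Tendsto (fun n : ℕ => (n + 1 : ℝ) ^ (-(s.re - 1))) atTop (𝓝 0) :=
      (tendsto_rpow_neg_atTop (by linarith)).comp
        (tendsto_natCast_atTop_atTop.atTop_add tendsto_const_nhds)
    refine this.congr fun n => ?_
    rw [Complex.norm_cpow_eq_rpow_re_of_pos (by positivity)]
    simp
  have h3 : Tendsto (fun m : ℕ => ∑ n ∈ Finset.range m, zetaTerm n s) atTop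
      (𝓝 ((s - 1) * riemannZeta s + (0 - 1))) := by
    refine (h1.add (h2.sub_const 1)).congr fun m => ?_
    induction m with
    | zero => simp
    | succ k ih =>
      rw [Finset.sum_range_succ, Finset.sum_range_succ, ← ih, zetaTerm]
      push_cast
      ring_nf
  have := tendsto_nhds_unique h3 (summable_zetaTerm (by linarith)).hasSum.tendsto_sum_nat
  rw [hz, ← this]; ring

lemma riemannZeta₁_eq_one_add_tsum {s : ℂ} (hs : 0 < s.re) :
    riemannZeta₁ s = 1 + ∑' n, zetaTerm n s := by
  have hU : IsOpen {s : ℂ | 0 < s.re} := isOpen_lt continuous_const Complex.continuous_re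
  have hd : DifferentiableOn ℂ (fun s => 1 + ∑' n, zetaTerm n s) {s : ℂ | 0 < s.re} := by
    intro z hz
    have hz' : 0 < z.re := hz
    set V : Set ℂ := {s : ℂ | z.re / 2 < s.re} ∩ Metric.ball 0 (‖z‖ + 1) with hV
    have hVo : IsOpen V := (isOpen_lt continuous_const Complex.continuous_re).inter Metric.isOpen_ball
    have hzV : z ∈ V := ⟨by simp only [Set.mem_ofPred_eq]; linarith, by simp⟩
    have : DifferentiableOn ℂ (fun s => ∑' n, zetaTerm n s) V := by
      refine Complex.differentiableOn_tsum_of_summable_norm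
        (u := fun n : ℕ => 2 * (‖z‖ + 2) * (‖z‖ + 1) * (n + 1 : ℝ) ^ (-(z.re / 2 + 1)))
        ((summable_succ_rpow (by linarith)).mul_left _)
        (fun n => (differentiable_zetaTerm n).differentiableOn) hVo ?_
      intro n w hw
      have hwr : z.re / 2 < w.re := hw.1
      have hwn : ‖w‖ ≤ ‖z‖ + 1 := (mem_ball_zero_iff.mp hw.2).le
      refine (norm_zetaTerm_le zero_le_one le_rfl n (by linarith)).trans ?_
      rw [Real.rpow_one]
      have : ‖w - 1‖ ≤ ‖z‖ + 2 := (norm_sub_le _ _).trans (by rw [norm_one]; linarith)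
      gcongr
      linarith [n.cast_nonneg (α := ℝ)]
    exact ((this.differentiableAt (hVo.mem_nhds hzV)).const_add 1).differentiableWithinAt
  have hpc : IsPreconnected {s : ℂ | 0 < s.re} :=
    (convex_halfSpace_re_gt 0).isPreconnected
  have h := AnalyticOnNhd.eqOn_of_preconnected_of_eventuallyEq
    (differentiable_riemannZeta₁.differentiableOn.analyticOnNhd hU) (hd.analyticOnNhd hU) hpc
    (z₀ := 2) (by simp) (by
      filter_upwards [(isOpen_lt continuous_const Complex.continuous_re).mem_nhds
        (show (2 : ℂ) ∈ {s : ℂ | (1 : ℝ) < s.re} by simp)] with w hw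
      exact riemannZeta₁_eq_one_add_tsum_of_one_lt hw)
  exact h hs

lemma exists_norm_riemannZeta₁_le {p σ : ℝ} (hp0 : 0 ≤ p) (hp1 : p ≤ 1) (h : 1 < σ + p) :
    ∃ C, 0 ≤ C ∧ ∀ s : ℂ, σ ≤ s.re → ‖riemannZeta₁ s‖ ≤ 1 + C * (‖s - 1‖ * ‖s‖ ^ p) := by
  refine ⟨2 * ∑' n : ℕ, (n + 1 : ℝ) ^ (-(σ + p)), by positivity, fun s hs => ?_⟩
  have hs0 : 0 < s.re := by linarith
  rw [riemannZeta₁_eq_one_add_tsum hs0]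
  refine (norm_add_le _ _).trans ?_
  rw [norm_one]
  gcongr
  have hb : ∀ n : ℕ, ‖zetaTerm n s‖ ≤ 2 * ‖s - 1‖ * ‖s‖ ^ p * (n + 1 : ℝ) ^ (-(σ + p)) := by
    intro n
    refine (norm_zetaTerm_le hp0 hp1 n hs0.le).trans ?_
    gcongr
    linarith [n.cast_nonneg (α := ℝ)]
  refine (tsum_of_norm_bounded ((summable_succ_rpow h).mul_left _).hasSum hb).trans (le_of_eq ?_)
  rw [tsum_mul_left]; ring

lemma riemannZeta₁_eq {s : ℂ} (hs : s ≠ 1) : riemannZeta₁ s = (s - 1) * riemannZeta s := by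
  rw [riemannZeta_eq_inv_sub_mul hs, ← mul_assoc, mul_inv_cancel₀ (sub_ne_zero.mpr hs), one_mul]

lemma riemannZeta₁_conj (s : ℂ) :
    riemannZeta₁ (starRingEnd ℂ s) = starRingEnd ℂ (riemannZeta₁ s) := by
  rcases eq_or_ne s 1 with rfl | hs
  · simp
  · have hs' : starRingEnd ℂ s ≠ 1 := fun h => hs (by simpa using congrArg (starRingEnd ℂ) h)
    rw [riemannZeta₁_eq hs, riemannZeta₁_eq hs', riemannZeta_conj]
    simp

lemma zetaTerm_half (n : ℕ) :
    zetaTerm n (1 / 2) = ((-(1 / 2) * (√(n + 1 : ℝ))⁻¹ + √(n + 2 : ℝ) - √(n + 1 : ℝ) : ℝ) : ℂ) := by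
  have h1 : (0 : ℝ) ≤ n + 1 := by positivity
  have h2 : (0 : ℝ) ≤ n + 2 := by positivity
  have e1 : (-(1 / 2) : ℂ) = ((-(1 / 2) : ℝ) : ℂ) := by push_cast; ring
  have e2 : (1 - 1 / 2 : ℂ) = ((1 / 2 : ℝ) : ℂ) := by push_cast; ring
  rw [zetaTerm, e2, e1, ← Complex.ofReal_cpow h1, ← Complex.ofReal_cpow h1, ← Complex.ofReal_cpow h2,
    Real.rpow_neg h1, ← Real.sqrt_eq_rpow, ← Real.sqrt_eq_rpow]
  push_cast
  ring

lemma half_le_re_riemannZeta₁_half : 1 / 2 ≤ (riemannZeta₁ (1 / 2)).re := by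
  have hpos : 0 < (1 / 2 : ℂ).re := by norm_num
  rw [riemannZeta₁_eq_one_add_tsum hpos]
  have hs := (Complex.hasSum_re (summable_zetaTerm hpos).hasSum).tendsto_sum_nat
  have hb : ∀ m : ℕ, -(1 / 2) * (1 - (√(m + 1 : ℝ))⁻¹) ≤
      ∑ n ∈ Finset.range m, (zetaTerm n (1 / 2)).re := by
    intro m
    induction m with
    | zero => simp
    | succ k ih =>
      rw [Finset.sum_range_succ, zetaTerm_half, Complex.ofReal_re]
      have e : ((k + 1 : ℕ) : ℝ) + 1 = k + 2 := by push_cast; ring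
      rw [e]
      have ha : 0 < √(k + 1 : ℝ) := Real.sqrt_pos.mpr (by positivity)
      have hab : √(k + 1 : ℝ) ≤ √(k + 2 : ℝ) := Real.sqrt_le_sqrt (by linarith)
      have hsq : √(k + 2 : ℝ) ^ 2 - √(k + 1 : ℝ) ^ 2 = 1 := by
        rw [Real.sq_sqrt (by positivity), Real.sq_sqrt (by positivity)]; ring
      have hb : 0 < √(k + 2 : ℝ) := ha.trans_le hab
      have key : (1 / 2) * (√(k + 2 : ℝ))⁻¹ ≤ √(k + 2 : ℝ) - √(k + 1 : ℝ) := by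
        rw [← div_eq_mul_inv, div_le_iff₀ hb]
        nlinarith
      linarith
  have hlim := ge_of_tendsto hs (b := -(1 / 2)) (Eventually.of_forall fun m => by
    refine le_trans ?_ (hb m)
    have : 0 ≤ (√(m + 1 : ℝ))⁻¹ := by positivity
    linarith)
  simp only [Complex.add_re, Complex.one_re]
  linarith

lemma riemannZeta_half_ne_zero : riemannZeta (1 / 2) ≠ 0 := by
  intro h
  have h1 := half_le_re_riemannZeta₁_half
  rw [riemannZeta₁_eq (by norm_num), h] at h1
  norm_num at h1

/-- Zeros of `riemannZeta₁` to the right of `-2` lie on the critical line. -/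
lemma re_eq_half_of_riemannZeta₁_eq_zero
    (hRH : ∀ ρ : ℂ, riemannZeta ρ = 0 → 0 < ρ.re → ρ.re < 1 → ρ.re = 1 / 2)
    {s : ℂ} (h : riemannZeta₁ s = 0) (hs : -2 < s.re) : s.re = 1 / 2 := by
  have hs1 : s ≠ 1 := by rintro rfl; simp at h
  have hz : riemannZeta s = 0 := by
    rw [riemannZeta₁_eq hs1] at h
    exact (mul_eq_zero.mp h).resolve_left (sub_ne_zero.mpr hs1)
  rcases le_or_gt 1 s.re with h1 | h1
  · exact absurd hz (riemannZeta_ne_zero_of_one_le_re h1)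
  rcases lt_or_ge 0 s.re with h0 | h0
  · exact hRH s hz h0 h1
  exfalso
  rcases eq_or_ne s 0 with rfl | hne
  · rw [riemannZeta_zero] at hz; norm_num at hz
  have hw : 1 ≤ (1 - s).re := by simp; linarith
  have hw' : (1 - s).re < 3 := by simp; linarith
  have hf := riemannZeta_one_sub (s := 1 - s) (by
    intro n hn
    have := congrArg Complex.re hn
    simp only [Complex.neg_re, Complex.natCast_re] at this
    have : (0:ℝ) ≤ n := n.cast_nonneg
    linarith) (by simpa using hne)
  rw [sub_sub_cancel, hz] at hf
  have hG : Complex.Gamma (1 - s) ≠ 0 := Complex.Gamma_ne_zero_of_re_pos (by linarith)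
  have hZ : riemannZeta (1 - s) ≠ 0 := riemannZeta_ne_zero_of_one_le_re hw
  have hc : Complex.cos (Real.pi * (1 - s) / 2) ≠ 0 := by
    rw [Complex.cos_ne_zero_iff]
    intro k hk
    have hpi : (Real.pi : ℂ) ≠ 0 := by exact_mod_cast Real.pi_ne_zero
    have h2 : 1 - s = 2 * k + 1 := by
      field_simp at hk
      exact hk
    have h3 := congrArg Complex.re h2
    have h4 : (2 * (k : ℂ) + 1).re = 2 * k + 1 := by simp
    rw [h4] at h3
    rw [h3] at hw hw'
    have : k = 0 := by
      have a : (0 : ℝ) ≤ k := by linarith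
      have b : (k : ℝ) < 1 := by linarith
      have a' : 0 ≤ k := by exact_mod_cast a
      have b' : k < 1 := by exact_mod_cast b
      omega
    subst this
    apply hne
    simpa using h2
  simp [hG, hZ, hc] at hf

/-- A uniform bound for `1/ζ` in the half-plane of absolute convergence. -/
lemma exists_norm_inv_riemannZeta_le :
    ∃ C, 0 < C ∧ ∀ s : ℂ, 3 / 2 ≤ s.re → ‖(riemannZeta s)⁻¹‖ ≤ C := by
  have hs32 : Summable fun n : ℕ => (n : ℝ) ^ (-(3 / 2 : ℝ)) :=
    Real.summable_nat_rpow.mpr (by norm_num)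
  refine ⟨1 + ∑' n : ℕ, (n : ℝ) ^ (-(3 / 2 : ℝ)), by positivity, fun s hs => ?_⟩
  have h1 : 1 < s.re := by linarith
  have h := ArithmeticFunction.LSeries_zeta_mul_Lseries_moebius h1
  rw [ArithmeticFunction.LSeries_zeta_eq_riemannZeta h1] at h
  rw [inv_eq_of_mul_eq_one_right h]
  have : ‖LSeries (fun n => ((ArithmeticFunction.moebius n : ℤ) : ℂ)) s‖ ≤
      ∑' n : ℕ, (n : ℝ) ^ (-(3 / 2 : ℝ)) := by
    refine tsum_of_norm_bounded hs32.hasSum fun n => ?_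
    rcases eq_or_ne n 0 with rfl | hn
    · simp
    rw [LSeries.norm_term_eq, if_neg hn]
    have hn1 : (1 : ℝ) ≤ n := by exact_mod_cast Nat.one_le_iff_ne_zero.mpr hn
    rw [div_eq_mul_inv, ← Real.rpow_neg (by positivity)]
    have hm : ‖((ArithmeticFunction.moebius n : ℤ) : ℂ)‖ ≤ 1 := by
      rw [Complex.norm_intCast]
      exact_mod_cast ArithmeticFunction.abs_moebius_le_one
    calc _ ≤ 1 * (n : ℝ) ^ (-s.re) := by gcongr
      _ ≤ _ := by rw [one_mul]; gcongr
  linarith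

/-- `1/ζ` is bounded on the line `Re s = -1/2`. -/
lemma exists_norm_inv_riemannZeta_le_neg_half :
    ∃ C, 0 < C ∧ ∀ s : ℂ, s.re = -1 / 2 → ‖(riemannZeta s)⁻¹‖ ≤ C := by
  obtain ⟨C, hC, hb⟩ := exists_norm_inv_riemannZeta_le
  set κ : ℝ := ‖2 * (2 * (Real.pi : ℂ)) ^ (-(3 / 2 : ℂ))‖ with hκ
  have hκ0 : 0 < κ := by
    have : (2 * (Real.pi : ℂ)) ≠ 0 := by simp [Real.pi_ne_zero]
    rw [hκ, norm_pos_iff]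
    simp [Complex.cpow_eq_zero_iff, this]
  refine ⟨C * (κ⁻¹ * 2), by positivity, fun s hs => ?_⟩
  set w : ℂ := 1 - s with hw
  have hwr : w.re = 3 / 2 := by rw [hw]; simp; linarith
  have hf := riemannZeta_one_sub (s := w) (by
    intro n hn
    have := congrArg Complex.re hn
    simp only [Complex.neg_re, Complex.natCast_re] at this
    have : (0:ℝ) ≤ n := n.cast_nonneg
    linarith) (by rintro h; rw [h] at hwr; norm_num at hwr)
  rw [hw, sub_sub_cancel, ← hw] at hf
  set X : ℂ := Complex.Gamma w * Complex.cos (Real.pi * w / 2) with hX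
  have hconj : starRingEnd ℂ w = 3 - w := by
    apply Complex.ext
    · simp; linarith
    · simp
  have hXX : X * starRingEnd ℂ X = ((w - 1) * (starRingEnd ℂ w - 1)) * (Real.pi / 2) := by
    have hw1 : w - 1 ≠ 0 := by
      intro h; have := congrArg Complex.re h; simp at this; linarith
    have hw2 : 2 - w ≠ 0 := by
      intro h; have := congrArg Complex.re h; simp at this; linarith
    have hG1 : Complex.Gamma w = (w - 1) * Complex.Gamma (w - 1) := by
      have := Complex.Gamma_add_one (w - 1) hw1
      rwa [sub_add_cancel] at this
    have hG2 : Complex.Gamma (3 - w) = (2 - w) * Complex.Gamma (1 - (w - 1)) := by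
      have := Complex.Gamma_add_one (2 - w) hw2
      rw [show (2 - w + 1 : ℂ) = 3 - w by ring] at this
      rw [this]; ring_nf
    have hrefl := Complex.Gamma_mul_Gamma_one_sub (w - 1)
    have hsin : Complex.sin (Real.pi * (w - 1)) ≠ 0 := by
      intro h
      rw [h, div_zero] at hrefl
      rcases mul_eq_zero.mp hrefl with h | h
      · exact Complex.Gamma_ne_zero_of_re_pos (by simp; linarith) h
      · exact Complex.Gamma_ne_zero_of_re_pos (by simp; linarith) h
    have hXc : starRingEnd ℂ X = Complex.Gamma (3 - w) * Complex.cos (Real.pi * (3 - w) / 2) := by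
      rw [hX, map_mul, ← Complex.Gamma_conj, ← Complex.cos_conj, ← hconj]
      simp [map_ofNat]
    have hcos : Complex.cos (Real.pi * (3 - w) / 2) = -Complex.sin (Real.pi * w / 2) := by
      rw [show Real.pi * (3 - w) / 2 = (Real.pi / 2 - Real.pi * w / 2) + Real.pi by ring,
        Complex.cos_add_pi, Complex.cos_pi_div_two_sub]
    have hs2 : Complex.sin (Real.pi * (w - 1)) =
        -(2 * Complex.sin (Real.pi * w / 2) * Complex.cos (Real.pi * w / 2)) := by
      rw [← Complex.sin_two_mul, show Real.pi * (w - 1) = 2 * (Real.pi * w / 2) - Real.pi by ring,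
        Complex.sin_sub_pi]
    rw [hXc, hX, hcos, hG1, hG2, hconj]
    calc _ = (w - 1) * (2 - w) * (Complex.Gamma (w - 1) * Complex.Gamma (1 - (w - 1))) *
          (-(2 * Complex.sin (Real.pi * w / 2) * Complex.cos (Real.pi * w / 2)) / 2) := by ring
      _ = _ := by
        rw [hrefl, ← hs2, show (3 - w - 1 : ℂ) = 2 - w by ring]
        generalize Complex.sin (Real.pi * (w - 1)) = S at hsin
        field_simp
  have hXn : 1 / 2 ≤ ‖X‖ := by
    have h1 := congrArg norm hXX
    have h0 : starRingEnd ℂ w - 1 = starRingEnd ℂ (w - 1) := by simp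
    rw [norm_mul X, RCLike.norm_conj, h0, norm_mul (_ * _), norm_mul (w - 1), RCLike.norm_conj] at h1
    have h2 : 1 / 2 ≤ ‖w - 1‖ := by
      refine le_trans ?_ (Complex.abs_re_le_norm _)
      rw [Complex.sub_re, hwr]; norm_num
    have h3 : ‖(Real.pi / 2 : ℂ)‖ = Real.pi / 2 := by
      rw [norm_div, Complex.norm_real, Real.norm_of_nonneg Real.pi_pos.le]; simp
    rw [h3] at h1
    have := Real.pi_gt_three
    by_contra hlt
    push Not at hlt
    have a : ‖X‖ * ‖X‖ < 1 / 2 * (1 / 2) := by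
      apply mul_lt_mul'' hlt hlt (norm_nonneg _) (norm_nonneg _)
    nlinarith
  have hnorm : ‖riemannZeta s‖ = κ * ‖X‖ * ‖riemannZeta w‖ := by
    rw [hf, hX, hκ]
    simp only [norm_mul, ← mul_assoc]
    have : ‖(2 * (Real.pi : ℂ)) ^ (-w)‖ = ‖(2 * (Real.pi : ℂ)) ^ (-(3 / 2 : ℂ))‖ := by
      have h2 : (2 * (Real.pi : ℂ)) = ((2 * Real.pi : ℝ) : ℂ) := by push_cast; rfl
      rw [h2, Complex.norm_cpow_eq_rpow_re_of_pos (by positivity),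
        Complex.norm_cpow_eq_rpow_re_of_pos (by positivity)]
      simp [hwr]
    rw [this]
  rw [norm_inv, hnorm, mul_inv, mul_inv, mul_comm, ← norm_inv (riemannZeta w)]
  have h2 : ‖X‖⁻¹ ≤ 2 := by
    rw [inv_le_comm₀ (by linarith) two_pos]; linarith
  have := hb w (by linarith)
  gcongr

lemma Complex.norm_Gamma_le {s : ℂ} (hs : 0 < s.re) : ‖Complex.Gamma s‖ ≤ Real.Gamma s.re := by
  rw [Complex.Gamma_eq_integral hs, Complex.GammaIntegral, Real.Gamma_eq_integral hs]
  refine (norm_integral_le_integral_norm _).trans (le_of_eq ?_)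
  refine setIntegral_congr_fun measurableSet_Ioi fun x hx => ?_
  have hx : (0:ℝ) < x := hx
  simp only [norm_mul, Complex.norm_real, Complex.norm_cpow_eq_rpow_re_of_pos hx]
  rw [Real.norm_of_nonneg (Real.exp_pos _).le]
  simp

lemma Complex.norm_cos_le_exp (z : ℂ) : ‖Complex.cos z‖ ≤ Real.exp |z.im| := by
  rw [Complex.cos, norm_div, RCLike.norm_ofNat]
  have h1 : ‖Complex.exp (z * Complex.I)‖ ≤ Real.exp |z.im| := by
    rw [Complex.norm_exp]; simp [neg_le_abs]
  have h2 : ‖Complex.exp (-z * Complex.I)‖ ≤ Real.exp |z.im| := by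
    rw [Complex.norm_exp]; simp [le_abs_self]
  have := norm_add_le (Complex.exp (z * Complex.I)) (Complex.exp (-z * Complex.I))
  linarith

/-- Crude exponential growth of `(s - 1) ζ(s)` in a strip. -/
lemma exists_norm_riemannZeta₁_le_exp :
    ∃ C, 0 < C ∧ ∀ w : ℂ, -1 ≤ w.re → w.re ≤ 6 → 1 ≤ |w.im| →
      ‖riemannZeta₁ w‖ ≤ Real.exp (C * |w.im|) := by
  obtain ⟨C₁, hC₁, hz⟩ := exists_norm_riemannZeta₁_le (p := 1) (σ := 1 / 2) zero_le_one le_rfl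
    (by norm_num)
  obtain ⟨C₂, hC₂⟩ := (isCompact_Icc (a := (1/2:ℝ)) (b := 2)).bddAbove_image
    (f := Real.Gamma) (fun x hx => (Real.differentiableAt_Gamma fun m hm => by
      have : (0:ℝ) ≤ m := m.cast_nonneg
      linarith [hx.1]).continuousAt.continuousWithinAt)
  have hpoly : ∀ w : ℂ, 1 / 2 ≤ w.re → w.re ≤ 6 → 1 ≤ |w.im| →
      ‖riemannZeta₁ w‖ ≤ (1 + 56 * C₁) * Real.exp (2 * |w.im|) := by
    intro w h1 h2 h3
    refine (hz w h1).trans ?_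
    rw [Real.rpow_one]
    have a1 : ‖w‖ ≤ 7 * |w.im| := by
      refine (Complex.norm_le_abs_re_add_abs_im w).trans ?_
      rw [abs_of_nonneg (by linarith : 0 ≤ w.re)]; linarith
    have a2 : ‖w - 1‖ ≤ 8 * |w.im| := by
      refine (norm_sub_le _ _).trans ?_
      rw [norm_one]; linarith
    have a3 : ‖w - 1‖ * ‖w‖ ≤ 56 * |w.im| ^ 2 := by
      calc _ ≤ (8 * |w.im|) * (7 * |w.im|) := by gcongr
        _ = _ := by ring
    have a4 : |w.im| ^ 2 ≤ Real.exp (2 * |w.im|) := by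
      rw [two_mul, Real.exp_add, ← pow_two]
      gcongr
      linarith [Real.add_one_le_exp |w.im|]
    have a5 : 1 ≤ Real.exp (2 * |w.im|) := Real.one_le_exp (by positivity)
    have : C₁ * (‖w - 1‖ * ‖w‖) ≤ C₁ * (56 * Real.exp (2 * |w.im|)) := by
      exact mul_le_mul_of_nonneg_left (by linarith) hC₁
    linarith
  have hall : ∃ D, 1 ≤ D ∧ ∀ w : ℂ, -1 ≤ w.re → w.re ≤ 6 → 1 ≤ |w.im| →
      ‖riemannZeta₁ w‖ ≤ D * Real.exp (6 * |w.im|) := by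
    have hC₂0 : 0 ≤ C₂ := (Real.Gamma_pos_of_pos one_pos).le.trans (hC₂ ⟨1, by norm_num, rfl⟩)
    refine ⟨(1 + 56 * C₁) * (1 + 14 * C₂), ?_, ?_⟩
    · have : 0 ≤ C₁ * C₂ := by positivity
      nlinarith
    intro w h1 h2 h3
    have he : Real.exp (2 * |w.im|) ≤ Real.exp (6 * |w.im|) := by gcongr; norm_num
    rcases le_or_gt (1 / 2) w.re with h | h
    · refine (hpoly w h h2 h3).trans ?_
      have : (1 + 56 * C₁) ≤ (1 + 56 * C₁) * (1 + 14 * C₂) :=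
        le_mul_of_one_le_right (by positivity) (by linarith)
      gcongr
    · set s : ℂ := 1 - w with hs
      have hsr : s.re = 1 - w.re := by simp [hs]
      have hsi : s.im = -w.im := by simp [hs]
      have him : w.im ≠ 0 := by intro h; rw [h] at h3; norm_num at h3
      have hs1 : s ≠ 1 := by
        intro h; have := congrArg Complex.im h; rw [hsi] at this; simp [him] at this
      have hw1 : w ≠ 1 := by
        intro h; rw [h] at him; simp at him
      have hf := riemannZeta_one_sub (s := s) (by
        intro n hn
        have := congrArg Complex.im hn
        rw [hsi] at this; simp [him] at this) hs1
      rw [hs, sub_sub_cancel, ← hs] at hf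
      have b1 : ‖riemannZeta s‖ ≤ (1 + 56 * C₁) * Real.exp (2 * |w.im|) := by
        have := hpoly s (by rw [hsr]; linarith) (by rw [hsr]; linarith)
          (by rw [hsi, abs_neg]; exact h3)
        rw [hsi, abs_neg] at this
        refine le_trans ?_ this
        rw [riemannZeta₁_eq hs1, norm_mul]
        refine le_mul_of_one_le_left (norm_nonneg _) ?_
        refine le_trans ?_ (Complex.abs_im_le_norm _)
        simpa [hsi] using h3
      have b2 : ‖Complex.Gamma s‖ ≤ C₂ :=
        (Complex.norm_Gamma_le (by rw [hsr]; linarith)).trans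
          (hC₂ ⟨s.re, ⟨by rw [hsr]; linarith, by rw [hsr]; linarith⟩, rfl⟩)
      have b3 : ‖Complex.cos (Real.pi * s / 2)‖ ≤ Real.exp (2 * |w.im|) := by
        refine (Complex.norm_cos_le_exp _).trans ?_
        have e : (Real.pi * s / 2).im = Real.pi / 2 * s.im := by
          rw [show (Real.pi * s / 2 : ℂ) = ((Real.pi / 2 : ℝ) : ℂ) * s by push_cast; ring,
            Complex.im_ofReal_mul]
        rw [e, hsi, abs_mul, abs_neg, abs_of_pos (by positivity)]
        gcongr
        linarith [Real.pi_le_four]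
      have b4 : ‖(2 * (Real.pi : ℂ)) ^ (-s)‖ ≤ 1 := by
        have h2 : (2 * (Real.pi : ℂ)) = ((2 * Real.pi : ℝ) : ℂ) := by push_cast; rfl
        rw [h2, Complex.norm_cpow_eq_rpow_re_of_pos (by positivity)]
        refine Real.rpow_le_one_of_one_le_of_nonpos (by linarith [Real.pi_gt_three]) ?_
        rw [Complex.neg_re, hsr]; linarith
      have b5 : ‖w - 1‖ ≤ 7 * Real.exp (2 * |w.im|) := by
        have : ‖w - 1‖ ≤ |w.re - 1| + |w.im| := by
          simpa using Complex.norm_le_abs_re_add_abs_im (w - 1)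
        have h4 : |w.re - 1| ≤ 2 := by rw [abs_le]; constructor <;> linarith
        have := Real.add_one_le_exp (2 * |w.im|)
        linarith
      rw [riemannZeta₁_eq hw1, hf]
      simp only [norm_mul, RCLike.norm_ofNat]
      calc ‖w - 1‖ * (2 * ‖(2 * (Real.pi : ℂ)) ^ (-s)‖ * ‖Complex.Gamma s‖ *
            ‖Complex.cos (Real.pi * s / 2)‖ * ‖riemannZeta s‖)
          ≤ (7 * Real.exp (2 * |w.im|)) * (2 * 1 * C₂ * Real.exp (2 * |w.im|) *
            ((1 + 56 * C₁) * Real.exp (2 * |w.im|))) := by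
            gcongr
        _ = (1 + 56 * C₁) * (14 * C₂) * (Real.exp (2 * |w.im|) * Real.exp (2 * |w.im|) *
            Real.exp (2 * |w.im|)) := by ring
        _ = (1 + 56 * C₁) * (14 * C₂) * Real.exp (6 * |w.im|) := by
            rw [← Real.exp_add, ← Real.exp_add]; ring_nf
        _ ≤ _ := by gcongr; linarith
  obtain ⟨D, hD, hb⟩ := hall
  refine ⟨Real.log D + 6, by have := Real.log_nonneg hD; linarith, fun w h1 h2 h3 => ?_⟩
  refine (hb w h1 h2 h3).trans ?_
  rw [add_mul, Real.exp_add]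
  gcongr
  calc D = Real.exp (Real.log D) := (Real.exp_log (by linarith)).symm
    _ ≤ _ := by
      gcongr
      exact le_mul_of_one_le_right (Real.log_nonneg hD) h3

/-- Splitting off finitely many distinct zeros of an entire function. -/
lemma exists_eq_prod_sub_mul {f : ℂ → ℂ} (hf : Differentiable ℂ f) (S : Finset ℂ)
    (hS : ∀ ρ ∈ S, f ρ = 0) :
    ∃ g : ℂ → ℂ, Differentiable ℂ g ∧ ∀ z, f z = (∏ ρ ∈ S, (z - ρ)) * g z := by
  classical
  induction S using Finset.induction_on with
  | empty => exact ⟨f, hf, by simp⟩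
  | insert a S ha ih =>
    obtain ⟨g, hg, hfg⟩ := ih fun ρ hρ => hS ρ (Finset.mem_insert_of_mem hρ)
    have hga : g a = 0 := by
      have h := hS a (Finset.mem_insert_self a S)
      rw [hfg a] at h
      refine (mul_eq_zero.mp h).resolve_left (Finset.prod_ne_zero_iff.mpr fun ρ hρ => ?_)
      exact sub_ne_zero.mpr fun h => ha (h ▸ hρ)
    refine ⟨dslope g a, ?_, fun z => ?_⟩
    · rw [← differentiableOn_univ] at hg ⊢
      exact (Complex.differentiableOn_dslope univ_mem).mpr hg
    · rw [hfg z, Finset.prod_insert ha]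
      have := sub_smul_dslope g a z
      rw [hga, sub_zero, smul_eq_mul] at this
      rw [← this]; ring

/-- At a simple zero, the cofactor of the zero does not vanish. -/
lemma cofactor_ne_zero_of_deriv_ne_zero {f g : ℂ → ℂ} (hg : Differentiable ℂ g) {S : Finset ℂ}
    (h : ∀ z, f z = (∏ ρ ∈ S, (z - ρ)) * g z) {a : ℂ} (ha : a ∈ S) (hd : deriv f a ≠ 0) :
    g a ≠ 0 := by
  intro h0
  apply hd
  have hP : DifferentiableAt ℂ (fun z : ℂ => ∏ ρ ∈ S, (z - ρ)) a := by fun_prop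
  have e : f = fun z => (∏ ρ ∈ S, (z - ρ)) * g z := funext h
  rw [e, deriv_fun_mul hP (hg a), h0, Finset.prod_eq_zero ha (sub_self a)]
  ring

/-- Dividing out zeros by Blaschke factors for the disc of radius `R` about `c`. -/
lemma exists_blaschke {f : ℂ → ℂ} (hf : Differentiable ℂ f) {S : Finset ℂ}
    (hS : ∀ ρ ∈ S, f ρ = 0) {c : ℂ} {R M : ℝ} (hR : 0 < R)
    (hM : ∀ z, ‖z - c‖ = R → ‖f z‖ ≤ M) :
    ∃ G : ℂ → ℂ, Differentiable ℂ G ∧ (∀ z, ‖z - c‖ ≤ R → ‖G z‖ ≤ M) ∧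
      ∀ z, (∏ ρ ∈ S, (z - ρ)) * G z =
        f z * ∏ ρ ∈ S, ((R : ℂ) ^ 2 - starRingEnd ℂ (ρ - c) * (z - c)) / R := by
  obtain ⟨g, hg, hfg⟩ := exists_eq_prod_sub_mul hf S hS
  refine ⟨fun z => g z * ∏ ρ ∈ S, ((R : ℂ) ^ 2 - starRingEnd ℂ (ρ - c) * (z - c)) / R,
    by fun_prop, ?_, fun z => by rw [hfg z]; ring⟩
  have hGd : Differentiable ℂ
      fun z => g z * ∏ ρ ∈ S, ((R : ℂ) ^ 2 - starRingEnd ℂ (ρ - c) * (z - c)) / R := by fun_prop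
  intro z hz
  refine Complex.norm_le_of_forall_mem_frontier_norm_le (U := Metric.ball c R) Metric.isBounded_ball
    hGd.diffContOnCl (fun w hw => ?_) (by
      rw [closure_ball c hR.ne', mem_closedBall_iff_norm]; exact hz)
  rw [frontier_ball c hR.ne', mem_sphere_iff_norm] at hw
  refine le_trans (le_of_eq ?_) (hM w hw)
  rw [hfg w, norm_mul, norm_mul, mul_comm, norm_prod, norm_prod]
  congr 1
  refine Finset.prod_congr rfl fun ρ _ => ?_
  have e : (R : ℂ) ^ 2 - starRingEnd ℂ (ρ - c) * (w - c) =
      starRingEnd ℂ (w - ρ) * (w - c) := by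
    have : (R : ℂ) ^ 2 = starRingEnd ℂ (w - c) * (w - c) := by
      rw [Complex.conj_mul', hw]
    rw [this]
    simp only [map_sub]
    ring
  rw [e, norm_div, norm_mul, RCLike.norm_conj, hw, Complex.norm_real, Real.norm_of_nonneg hR.le]
  field_simp

/-- Jensen-type bound for the number of zeros in a disc. -/
lemma norm_mul_pow_card_zeros_le {f : ℂ → ℂ} (hf : Differentiable ℂ f) {S : Finset ℂ}
    (hS : ∀ ρ ∈ S, f ρ = 0) {c : ℂ} {r R M : ℝ} (hr : 0 < r) (hrR : r < R)
    (hSr : ∀ ρ ∈ S, ‖ρ - c‖ ≤ r) (hM : ∀ z, ‖z - c‖ = R → ‖f z‖ ≤ M) :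
    ‖f c‖ * (R / r) ^ S.card ≤ M := by
  have hR : 0 < R := hr.trans hrR
  obtain ⟨G, -, hGM, hG⟩ := exists_blaschke hf hS hR hM
  have h1 := congrArg norm (hG c)
  simp only [sub_self, mul_zero, sub_zero, Finset.prod_const, norm_mul, norm_prod, norm_pow,
    norm_div, Complex.norm_real, Real.norm_of_nonneg hR.le] at h1
  rw [show R ^ 2 / R = R by field_simp] at h1
  have h2 : ∏ ρ ∈ S, ‖c - ρ‖ ≤ r ^ S.card := by
    rw [← Finset.prod_const]
    refine Finset.prod_le_prod (fun _ _ => norm_nonneg _) fun ρ hρ => ?_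
    rw [norm_sub_rev]; exact hSr ρ hρ
  have h3 := hGM c (by simpa using hR.le)
  rw [div_pow, ← mul_div_assoc, div_le_iff₀ (by positivity), ← h1, mul_comm]
  gcongr
  exact (norm_nonneg _).trans h3

/-- Lower bound for a zero-free function in a disc (Borel–Carathéodory). -/
lemma norm_ge_of_forall_ne_zero {G : ℂ → ℂ} {c : ℂ} {r R A : ℝ} (hrR : r < R)
    (hR : 0 < R) (hA : 0 < A) (hd : Differentiable ℂ G) (h0 : ∀ z, ‖z - c‖ < R → G z ≠ 0)
    (hM : ∀ z, ‖z - c‖ < R → ‖G z‖ ≤ ‖G c‖ * Real.exp A) {z : ℂ} (hz : ‖z - c‖ ≤ r) :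
    ‖G c‖ * Real.exp (-(2 * A * r / (R - r))) ≤ ‖G z‖ := by
  set F : ℂ → ℂ := fun w => G (c + w) with hF
  have hFd : Differentiable ℂ F := by fun_prop
  have hF0 : ∀ w ∈ Metric.ball (0:ℂ) R, F w ≠ 0 := fun w hw =>
    h0 _ (by simpa using hw)
  have hdF : Differentiable ℂ (deriv F) := by
    have := (hFd.contDiff (n := 2)).differentiable_deriv_two
    exact this
  have hq : DifferentiableOn ℂ (fun w => deriv F w / F w) (Metric.ball 0 R) :=
    hdF.differentiableOn.div hFd.differentiableOn hF0
  obtain ⟨L, hL⟩ := hq.isExactOn_ball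
  have h00 : (0:ℂ) ∈ Metric.ball (0:ℂ) R := Metric.mem_ball_self hR
  have hder : ∀ w ∈ Metric.ball (0:ℂ) R,
      HasDerivAt (fun w => F w * Complex.exp (-L w)) 0 w := by
    intro w hw
    have h1 := (hFd w).hasDerivAt.mul ((hL w hw).neg.cexp)
    have e : deriv F w * Complex.exp (-L w) +
        F w * (Complex.exp (-L w) * -(deriv F w / F w)) = 0 := by
      have := hF0 w hw
      field_simp
      ring
    rw [← e]
    exact h1
  have hconst : ∀ w ∈ Metric.ball (0:ℂ) R,
      F w * Complex.exp (-L w) = F 0 * Complex.exp (-L 0) := fun w hw =>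
    Metric.isOpen_ball.is_const_of_deriv_eq_zero (convex_ball (0:ℂ) R).isPreconnected
      (fun x hx => (hder x hx).differentiableAt.differentiableWithinAt)
      (fun x hx => (hder x hx).deriv) hw h00
  have hexp : ∀ w ∈ Metric.ball (0:ℂ) R, F w = F 0 * Complex.exp (L w - L 0) := by
    intro w hw
    have h1 := hconst w hw
    calc F w = (F w * Complex.exp (-L w)) * Complex.exp (L w) := by
          rw [mul_assoc, ← Complex.exp_add]; simp
      _ = _ := by rw [h1, mul_assoc, ← Complex.exp_add]; ring_nf
  have hFc : F 0 = G c := by simp [hF]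
  have hGc : 0 < ‖G c‖ := norm_pos_iff.mpr (h0 c (by simpa using hR))
  have hz' : z - c ∈ Metric.ball (0:ℂ) R := by
    rw [mem_ball_zero_iff]; linarith
  have hbc := Complex.borelCaratheodory_zero (f := fun w => L w - L 0) (M := A) (R := R) hA
    (fun w hw => ((hL w hw).differentiableAt.sub_const _).differentiableWithinAt)
    (fun w hw => by
      have h1 := hM (c + w) (by simpa using hw)
      have h2 := congrArg norm (hexp w hw)
      rw [norm_mul, hFc, Complex.norm_exp] at h2
      change ‖F w‖ ≤ _ at h1
      rw [h2] at h1
      have h3 := (mul_le_mul_iff_right₀ hGc).mp h1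
      exact Real.exp_le_exp.mp h3) hR hz' (by simp)
  have h2 := congrArg norm (hexp _ hz')
  rw [norm_mul, hFc, Complex.norm_exp] at h2
  have h3 : F (z - c) = G z := by simp [hF]
  rw [← h3, h2]
  have h4 : 2 * A * ‖z - c‖ / (R - ‖z - c‖) ≤ 2 * A * r / (R - r) := by
    have : 0 ≤ ‖z - c‖ := norm_nonneg _
    have hr : 0 ≤ r := this.trans hz
    exact div_le_div₀ (by positivity) (by gcongr) (by linarith) (by linarith)
  have h5 := (Complex.abs_re_le_norm (L (z - c) - L 0)).trans (hbc.trans h4)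
  gcongr
  exact (abs_le.mp h5).1

/-- Minimum modulus bound for a function all of whose zeros in a disc are simple. -/
lemma norm_ge_of_simple_zeros {f : ℂ → ℂ} (hf : Differentiable ℂ f) {S : Finset ℂ} {c : ℂ}
    {r R' R A : ℝ} (hrR : r < R') (hR' : 0 < R') (hRR : R' < R) (hA : 0 < A)
    (hS : ∀ ρ, ρ ∈ S ↔ f ρ = 0 ∧ ‖ρ - c‖ ≤ R') (hd : ∀ ρ ∈ S, deriv f ρ ≠ 0)
    (hM : ∀ z, ‖z - c‖ = R → ‖f z‖ ≤ ‖f c‖ * Real.exp A) {z : ℂ} (hz : ‖z - c‖ ≤ r)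
    {d : ℝ} (hd0 : 0 ≤ d) (hzd : ∀ ρ ∈ S, d ≤ ‖z - ρ‖) :
    ‖f c‖ * Real.exp (-(2 * A * r / (R' - r))) * (d / (2 * R)) ^ S.card ≤ ‖f z‖ := by
  have hR : 0 < R := hR'.trans hRR
  obtain ⟨G, hGd, hGM, hG⟩ := exists_blaschke hf (fun ρ hρ => ((hS ρ).mp hρ).1) hR hM
  have hRc : (R : ℂ) ≠ 0 := by exact_mod_cast hR.ne'
  have hB : ∀ w, ‖w - c‖ ≤ R' →
      ∏ ρ ∈ S, ((R : ℂ) ^ 2 - starRingEnd ℂ (ρ - c) * (w - c)) / R ≠ 0 := by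
    intro w hw
    refine Finset.prod_ne_zero_iff.mpr fun ρ hρ => div_ne_zero (fun h => ?_) hRc
    have h1 := congrArg norm (sub_eq_zero.mp h)
    rw [norm_mul, RCLike.norm_conj, norm_pow, Complex.norm_real, Real.norm_of_nonneg hR.le] at h1
    have h2 := ((hS ρ).mp hρ).2
    have : ‖ρ - c‖ * ‖w - c‖ ≤ R' * R' := by gcongr
    nlinarith
  have hG0 : ∀ w, ‖w - c‖ < R' → G w ≠ 0 := by
    intro w hw h
    have h1 := hG w
    rw [h, mul_zero] at h1
    have hfw : f w = 0 := (mul_eq_zero.mp h1.symm).resolve_right (hB w hw.le)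
    have hwS : w ∈ S := (hS w).mpr ⟨hfw, hw.le⟩
    have hBd : Differentiable ℂ
      fun w => ∏ ρ ∈ S, ((R : ℂ) ^ 2 - starRingEnd ℂ (ρ - c) * (w - c)) / R := by fun_prop
    refine cofactor_ne_zero_of_deriv_ne_zero (f := fun w => f w *
      ∏ ρ ∈ S, ((R : ℂ) ^ 2 - starRingEnd ℂ (ρ - c) * (w - c)) / R) hGd
      (fun w => (hG w).symm) hwS ?_ h
    rw [deriv_fun_mul (hf w) (hBd w), hfw, zero_mul, add_zero]
    exact mul_ne_zero (hd w hwS) (hB w hw.le)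
  have hGc : ‖f c‖ ≤ ‖G c‖ := by
    have h1 := congrArg norm (hG c)
    simp only [sub_self, mul_zero, sub_zero, Finset.prod_const, norm_mul, norm_prod, norm_pow,
      norm_div, Complex.norm_real, Real.norm_of_nonneg hR.le] at h1
    rw [show R ^ 2 / R = R by field_simp] at h1
    have h2 : ∏ ρ ∈ S, ‖c - ρ‖ ≤ R ^ S.card := by
      rw [← Finset.prod_const]
      refine Finset.prod_le_prod (fun _ _ => norm_nonneg _) fun ρ hρ => ?_
      rw [norm_sub_rev]; exact ((hS ρ).mp hρ).2.trans hRR.le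
    have h3 : ‖f c‖ * R ^ S.card ≤ ‖G c‖ * R ^ S.card := by
      rw [← h1, mul_comm]; gcongr
    exact le_of_mul_le_mul_right h3 (by positivity)
  have hGz := norm_ge_of_forall_ne_zero hrR hR' hA hGd hG0
    (fun w hw => (hGM w (by linarith)).trans (by gcongr)) hz
  have h1 := congrArg norm (hG z)
  rw [norm_mul, norm_mul, norm_prod, norm_prod] at h1
  have h2 : ∏ ρ ∈ S, ‖((R : ℂ) ^ 2 - starRingEnd ℂ (ρ - c) * (z - c)) / R‖ ≤ (2 * R) ^ S.card := by
    rw [← Finset.prod_const]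
    refine Finset.prod_le_prod (fun _ _ => norm_nonneg _) fun ρ hρ => ?_
    rw [norm_div, Complex.norm_real, Real.norm_of_nonneg hR.le, div_le_iff₀ hR]
    refine (norm_sub_le _ _).trans ?_
    rw [norm_mul, RCLike.norm_conj, norm_pow, Complex.norm_real, Real.norm_of_nonneg hR.le]
    have : ‖ρ - c‖ * ‖z - c‖ ≤ R * R := by
      gcongr
      · exact ((hS ρ).mp hρ).2.trans hRR.le
      · linarith
    linarith
  have h3 : d ^ S.card ≤ ∏ ρ ∈ S, ‖z - ρ‖ := by
    rw [← Finset.prod_const]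
    exact Finset.prod_le_prod (fun _ _ => hd0) hzd
  rw [div_pow, ← mul_div_assoc, div_le_iff₀ (by positivity)]
  calc ‖f c‖ * Real.exp (-(2 * A * r / (R' - r))) * d ^ S.card
      ≤ ‖G z‖ * ∏ ρ ∈ S, ‖z - ρ‖ := by
        gcongr
        refine le_trans ?_ hGz
        gcongr
    _ = ‖f z‖ * ∏ ρ ∈ S, ‖((R : ℂ) ^ 2 - starRingEnd ℂ (ρ - c) * (z - c)) / R‖ := by
        rw [mul_comm, h1]
    _ ≤ _ := by gcongr

/-- Ordinates of the zeros of `ζ` on the critical line. -/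
def zetaOrdinates : Set ℝ := {γ | riemannZeta (1 / 2 + γ * Complex.I) = 0}

lemma half_add_mul_I_ne_one (γ : ℝ) : (1 / 2 + γ * Complex.I : ℂ) ≠ 1 := by
  intro h; have := congrArg Complex.re h; norm_num at this

lemma riemannZeta₁_eq_zero_of_mem {γ : ℝ} (h : γ ∈ zetaOrdinates) :
    riemannZeta₁ (1 / 2 + γ * Complex.I) = 0 := by
  have h : riemannZeta (1 / 2 + γ * Complex.I) = 0 := h
  rw [riemannZeta₁_eq (half_add_mul_I_ne_one γ), h, mul_zero]

lemma riemannZeta_eq_zero_of_riemannZeta₁ {s : ℂ} (h : riemannZeta₁ s = 0) :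
    riemannZeta s = 0 := by
  have hs1 : s ≠ 1 := by rintro rfl; simp at h
  rw [riemannZeta₁_eq hs1] at h
  exact (mul_eq_zero.mp h).resolve_left (sub_ne_zero.mpr hs1)

lemma neg_mem_zetaOrdinates {γ : ℝ} (h : γ ∈ zetaOrdinates) : -γ ∈ zetaOrdinates := by
  have h : riemannZeta (1 / 2 + γ * Complex.I) = 0 := h
  change riemannZeta _ = 0
  have e : (1 / 2 + ((-γ : ℝ) : ℂ) * Complex.I) = starRingEnd ℂ (1 / 2 + γ * Complex.I) := by
    apply Complex.ext <;> simp
  rw [e, riemannZeta_conj, h, map_zero]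

lemma deriv_riemannZeta₁ {s : ℂ} (hs : s ≠ 1) (h : riemannZeta s = 0) :
    deriv riemannZeta₁ s = (s - 1) * deriv riemannZeta s := by
  have he : riemannZeta₁ =ᶠ[𝓝 s] fun z => (z - 1) * riemannZeta z := by
    filter_upwards [isOpen_ne.mem_nhds hs] with z hz using riemannZeta₁_eq hz
  rw [he.deriv_eq, deriv_fun_mul (by fun_prop) (differentiableAt_riemannZeta hs), h]
  simp

lemma finite_zeros_riemannZeta₁ {K : Set ℂ} (hK : IsCompact K) :
    {s | riemannZeta₁ s = 0 ∧ s ∈ K}.Finite :=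
  hK.inter_riemannZetaZeros_finite.subset fun _ hs =>
    ⟨hs.2, riemannZeta_eq_zero_of_riemannZeta₁ hs.1⟩

lemma exists_le_norm_riemannZeta₁_two :
    ∃ c, 0 < c ∧ c ≤ 1 ∧ ∀ u : ℝ, c ≤ ‖riemannZeta₁ (2 + u * Complex.I)‖ := by
  obtain ⟨C, hC, hb⟩ := exists_norm_inv_riemannZeta_le
  refine ⟨(1 + C)⁻¹, by positivity, inv_le_one_of_one_le₀ (by linarith), fun u => ?_⟩
  have h1 : (2 + u * Complex.I : ℂ) ≠ 1 := by
    intro h; have := congrArg Complex.re h; norm_num at this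
  rw [riemannZeta₁_eq h1, norm_mul]
  have h2 := hb (2 + u * Complex.I) (by simp; norm_num)
  have h3 : riemannZeta (2 + u * Complex.I) ≠ 0 :=
    riemannZeta_ne_zero_of_one_le_re (by simp)
  have h4 : 1 ≤ ‖(2 + u * Complex.I - 1 : ℂ)‖ := by
    refine le_trans ?_ (Complex.abs_re_le_norm _)
    norm_num
  have h5 : (1 + C)⁻¹ ≤ ‖riemannZeta (2 + u * Complex.I)‖ := by
    rw [norm_inv] at h2
    have := norm_pos_iff.mpr h3
    rw [inv_le_comm₀ (by positivity) this]
    linarith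
  calc (1 + C)⁻¹ ≤ 1 * ‖riemannZeta (2 + u * Complex.I)‖ := by rw [one_mul]; exact h5
    _ ≤ _ := by gcongr

/-- The number of zeros in a window of length one is small. -/
lemma exists_card_zetaOrdinates_le :
    ∃ C, 0 < C ∧ ∀ (u : ℝ) (F : Finset ℝ), (∀ γ ∈ F, γ ∈ zetaOrdinates ∧ |γ - u| ≤ 1 / 2) →
      (F.card : ℝ) ≤ C * (1 + |u|) ^ (1 / 10 : ℝ) := by
  obtain ⟨c₀, hc₀, -, hc⟩ := exists_le_norm_riemannZeta₁_two
  obtain ⟨C₁, hC₁, hz⟩ := exists_norm_riemannZeta₁_le (p := 1) (σ := 1 / 10) zero_le_one le_rfl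
    (by norm_num)
  set D : ℝ := (1 + 16 * C₁) / c₀ with hD
  have hD0 : 0 < D := by positivity
  refine ⟨16 * (|Real.log D| + 20), by positivity, fun u F hF => ?_⟩
  set c : ℂ := 2 + u * Complex.I with hcdef
  have hinj : Function.Injective fun γ : ℝ => (1 / 2 + γ * Complex.I : ℂ) := by
    intro a b hab
    simpa using congrArg Complex.im hab
  set S : Finset ℂ := F.map ⟨_, hinj⟩ with hS
  have hcard : S.card = F.card := Finset.card_map _
  have hu : 1 ≤ 1 + |u| := by linarith [abs_nonneg u]
  have key := norm_mul_pow_card_zeros_le (f := riemannZeta₁) differentiable_riemannZeta₁ (S := S)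
    (c := c) (r := 8 / 5) (R := 19 / 10) (M := (1 + 16 * C₁) * (1 + |u|) ^ 2)
    (by
      intro ρ hρ
      obtain ⟨γ, hγ, rfl⟩ := Finset.mem_map.mp hρ
      exact riemannZeta₁_eq_zero_of_mem (hF γ hγ).1) (by norm_num) (by norm_num)
    (by
      intro ρ hρ
      obtain ⟨γ, hγ, rfl⟩ := Finset.mem_map.mp hρ
      have h1 := (hF γ hγ).2
      have e : ‖(1 / 2 + γ * Complex.I : ℂ) - c‖ ^ 2 = 9 / 4 + (γ - u) ^ 2 := by
        rw [Complex.sq_norm, Complex.normSq_apply, hcdef]; simp; ring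
      have h2 : (γ - u) ^ 2 ≤ 1 / 4 := by
        rw [← sq_abs]; nlinarith [abs_nonneg (γ - u)]
      change ‖(1 / 2 + γ * Complex.I : ℂ) - c‖ ≤ 8 / 5
      refine le_of_sq_le_sq (α := ℝ) ?_ (by norm_num)
      rw [e]; linarith)
    (by
      intro z hz1
      have h1 : |(z - c).re| ≤ 19 / 10 := (Complex.abs_re_le_norm _).trans hz1.le
      have h2 : 1 / 10 ≤ z.re := by
        have := (abs_le.mp h1).1
        simp only [hcdef, Complex.sub_re, Complex.add_re, Complex.mul_re, Complex.ofReal_re,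
          Complex.I_re, Complex.ofReal_im, Complex.I_im, Complex.re_ofNat] at this
        linarith
      refine (hz z h2).trans ?_
      rw [Real.rpow_one]
      have hcn : ‖c‖ ≤ 2 + |u| := by
        rw [hcdef]; refine (norm_add_le _ _).trans ?_; simp
      have h3 : ‖z‖ ≤ 4 * (1 + |u|) := by
        have := norm_add_le (z - c) c
        rw [sub_add_cancel] at this
        linarith [abs_nonneg u]
      have hc1 : ‖c - 1‖ ≤ 1 + |u| := by
        rw [hcdef, show (2 + u * Complex.I - 1 : ℂ) = 1 + u * Complex.I by ring]
        refine (norm_add_le _ _).trans ?_; simp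
      have h4 : ‖z - 1‖ ≤ 4 * (1 + |u|) := by
        have := norm_add_le (z - c) (c - 1)
        rw [sub_add_sub_cancel] at this
        linarith [abs_nonneg u]
      have h5 : ‖z - 1‖ * ‖z‖ ≤ 16 * (1 + |u|) ^ 2 := by
        calc _ ≤ (4 * (1 + |u|)) * (4 * (1 + |u|)) := by gcongr
          _ = _ := by ring
      have h6 : 1 ≤ (1 + |u|) ^ 2 := one_le_pow₀ hu
      have h7 := mul_le_mul_of_nonneg_left h5 hC₁
      nlinarith)
  have k1 : (19 / 16 : ℝ) ^ F.card ≤ D * (1 + |u|) ^ 2 := by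
    rw [hcard] at key
    rw [hD, div_mul_eq_mul_div, le_div_iff₀ hc₀, mul_comm]
    refine le_trans ?_ key
    have e : (19 / 10 : ℝ) / (8 / 5) = 19 / 16 := by norm_num
    rw [e]
    gcongr
    exact hc u
  have k2 := Real.log_le_log (by positivity) k1
  rw [Real.log_pow, Real.log_mul hD0.ne' (by positivity), Real.log_pow] at k2
  have k3 : 1 / 16 ≤ Real.log (19 / 16) := by
    have := Real.one_sub_inv_le_log_of_pos (show (0:ℝ) < 19 / 16 by norm_num)
    norm_num at this ⊢; linarith
  have k4 : Real.log (1 + |u|) ≤ 10 * (1 + |u|) ^ (1 / 10 : ℝ) := by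
    have := Real.log_le_rpow_div (show 0 ≤ 1 + |u| by positivity) (show (0:ℝ) < 1 / 10 by norm_num)
    linarith
  have k5 : 1 ≤ (1 + |u|) ^ (1 / 10 : ℝ) := Real.one_le_rpow hu (by norm_num)
  have k6 : (F.card : ℝ) * (1 / 16) ≤ F.card * Real.log (19 / 16) := by gcongr
  have k7 : Real.log D ≤ |Real.log D| * (1 + |u|) ^ (1 / 10 : ℝ) :=
    (le_abs_self _).trans (le_mul_of_one_le_right (abs_nonneg _) k5)
  push_cast at k2
  nlinarith

/-- A point of `[T, T + 1]` at a definite distance from finitely many given points. -/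
lemma exists_mem_Icc_forall_le_abs_sub (F : Finset ℝ) (T : ℝ) :
    ∃ x ∈ Set.Icc T (T + 1), ∀ γ ∈ F, 1 / (2 * (F.card + 1) : ℝ) ≤ |x - γ| := by
  by_contra! h
  set d : ℝ := 1 / (2 * (F.card + 1) : ℝ) with hd
  have hd0 : 0 < d := by positivity
  have hsub : Set.Icc T (T + 1) ⊆ ⋃ γ ∈ F, Metric.ball γ d := by
    intro x hx
    obtain ⟨γ, hγ, hlt⟩ := h x hx
    exact Set.mem_biUnion hγ (by rw [Metric.mem_ball, Real.dist_eq]; exact hlt)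
  have h1 := (measure_mono (μ := volume) hsub).trans (measure_biUnion_finset_le F _)
  simp only [Real.volume_Icc, Real.volume_ball, Finset.sum_const, nsmul_eq_mul] at h1
  rw [← ENNReal.ofReal_natCast, ← ENNReal.ofReal_mul (by positivity),
    ENNReal.ofReal_le_ofReal_iff (by positivity)] at h1
  have h2 : (F.card : ℝ) * (2 * d) < 1 := by
    rw [hd]
    rw [show (F.card : ℝ) * (2 * (1 / (2 * (F.card + 1)))) = F.card / (F.card + 1) by field_simp]
    rw [div_lt_one (by positivity)]
    linarith
  linarith

/-- Horizontal lines on which `(s - 1) ζ(s)` is not too small. -/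
lemma exists_horizontal_lower_bound
    (hRH : ∀ ρ : ℂ, riemannZeta ρ = 0 → 0 < ρ.re → ρ.re < 1 → ρ.re = 1 / 2)
    (hsimple : ∀ ρ : ℂ, riemannZeta ρ = 0 → 0 < ρ.re → ρ.re < 1 → deriv riemannZeta ρ ≠ 0) :
    ∃ C, 0 < C ∧ ∀ T : ℝ, 4 ≤ T → ∃ x ∈ Set.Icc T (T + 1),
      (∀ σ : ℝ, -1 / 2 ≤ σ → σ ≤ 3 / 2 →
        Real.exp (-(C * T ^ (3 / 2 : ℝ))) ≤ ‖riemannZeta₁ (σ + x * Complex.I)‖) ∧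
      ∀ γ ∈ zetaOrdinates, Real.exp (-(C * T ^ (3 / 2 : ℝ))) ≤ |x - γ| := by
  obtain ⟨c₀, hc₀, hc₀1, hc⟩ := exists_le_norm_riemannZeta₁_two
  obtain ⟨C₁, hC₁, hz⟩ := exists_norm_riemannZeta₁_le_exp
  set L : ℝ := -Real.log c₀ with hL
  have hL0 : 0 ≤ L := by rw [hL]; linarith [Real.log_nonpos hc₀.le hc₀1]
  have hcL : c₀ = Real.exp (-L) := by rw [hL, neg_neg, Real.exp_log hc₀]
  set C₂ : ℝ := L + 2 * C₁ with hC₂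
  have hC₂0 : 0 < C₂ := by positivity
  set K : ℝ := (12 * (15 * C₂ + 1)) ^ (1 / 2 : ℝ) with hK
  have hK0 : 0 < K := by positivity
  refine ⟨L + 54 * C₂ + 15 * C₂ * (2 * K) + 2 * (15 * C₂ + 1), by positivity, fun T hT => ?_⟩
  have hT0 : 0 < T := by linarith
  set c : ℂ := 2 + T * Complex.I with hcdef
  have hfin := finite_zeros_riemannZeta₁ (isCompact_closedBall c (14 / 5))
  obtain ⟨S, hSmem⟩ : ∃ S : Finset ℂ, ∀ ρ, ρ ∈ S ↔ riemannZeta₁ ρ = 0 ∧ ‖ρ - c‖ ≤ 14 / 5 :=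
    ⟨hfin.toFinset, fun ρ => by
      rw [Set.Finite.mem_toFinset, Set.mem_ofPred_eq, mem_closedBall_iff_norm]⟩
  have hdS : ∀ ρ ∈ S, deriv riemannZeta₁ ρ ≠ 0 := by
    intro ρ hρ
    obtain ⟨h1, h2⟩ := (hSmem ρ).mp hρ
    have h3 : |(ρ - c).re| ≤ 14 / 5 := (Complex.abs_re_le_norm _).trans h2
    have h4 : -2 < ρ.re := by
      have := (abs_le.mp h3).1
      simp only [hcdef, Complex.sub_re, Complex.add_re, Complex.mul_re, Complex.ofReal_re,
        Complex.I_re, Complex.ofReal_im, Complex.I_im, Complex.re_ofNat] at this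
      linarith
    have h5 := re_eq_half_of_riemannZeta₁_eq_zero hRH h1 h4
    have hρ1 : ρ ≠ 1 := by rintro rfl; norm_num at h5
    have h6 := riemannZeta_eq_zero_of_riemannZeta₁ h1
    rw [deriv_riemannZeta₁ hρ1 h6]
    exact mul_ne_zero (sub_ne_zero.mpr hρ1)
      (hsimple ρ h6 (by rw [h5]; norm_num) (by rw [h5]; norm_num))
  set A : ℝ := C₂ * T with hA
  have hA0 : 0 < A := by positivity
  have hM : ∀ z, ‖z - c‖ = 3 → ‖riemannZeta₁ z‖ ≤ ‖riemannZeta₁ c‖ * Real.exp A := by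
    intro z hz1
    have h1 : |(z - c).re| ≤ 3 := (Complex.abs_re_le_norm _).trans hz1.le
    have h2 : |(z - c).im| ≤ 3 := (Complex.abs_im_le_norm _).trans hz1.le
    simp only [hcdef, Complex.sub_re, Complex.add_re, Complex.mul_re, Complex.ofReal_re,
      Complex.I_re, Complex.ofReal_im, Complex.I_im, Complex.re_ofNat] at h1
    simp only [hcdef, Complex.sub_im, Complex.add_im, Complex.mul_im, Complex.ofReal_re,
      Complex.I_re, Complex.ofReal_im, Complex.I_im, Complex.im_ofNat] at h2
    obtain ⟨a1, a2⟩ := abs_le.mp h1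
    obtain ⟨b1, b2⟩ := abs_le.mp h2
    have him : 1 ≤ z.im := by linarith
    have h3 := hz z (by linarith) (by linarith) (by rw [abs_of_nonneg (by linarith)]; exact him)
    rw [abs_of_nonneg (by linarith)] at h3
    calc ‖riemannZeta₁ z‖ ≤ Real.exp (C₁ * z.im) := h3
      _ ≤ Real.exp (-L + A) := by
        gcongr
        rw [hA, hC₂]
        nlinarith
      _ = c₀ * Real.exp A := by rw [Real.exp_add, ← hcL]
      _ ≤ _ := by gcongr; exact hc T
  obtain ⟨N, hN⟩ : ∃ N : ℕ, N = S.card := ⟨_, rfl⟩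
  have hfc : 0 < ‖riemannZeta₁ c‖ := hc₀.trans_le (hc T)
  have hN15 : (N : ℝ) ≤ 15 * A := by
    have h1 := norm_mul_pow_card_zeros_le differentiable_riemannZeta₁ (S := S)
      (fun ρ hρ => ((hSmem ρ).mp hρ).1) (c := c) (r := 14 / 5) (R := 3) (by norm_num) (by norm_num)
      (fun ρ hρ => ((hSmem ρ).mp hρ).2) hM
    rw [← hN] at h1
    have h2 := le_of_mul_le_mul_left h1 hfc
    have h3 := Real.log_le_log (by positivity) h2
    rw [Real.log_pow, Real.log_exp] at h3
    have h4 : 1 / 15 ≤ Real.log (3 / (14 / 5)) := by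
      have := Real.one_sub_inv_le_log_of_pos (show (0:ℝ) < 3 / (14 / 5) by norm_num)
      norm_num at this ⊢; linarith
    have h5 : (N : ℝ) * (1 / 15) ≤ N * Real.log (3 / (14 / 5)) := by gcongr
    linarith
  obtain ⟨x, hx, hxF⟩ := exists_mem_Icc_forall_le_abs_sub (S.image Complex.im) T
  set d : ℝ := 1 / (2 * (N + 1)) with hd
  have hd0 : 0 < d := by positivity
  have hdle : d ≤ 1 / 2 := by
    rw [hd]
    apply one_div_le_one_div_of_le two_pos
    linarith [N.cast_nonneg (α := ℝ)]
  have hxS : ∀ ρ ∈ S, d ≤ |x - ρ.im| := by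
    intro ρ hρ
    refine le_trans ?_ (hxF ρ.im (Finset.mem_image_of_mem _ hρ))
    rw [hd]
    have : ((S.image Complex.im).card : ℝ) ≤ N := by
      rw [hN]; exact_mod_cast Finset.card_image_le
    exact one_div_le_one_div_of_le (mul_pos two_pos (Nat.cast_add_one_pos _)) (by linarith)
  have hT1 : 1 ≤ T ^ (1 / 2 : ℝ) := Real.one_le_rpow (by linarith) (by norm_num)
  have hT32 : T ^ (3 / 2 : ℝ) = T * T ^ (1 / 2 : ℝ) := by
    rw [← Real.rpow_one_add' hT0.le (by norm_num)]; norm_num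
  have hTT : T ≤ T ^ (3 / 2 : ℝ) := by rw [hT32]; nlinarith
  have hT132 : 1 ≤ T ^ (3 / 2 : ℝ) := by linarith
  have hdexp : Real.exp (-(2 * (15 * C₂ + 1) * T ^ (3 / 2 : ℝ))) ≤ d := by
    rw [Real.exp_neg, hd, one_div]
    apply inv_anti₀ (by positivity)
    refine le_trans ?_ (Real.add_one_le_exp _)
    have : A ≤ C₂ * T ^ (3 / 2 : ℝ) := by rw [hA]; gcongr
    nlinarith
  refine ⟨x, hx, fun σ h1 h2 => ?_, fun γ hγ => ?_⟩
  · set z : ℂ := σ + x * Complex.I with hzdef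
    have hzc : ‖z - c‖ ≤ 27 / 10 := by
      refine le_of_sq_le_sq (α := ℝ) ?_ (by norm_num)
      have e : ‖z - c‖ ^ 2 = (σ - 2) ^ 2 + (x - T) ^ 2 := by
        rw [Complex.sq_norm, Complex.normSq_apply, hzdef, hcdef]; simp; ring
      rw [e]
      have := hx.1
      have := hx.2
      nlinarith
    have hzd : ∀ ρ ∈ S, d ≤ ‖z - ρ‖ := by
      intro ρ hρ
      refine (hxS ρ hρ).trans (le_trans (le_of_eq ?_) (Complex.abs_im_le_norm _))
      simp [hzdef]
    have hmain := norm_ge_of_simple_zeros differentiable_riemannZeta₁ (S := S) (c := c)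
      (r := 27 / 10) (R' := 14 / 5) (R := 3) (A := A) (by norm_num) (by norm_num) (by norm_num)
      hA0 hSmem hdS hM hzc hd0.le hzd
    refine le_trans ?_ hmain
    rw [← hN]
    have e1 : 2 * A * (27 / 10) / (14 / 5 - 27 / 10) = 54 * A := by ring
    have e2 : d / (2 * 3) = Real.exp (-Real.log (12 * (N + 1))) := by
      rw [Real.exp_neg, Real.exp_log (by positivity), hd]
      field_simp; norm_num
    have e3 : Real.log (12 * (N + 1)) ≤ 2 * K * T ^ (1 / 2 : ℝ) := by
      have h3 : (12 * (N + 1) : ℝ) ≤ 12 * (15 * C₂ + 1) * T := by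
        rw [hA] at hN15; nlinarith
      have h4 := Real.log_le_rpow_div (show (0:ℝ) ≤ 12 * (N + 1) by positivity)
        (show (0:ℝ) < 1 / 2 by norm_num)
      have h5 : (12 * (N + 1) : ℝ) ^ (1 / 2 : ℝ) ≤ K * T ^ (1 / 2 : ℝ) := by
        rw [hK, ← Real.mul_rpow (by positivity) hT0.le]
        gcongr
      linarith
    have e4 : (N : ℝ) * Real.log (12 * (N + 1)) ≤ 15 * C₂ * (2 * K) * T ^ (3 / 2 : ℝ) := by
      have h0 : 0 ≤ Real.log (12 * (N + 1)) :=
        Real.log_nonneg (by linarith [N.cast_nonneg (α := ℝ)])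
      calc (N : ℝ) * Real.log (12 * (N + 1)) ≤ (15 * A) * (2 * K * T ^ (1 / 2 : ℝ)) := by gcongr
        _ = _ := by rw [hT32, hA]; ring
    rw [e1, e2, ← Real.exp_nat_mul]
    calc Real.exp (-((L + 54 * C₂ + 15 * C₂ * (2 * K) + 2 * (15 * C₂ + 1)) * T ^ (3 / 2 : ℝ)))
        ≤ Real.exp (-L + -(54 * A) + N * -Real.log (12 * (N + 1))) := by
          gcongr
          have a1 : A ≤ C₂ * T ^ (3 / 2 : ℝ) := by rw [hA]; gcongr
          have a2 : L ≤ L * T ^ (3 / 2 : ℝ) := le_mul_of_one_le_right hL0 hT132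
          have a3 : 0 ≤ 2 * (15 * C₂ + 1) * T ^ (3 / 2 : ℝ) := by positivity
          linarith
      _ = c₀ * Real.exp (-(54 * A)) * Real.exp (N * -Real.log (12 * (N + 1))) := by
          rw [Real.exp_add, Real.exp_add, ← hcL]
      _ ≤ _ := by gcongr; exact hc T
  · have hE : Real.exp (-((L + 54 * C₂ + 15 * C₂ * (2 * K) + 2 * (15 * C₂ + 1)) * T ^ (3 / 2 : ℝ)))
        ≤ d := by
      refine le_trans ?_ hdexp
      gcongr
      have : 0 ≤ L + 54 * C₂ + 15 * C₂ * (2 * K) := by positivity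
      linarith
    refine hE.trans ?_
    by_cases hmem : (1 / 2 + γ * Complex.I : ℂ) ∈ S
    · have := hxS _ hmem
      simpa using this
    · have h3 : 14 / 5 < ‖(1 / 2 + γ * Complex.I : ℂ) - c‖ := by
        by_contra hle
        exact hmem ((hSmem _).mpr ⟨riemannZeta₁_eq_zero_of_mem hγ, not_lt.mp hle⟩)
      have h4 : ‖(1 / 2 + γ * Complex.I : ℂ) - c‖ ^ 2 = (3 / 2) ^ 2 + |γ - T| ^ 2 := by
        rw [Complex.sq_norm, Complex.normSq_apply, hcdef, sq_abs]; simp; ring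
      have h5 : |γ - T| ≤ |x - γ| + |x - T| := by
        have := abs_sub_le γ x T
        rwa [abs_sub_comm γ x] at this
      have h6 : |x - T| ≤ 1 := by rw [abs_le]; constructor <;> linarith [hx.1, hx.2]
      nlinarith [abs_nonneg (γ - T), abs_nonneg (x - γ)]

/-- Subtracting from `e^{(w - s)²} / ζ(w)` its principal parts at a finite set of simple zeros
of `ζ` leaves a function that is regular at those zeros. -/
lemma exists_regularized_inv_zeta {S : Finset ℂ} (hS : ∀ ρ ∈ S, riemannZeta ρ = 0 ∧ ρ ≠ 1)
    (hd : ∀ ρ ∈ S, deriv riemannZeta ρ ≠ 0) (s : ℂ) :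
    ∃ H : ℂ → ℂ, (∀ w, (riemannZeta₁ w = 0 → w ∈ S) → DifferentiableAt ℂ H w) ∧
      ∀ w, riemannZeta₁ w ≠ 0 → H w = (w - 1) / riemannZeta₁ w * Complex.exp ((w - s) ^ 2) -
        ∑ ρ ∈ S, Complex.exp ((ρ - s) ^ 2) / (deriv riemannZeta ρ * (w - ρ)) := by
  have hS₁ : ∀ ρ ∈ S, riemannZeta₁ ρ = 0 := fun ρ hρ => by
    rw [riemannZeta₁_eq (hS ρ hρ).2, (hS ρ hρ).1, mul_zero]
  have hd₁ : ∀ ρ ∈ S, deriv riemannZeta₁ ρ = (ρ - 1) * deriv riemannZeta ρ := fun ρ hρ =>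
    deriv_riemannZeta₁ (hS ρ hρ).2 (hS ρ hρ).1
  set E : ℂ → ℂ := fun w => (w - 1) * Complex.exp ((w - s) ^ 2) -
    ∑ ρ ∈ S, Complex.exp ((ρ - s) ^ 2) / deriv riemannZeta ρ * dslope riemannZeta₁ ρ w with hE
  have hEd : Differentiable ℂ E := by
    have : ∀ ρ, Differentiable ℂ (dslope riemannZeta₁ ρ) := fun ρ => by
      rw [← differentiableOn_univ, Complex.differentiableOn_dslope Filter.univ_mem,
        differentiableOn_univ]
      exact differentiable_riemannZeta₁
    rw [hE]
    refine Differentiable.sub (by fun_prop) (Differentiable.fun_sum fun ρ _ => ?_)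
    exact (this ρ).const_mul _
  have hE0 : ∀ ρ ∈ S, E ρ = 0 := by
    intro ρ hρ
    simp only [hE]
    rw [Finset.sum_eq_single_of_mem ρ hρ, dslope_same, hd₁ ρ hρ]
    · field_simp [hd ρ hρ]
      ring
    · intro ρ' hρ' hne
      rw [dslope_of_ne _ hne.symm, slope_def_module, hS₁ ρ hρ, hS₁ ρ' hρ']
      simp
  obtain ⟨E', hE'd, hE'⟩ := exists_eq_prod_sub_mul hEd S hE0
  obtain ⟨g, hgd, hg⟩ := exists_eq_prod_sub_mul differentiable_riemannZeta₁ S hS₁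
  refine ⟨fun w => E' w / g w, fun w hw => ?_, fun w hw => ?_⟩
  · refine (hE'd w).fun_div (hgd w) fun h0 => ?_
    have h1 : w ∈ S := hw (by rw [hg, h0, mul_zero])
    refine cofactor_ne_zero_of_deriv_ne_zero hgd hg h1 ?_ h0
    rw [hd₁ w h1]
    exact mul_ne_zero (sub_ne_zero.mpr (hS w h1).2) (hd w h1)
  · have h1 : E w / riemannZeta₁ w = E' w / g w := by
      rw [hE', hg, mul_div_mul_left]
      intro h0
      rw [hg, h0, zero_mul] at hw
      exact hw rfl
    change E' w / g w = _
    rw [← h1]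
    simp only [hE]
    rw [sub_div, Finset.sum_div]
    congr 1
    · ring
    · refine Finset.sum_congr rfl fun ρ hρ => ?_
      have hne : w ≠ ρ := by rintro rfl; exact hw (hS₁ _ hρ)
      rw [dslope_of_ne _ hne, slope_def_field, hS₁ ρ hρ, sub_zero]
      have := sub_ne_zero.mpr hne
      have := hd ρ hρ
      field_simp

lemma re_sub_sq (w s : ℂ) : ((w - s) ^ 2).re = (w.re - s.re) ^ 2 - (w.im - s.im) ^ 2 := by
  simp [sq]

set_option maxHeartbeats 2000000 in
/-- Pointwise bound for `1/ζ` in terms of the nearby zeros. -/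
lemma exists_norm_inv_zeta_le
    (hRH : ∀ ρ : ℂ, riemannZeta ρ = 0 → 0 < ρ.re → ρ.re < 1 → ρ.re = 1 / 2)
    (hsimple : ∀ ρ : ℂ, riemannZeta ρ = 0 → 0 < ρ.re → ρ.re < 1 → deriv riemannZeta ρ ≠ 0) :
    ∃ C, 0 < C ∧ ∀ s : ℂ, 1 / 2 < s.re → s.re < 3 / 2 → ∃ F : Finset ℝ, ↑F ⊆ zetaOrdinates ∧
      ‖(s - 1) / riemannZeta₁ s‖ ≤ C + C * ∑ γ ∈ F,
        ‖deriv riemannZeta (1 / 2 + γ * Complex.I)‖⁻¹ * Real.exp (-((s.im - γ) ^ 2 / 4)) /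
          ‖s - (1 / 2 + γ * Complex.I)‖ := by
  obtain ⟨C₁, hC₁, hinv₁⟩ := exists_norm_inv_riemannZeta_le
  obtain ⟨C₂, hC₂, hinv₂⟩ := exists_norm_inv_riemannZeta_le_neg_half
  obtain ⟨C₃, hC₃, hhor⟩ := exists_horizontal_lower_bound hRH hsimple
  refine ⟨(C₁ + C₂) * Real.exp 4 + 1 + 3 * Real.exp 1, by positivity, fun s hs1 hs2 => ?_⟩
  set t : ℝ := s.im with ht
  obtain ⟨T, hT4, hTt, hTa, hTb⟩ : ∃ T : ℝ, 4 ≤ T ∧ |t| + 1 < T ∧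
      (T + 3) + 4 + C₃ * T ^ (3 / 2 : ℝ) ≤ (T - |t|) ^ 2 ∧
      C₃ * T ^ (3 / 2 : ℝ) ≤ (T - 1 - |t|) ^ 2 / 2 := by
    have ht0 := abs_nonneg t
    set v : ℝ := 8 * (C₃ + 8) + 2 * (1 + |t|) with hv
    have hv8 : 64 ≤ v := by linarith
    have hvC : C₃ + 8 ≤ v / 8 := by linarith
    have hpow : (v ^ 2) ^ (3 / 2 : ℝ) = v ^ 3 := by
      rw [← Real.rpow_natCast, ← Real.rpow_mul (by linarith), ← Real.rpow_natCast]
      norm_num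
    have h1 : v ≤ v ^ 2 := by nlinarith
    have h2 : v ^ 2 / 2 ≤ v ^ 2 - 1 - |t| := by nlinarith
    have h3 : v ^ 4 / 8 ≤ (v ^ 2 - 1 - |t|) ^ 2 / 2 := by
      have : (v ^ 2 / 2) ^ 2 ≤ (v ^ 2 - 1 - |t|) ^ 2 := by
        apply pow_le_pow_left₀ (by positivity) h2
      nlinarith
    have h4 : (C₃ + 8) * v ^ 3 ≤ v ^ 4 / 8 := by
      have : (C₃ + 8) * v ^ 3 ≤ v / 8 * v ^ 3 := by gcongr
      nlinarith
    have h5 : v ^ 2 ≤ v ^ 3 := by nlinarith [sq_nonneg v]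
    have h6 : (v ^ 2 - 1 - |t|) ^ 2 ≤ (v ^ 2 - |t|) ^ 2 := by
      apply pow_le_pow_left₀ <;> nlinarith
    refine ⟨v ^ 2, by nlinarith, by nlinarith, ?_, ?_⟩
    · rw [hpow]
      nlinarith [sq_nonneg (v ^ 2 - 1 - |t|)]
    · rw [hpow]
      nlinarith [pow_pos (show (0:ℝ) < v by linarith) 3]
  obtain ⟨x, hx, hxlow, hxγ⟩ := hhor T hT4
  have hx0 : 0 < x := by linarith [hx.1]
  set R : Set ℂ := Set.Icc (-1 / 2 : ℝ) (3 / 2) ×ℂ Set.Icc (-x) x with hR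
  have hRc : IsCompact R := isCompact_Icc.reProdIm isCompact_Icc
  obtain ⟨S, hSmem⟩ : ∃ S : Finset ℂ, ∀ ρ, ρ ∈ S ↔ riemannZeta₁ ρ = 0 ∧ ρ ∈ R :=
    ⟨(finite_zeros_riemannZeta₁ hRc).toFinset, fun ρ => by
      rw [Set.Finite.mem_toFinset, Set.mem_ofPred_eq]⟩
  have hSre : ∀ ρ ∈ S, ρ.re = 1 / 2 := fun ρ hρ => by
    obtain ⟨h1, h2⟩ := (hSmem ρ).mp hρ
    refine re_eq_half_of_riemannZeta₁_eq_zero hRH h1 ?_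
    have := (Complex.mem_reProdIm.mp h2).1.1
    linarith
  have hSeq : ∀ ρ ∈ S, ρ = 1 / 2 + ρ.im * Complex.I := fun ρ hρ => by
    apply Complex.ext <;> simp [hSre ρ hρ]
  have hSζ : ∀ ρ ∈ S, riemannZeta ρ = 0 := fun ρ hρ =>
    riemannZeta_eq_zero_of_riemannZeta₁ ((hSmem ρ).mp hρ).1
  have hSZ : ∀ ρ ∈ S, ρ.im ∈ zetaOrdinates := fun ρ hρ => by
    change riemannZeta _ = 0
    rw [← hSeq ρ hρ, hSζ ρ hρ]
  have hSd : ∀ ρ ∈ S, deriv riemannZeta ρ ≠ 0 := fun ρ hρ =>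
    hsimple ρ (hSζ ρ hρ) (by rw [hSre ρ hρ]; norm_num) (by rw [hSre ρ hρ]; norm_num)
  obtain ⟨H, hHd, hH⟩ := exists_regularized_inv_zeta (S := S)
    (fun ρ hρ => ⟨hSζ ρ hρ, by rw [hSeq ρ hρ]; exact half_add_mul_I_ne_one _⟩) hSd s
  set a : ℂ → ℝ := fun ρ => ‖deriv riemannZeta ρ‖⁻¹ with ha
  have ha0 : ∀ ρ, 0 ≤ a ρ := fun ρ => by positivity
  have hterm : ∀ w, ∀ ρ ∈ S, ‖Complex.exp ((ρ - s) ^ 2) / (deriv riemannZeta ρ * (w - ρ))‖ ≤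
      a ρ * Real.exp (1 - (t - ρ.im) ^ 2) / ‖w - ρ‖ := by
    intro w ρ hρ
    rw [norm_div, norm_mul, Complex.norm_exp, re_sub_sq, hSre ρ hρ, ← ht, ha]
    have h1 : (1 / 2 - s.re) ^ 2 - (ρ.im - t) ^ 2 ≤ 1 - (t - ρ.im) ^ 2 := by nlinarith
    calc _ ≤ Real.exp (1 - (t - ρ.im) ^ 2) / (‖deriv riemannZeta ρ‖ * ‖w - ρ‖) := by gcongr
      _ = _ := by rw [← div_div, div_eq_mul_inv _ ‖deriv riemannZeta ρ‖]; ring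
  set P₁ : ℝ := ∑ ρ ∈ S, a ρ * Real.exp (-((t - ρ.im) ^ 2 / 2)) with hP₁
  set M : ℝ := (C₁ + C₂) * Real.exp 4 + 1 + Real.exp 1 * P₁ with hM
  have hfront : ∀ w, riemannZeta₁ w ≠ 0 →
      ‖(w - 1) / riemannZeta₁ w * Complex.exp ((w - s) ^ 2)‖ ≤ (C₁ + C₂) * Real.exp 4 + 1 →
      (∀ ρ ∈ S, Real.exp (1 - (t - ρ.im) ^ 2) / ‖w - ρ‖ ≤
        Real.exp 1 * Real.exp (-((t - ρ.im) ^ 2 / 2))) → ‖H w‖ ≤ M := by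
    intro w hw h1 h2
    rw [hH w hw]
    refine (norm_sub_le _ _).trans (add_le_add h1 ((norm_sum_le _ _).trans ?_))
    rw [hP₁, Finset.mul_sum]
    refine Finset.sum_le_sum fun ρ hρ => (hterm w ρ hρ).trans ?_
    rw [mul_div_assoc, mul_left_comm]
    exact mul_le_mul_of_nonneg_left (h2 ρ hρ) (ha0 ρ)
  have hfar : ∀ w : ℂ, ∀ ρ : ℂ, 1 ≤ ‖w - ρ‖ → Real.exp (1 - (t - ρ.im) ^ 2) / ‖w - ρ‖ ≤
        Real.exp 1 * Real.exp (-((t - ρ.im) ^ 2 / 2)) := by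
    intro w ρ h
    refine (div_le_self (Real.exp_pos _).le h).trans ?_
    rw [← Real.exp_add]
    gcongr
    nlinarith [sq_nonneg (t - ρ.im)]
  set U : Set ℂ := Set.Ioo (-1 / 2 : ℝ) (3 / 2) ×ℂ Set.Ioo (-x) x with hU
  have hUcl : closure U = R := by
    rw [hU, Complex.closure_reProdIm, closure_Ioo (by norm_num), closure_Ioo (by linarith)]
  have hUb : Bornology.IsBounded U := hRc.isBounded.subset (hUcl ▸ subset_closure)
  have habs : |t| < x := by linarith [hx.1]
  have hsU : s ∈ U := by
    rw [hU, Complex.mem_reProdIm]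
    exact ⟨⟨by linarith, hs2⟩, abs_lt.mp habs⟩
  have hdiff : DiffContOnCl ℂ H U := by
    apply DifferentiableOn.diffContOnCl
    rw [hUcl]
    exact fun w hw => (hHd w fun h0 => (hSmem w).mpr ⟨h0, hw⟩).differentiableWithinAt
  have hvert : ∀ w : ℂ, (w.re = -1 / 2 ∨ w.re = 3 / 2) → ‖H w‖ ≤ M := by
    intro w hw
    have hw1 : w ≠ 1 := by rintro rfl; norm_num at hw
    have hw0 : riemannZeta₁ w ≠ 0 := fun h => by
      have := re_eq_half_of_riemannZeta₁_eq_zero hRH h (by rcases hw with h | h <;> rw [h] <;> norm_num)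
      rcases hw with h | h <;> rw [h] at this <;> norm_num at this
    refine hfront w hw0 ?_ fun ρ hρ => hfar w ρ ?_
    · rw [norm_mul, Complex.norm_exp, re_sub_sq, riemannZeta₁_eq hw1,
        ← div_div, div_self (sub_ne_zero.mpr hw1), one_div]
      have h1 : ‖(riemannZeta w)⁻¹‖ ≤ C₁ + C₂ := by
        rcases hw with h | h
        · linarith [hinv₂ w h]
        · linarith [hinv₁ w h.ge]
      have h2 : (w.re - s.re) ^ 2 - (w.im - s.im) ^ 2 ≤ 4 := by
        rcases hw with h | h <;> rw [h] <;> nlinarith [sq_nonneg (w.im - s.im)]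
      have : ‖(riemannZeta w)⁻¹‖ * Real.exp ((w.re - s.re) ^ 2 - (w.im - s.im) ^ 2) ≤
        (C₁ + C₂) * Real.exp 4 := by gcongr
      linarith
    · refine le_trans ?_ (Complex.abs_re_le_norm _)
      rw [Complex.sub_re, hSre ρ hρ]
      rcases hw with h | h <;> rw [h] <;> norm_num
  have hhoriz : ∀ w : ℂ, -1 / 2 ≤ w.re → w.re ≤ 3 / 2 → (w.im = x ∨ w.im = -x) → ‖H w‖ ≤ M := by
    intro w hw1 hw2 hw
    have hlow : Real.exp (-(C₃ * T ^ (3 / 2 : ℝ))) ≤ ‖riemannZeta₁ w‖ := by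
      have h1 := hxlow w.re hw1 hw2
      rcases hw with h | h
      · rwa [← h, Complex.re_add_im] at h1
      · have e : (w.re + x * Complex.I : ℂ) = starRingEnd ℂ w := by
          apply Complex.ext <;> simp [h]
        rwa [e, riemannZeta₁_conj, Complex.norm_conj] at h1
    have hγ : ∀ γ ∈ zetaOrdinates, Real.exp (-(C₃ * T ^ (3 / 2 : ℝ))) ≤ |w.im - γ| := by
      intro γ hγ
      rcases hw with h | h
      · rw [h]; exact hxγ γ hγ
      · have := hxγ (-γ) (neg_mem_zetaOrdinates hγ)
        rw [h, ← abs_neg]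
        convert this using 2
        ring
    have hw0 : riemannZeta₁ w ≠ 0 := norm_pos_iff.mp ((Real.exp_pos _).trans_le hlow)
    have habsw : |w.im| = x := by
      rcases hw with h | h <;> rw [h]
      · exact abs_of_pos hx0
      · rw [abs_neg, abs_of_pos hx0]
    have hdist : T - |t| ≤ |w.im - t| := by
      have := abs_sub_abs_le_abs_sub w.im t
      linarith [hx.1]
    refine hfront w hw0 ?_ fun ρ hρ => ?_
    · have h1 : ‖w - 1‖ ≤ Real.exp (T + 3) := by
        have h2 : ‖w - 1‖ ≤ |(w - 1).re| + |(w - 1).im| := Complex.norm_le_abs_re_add_abs_im _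
        have h3 : |(w - 1).re| ≤ 3 / 2 := by
          rw [Complex.sub_re, Complex.one_re, abs_le]; constructor <;> linarith
        have h4 : |(w - 1).im| ≤ T + 1 := by
          rw [Complex.sub_im, Complex.one_im, sub_zero, habsw]; exact hx.2
        linarith [Real.add_one_le_exp (T + 3)]
      have h5 : (w.re - s.re) ^ 2 - (w.im - t) ^ 2 ≤ 4 - (T - |t|) ^ 2 := by
        have h6 : (w.re - s.re) ^ 2 ≤ 4 := by nlinarith
        have h7 : (T - |t|) ^ 2 ≤ (w.im - t) ^ 2 := by
          rw [← sq_abs (w.im - t)]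
          exact pow_le_pow_left₀ (by linarith) hdist 2
        linarith
      rw [norm_mul, norm_div, Complex.norm_exp, re_sub_sq, ← ht]
      have h8 : 0 ≤ (C₁ + C₂) * Real.exp 4 := by positivity
      calc ‖w - 1‖ / ‖riemannZeta₁ w‖ * Real.exp ((w.re - s.re) ^ 2 - (w.im - t) ^ 2)
          ≤ Real.exp (T + 3) / Real.exp (-(C₃ * T ^ (3 / 2 : ℝ))) *
            Real.exp (4 - (T - |t|) ^ 2) := by gcongr
        _ = Real.exp (T + 3 - -(C₃ * T ^ (3 / 2 : ℝ)) + (4 - (T - |t|) ^ 2)) := by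
            rw [Real.exp_add (T + 3 - -(C₃ * T ^ (3 / 2 : ℝ))), Real.exp_sub (T + 3)]
        _ ≤ 1 := by
            rw [Real.exp_le_one_iff]
            linarith
        _ ≤ _ := by linarith
    · rcases le_or_gt 1 ‖w - ρ‖ with h1 | h1
      · exact hfar w ρ h1
      have h2 : |w.im - ρ.im| ≤ ‖w - ρ‖ := by
        rw [← Complex.sub_im]; exact Complex.abs_im_le_norm _
      have h3 : Real.exp (-(C₃ * T ^ (3 / 2 : ℝ))) ≤ ‖w - ρ‖ := (hγ _ (hSZ ρ hρ)).trans h2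
      have h4 : T - 1 - |t| ≤ |t - ρ.im| := by
        have := abs_sub_le w.im ρ.im t
        rw [abs_sub_comm ρ.im t] at this
        linarith
      have h5 : (T - 1 - |t|) ^ 2 ≤ (t - ρ.im) ^ 2 := by
        rw [← sq_abs (t - ρ.im)]
        exact pow_le_pow_left₀ (by linarith) h4 2
      calc Real.exp (1 - (t - ρ.im) ^ 2) / ‖w - ρ‖
          ≤ Real.exp (1 - (t - ρ.im) ^ 2) / Real.exp (-(C₃ * T ^ (3 / 2 : ℝ))) := by gcongr
        _ = Real.exp (1 - (t - ρ.im) ^ 2 - -(C₃ * T ^ (3 / 2 : ℝ))) := (Real.exp_sub _ _).symm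
        _ ≤ Real.exp (1 + -((t - ρ.im) ^ 2 / 2)) := by gcongr; linarith
        _ = _ := Real.exp_add _ _
  have hHs : ‖H s‖ ≤ M := by
    refine Complex.norm_le_of_forall_mem_frontier_norm_le hUb hdiff (fun w hw => ?_)
      (subset_closure hsU)
    rw [hU, Complex.frontier_reProdIm, closure_Ioo (by norm_num), closure_Ioo (neg_lt_self hx0).ne,
      frontier_Ioo (neg_lt_self hx0), frontier_Ioo (by norm_num)] at hw
    rcases hw with hw | hw
    · obtain ⟨h1, h2⟩ := Complex.mem_reProdIm.mp hw
      exact hhoriz w h1.1 h1.2 (by simpa [or_comm] using h2)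
    · exact hvert w (by simpa using (Complex.mem_reProdIm.mp hw).1)
  have hs0 : riemannZeta₁ s ≠ 0 := fun h => by
    have := re_eq_half_of_riemannZeta₁_eq_zero hRH h (by linarith)
    linarith
  refine ⟨S.image Complex.im, ?_, ?_⟩
  · intro γ hγ
    obtain ⟨ρ, hρ, rfl⟩ := Finset.mem_image.mp (Finset.mem_coe.mp hγ)
    exact hSZ ρ hρ
  rw [Finset.sum_image (fun ρ hρ ρ' hρ' h => by
    rw [hSeq ρ hρ, hSeq ρ' hρ', h])]
  set P₂ : ℝ := ∑ ρ ∈ S, a ρ * Real.exp (-((t - ρ.im) ^ 2 / 4)) / ‖s - ρ‖ with hP₂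
  have hPe : ∑ ρ ∈ S, ‖deriv riemannZeta (1 / 2 + (ρ.im : ℂ) * Complex.I)‖⁻¹ *
      Real.exp (-((t - ρ.im) ^ 2 / 4)) / ‖s - (1 / 2 + (ρ.im : ℂ) * Complex.I)‖ = P₂ :=
    Finset.sum_congr rfl fun ρ hρ => by rw [← hSeq ρ hρ]
  rw [hPe]
  have hP₂0 : 0 ≤ P₂ := Finset.sum_nonneg fun ρ _ => by
    have := ha0 ρ
    positivity
  have hspos : ∀ ρ ∈ S, 0 < ‖s - ρ‖ := fun ρ hρ => by
    refine lt_of_lt_of_le ?_ (Complex.abs_re_le_norm _)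
    rw [Complex.sub_re, hSre ρ hρ, abs_of_pos (by linarith)]
    linarith
  have hP12 : P₁ ≤ 2 * P₂ := by
    rw [hP₁, hP₂, Finset.mul_sum]
    refine Finset.sum_le_sum fun ρ hρ => ?_
    have h1 : ‖s - ρ‖ ≤ 1 + |t - ρ.im| := by
      refine (Complex.norm_le_abs_re_add_abs_im _).trans ?_
      rw [Complex.sub_re, hSre ρ hρ, abs_of_pos (by linarith), Complex.sub_im]
      linarith
    have h2 : ‖s - ρ‖ ≤ 2 * Real.exp ((t - ρ.im) ^ 2 / 4) := by
      have := Real.add_one_le_exp ((t - ρ.im) ^ 2 / 4)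
      nlinarith [sq_nonneg (|t - ρ.im| - 1), sq_abs (t - ρ.im)]
    have h3 : Real.exp (-((t - ρ.im) ^ 2 / 2)) * ‖s - ρ‖ ≤
        2 * Real.exp (-((t - ρ.im) ^ 2 / 4)) := by
      calc Real.exp (-((t - ρ.im) ^ 2 / 2)) * ‖s - ρ‖
          ≤ Real.exp (-((t - ρ.im) ^ 2 / 2)) * (2 * Real.exp ((t - ρ.im) ^ 2 / 4)) := by gcongr
        _ = 2 * Real.exp (-((t - ρ.im) ^ 2 / 2) + (t - ρ.im) ^ 2 / 4) := by
            rw [Real.exp_add]; ring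
        _ = _ := by ring_nf
    rw [mul_div_assoc, mul_left_comm, ← mul_div_assoc]
    refine mul_le_mul_of_nonneg_left ?_ (ha0 ρ)
    rwa [le_div_iff₀ (hspos ρ hρ)]
  have hkey : ‖(s - 1) / riemannZeta₁ s‖ ≤ M + Real.exp 1 * P₂ := by
    have h1 := hH s hs0
    rw [sub_self, zero_pow two_ne_zero, Complex.exp_zero, mul_one] at h1
    rw [eq_sub_iff_add_eq] at h1
    rw [← h1]
    refine (norm_add_le _ _).trans (add_le_add hHs ((norm_sum_le _ _).trans ?_))
    rw [hP₂, Finset.mul_sum]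
    refine Finset.sum_le_sum fun ρ hρ => (hterm s ρ hρ).trans ?_
    rw [← mul_div_assoc]
    refine div_le_div_of_nonneg_right ?_ (norm_nonneg _)
    rw [mul_left_comm, ← Real.exp_add]
    refine mul_le_mul_of_nonneg_left ?_ (ha0 ρ)
    gcongr
    nlinarith [sq_nonneg (t - ρ.im)]
  refine hkey.trans ?_
  rw [hM]
  have e1 : 0 ≤ ((C₁ + C₂) * Real.exp 4 + 1) * P₂ := by positivity
  have e2 : Real.exp 1 * P₁ ≤ Real.exp 1 * (2 * P₂) := by gcongr
  nlinarith [Real.exp_pos 1]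

lemma zetaOrdinates_inter_finite (T : ℝ) : {γ ∈ zetaOrdinates | |γ| ≤ T}.Finite := by
  have hK : IsCompact ((fun γ : ℝ => (1 / 2 + γ * Complex.I : ℂ)) '' Set.Icc (-T) T) :=
    isCompact_Icc.image (by fun_prop)
  refine ((finite_zeros_riemannZeta₁ hK).image Complex.im).subset fun γ hγ => ?_
  refine ⟨1 / 2 + γ * Complex.I, ⟨riemannZeta₁_eq_zero_of_mem hγ.1, γ, abs_le.mp hγ.2, rfl⟩, ?_⟩
  simp

lemma countable_zetaOrdinates : zetaOrdinates.Countable := by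
  have : zetaOrdinates ⊆ ⋃ n : ℕ, {γ ∈ zetaOrdinates | |γ| ≤ n} := fun γ hγ => by
    obtain ⟨n, hn⟩ := exists_nat_ge |γ|
    exact Set.mem_iUnion.mpr ⟨n, hγ, hn⟩
  exact (Set.countable_iUnion fun n : ℕ => (zetaOrdinates_inter_finite n).countable).mono this

lemma zero_notMem_zetaOrdinates : (0 : ℝ) ∉ zetaOrdinates := fun h => by
  have h : riemannZeta (1 / 2 + (0 : ℝ) * Complex.I) = 0 := h
  rw [Complex.ofReal_zero, zero_mul, add_zero] at h
  exact riemannZeta_half_ne_zero h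

/-- `|ζ'(1/2 + iγ)|⁻²`. -/
noncomputable def zetaWeight (γ : ℝ) : ℝ := 1 / ‖deriv riemannZeta (1 / 2 + γ * Complex.I)‖ ^ 2

lemma zetaWeight_nonneg (γ : ℝ) : 0 ≤ zetaWeight γ := by unfold zetaWeight; positivity

lemma zetaWeight_neg (γ : ℝ) : zetaWeight (-γ) = zetaWeight γ := by
  have e : (1 / 2 + ((-γ : ℝ) : ℂ) * Complex.I) = starRingEnd ℂ (1 / 2 + γ * Complex.I) := by
    apply Complex.ext <;> simp
  have h : (starRingEnd ℂ ∘ riemannZeta ∘ starRingEnd ℂ) = riemannZeta := by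
    funext s
    simp [riemannZeta_conj]
  have h2 := congrFun (deriv_conj_conj (f := riemannZeta)) (1 / 2 + γ * Complex.I)
  rw [h] at h2
  rw [zetaWeight, zetaWeight, e, h2, Function.comp_apply, Function.comp_apply, Complex.norm_conj]

lemma sum_zetaWeight_pos_le {θ C : ℝ} (hθ : θ < 3 / 2)
    (hJ : ∀ T : ℝ, 1 ≤ T →
      (∑' γ : {γ : ℝ // 0 < γ ∧ γ ≤ T ∧ riemannZeta (1 / 2 + γ * Complex.I) = 0},
        1 / ‖deriv riemannZeta (1 / 2 + (γ : ℝ) * Complex.I)‖ ^ 2) ≤ C * T ^ θ) :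
    ∃ B, 0 ≤ B ∧ ∀ F : Finset ℝ, (∀ γ ∈ F, γ ∈ zetaOrdinates ∧ 0 < γ) →
      ∑ γ ∈ F, zetaWeight γ * (1 + |γ|) ^ (-(3 / 2) : ℝ) ≤ B := by
  have hfinite : ∀ T : ℝ,
      Finite {γ : ℝ // 0 < γ ∧ γ ≤ T ∧ riemannZeta (1 / 2 + γ * Complex.I) = 0} := by
    intro T
    refine ((zetaOrdinates_inter_finite T).subset ?_).to_subtype
    rintro γ ⟨h1, h2, h3⟩
    exact ⟨h3, by rwa [abs_of_pos h1]⟩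
  have hC : 0 ≤ C := by
    have h := hJ 1 le_rfl
    rw [Real.one_rpow, mul_one] at h
    exact (tsum_nonneg fun γ => by positivity).trans h
  have hpart : ∀ T : ℝ, 1 ≤ T → ∀ F : Finset ℝ, (∀ γ ∈ F, γ ∈ zetaOrdinates ∧ 0 < γ ∧ γ ≤ T) →
      ∑ γ ∈ F, zetaWeight γ ≤ C * T ^ θ := by
    intro T hT F hF
    refine le_trans ?_ (hJ T hT)
    have := hfinite T
    rw [← Finset.sum_subtype_of_mem (p := fun γ => 0 < γ ∧ γ ≤ T ∧
      riemannZeta (1 / 2 + γ * Complex.I) = 0) zetaWeight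
      (fun γ hγ => ⟨(hF γ hγ).2.1, (hF γ hγ).2.2, (hF γ hγ).1⟩)]
    exact Summable.sum_le_tsum (f := fun γ : {γ : ℝ // 0 < γ ∧ γ ≤ T ∧
      riemannZeta (1 / 2 + γ * Complex.I) = 0} => zetaWeight γ) _
      (fun γ _ => zetaWeight_nonneg γ) (Summable.of_finite)
  set r : ℝ := 2 ^ (θ - 3 / 2) with hr
  have hr0 : 0 < r := by positivity
  have hr1 : r < 1 := Real.rpow_lt_one_of_one_lt_of_neg one_lt_two (by linarith)
  set D : ℝ := 2 ^ (3 / 2 : ℝ) * C with hD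
  have hD0 : 0 ≤ D := by positivity
  have hgeo := (hasSum_geometric_of_lt_one hr0.le hr1).mul_left D
  refine ⟨_, (hgeo.nonneg fun n => by positivity), fun F hF => ?_⟩
  have hk : ∀ γ : ℝ, ∃ k : ℕ, 0 < γ → γ ≤ 2 ^ k ∧ (2 : ℝ) ^ k ≤ 2 * (1 + γ) := by
    intro γ
    by_cases h : 0 < γ
    · obtain ⟨n, h1, h2⟩ := exists_nat_pow_near (x := 1 + γ) (y := 2) (by linarith) one_lt_two
      exact ⟨n + 1, fun _ => ⟨by linarith, by rw [pow_succ]; linarith⟩⟩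
    · exact ⟨0, fun h' => absurd h' h⟩
  choose k hk using hk
  rw [← Finset.sum_fiberwise_of_maps_to (t := F.image k) (g := k)
    fun γ hγ => Finset.mem_image_of_mem k hγ]
  refine le_trans (Finset.sum_le_sum (g := fun n : ℕ => D * r ^ n) fun n _ => ?_)
    (sum_le_hasSum _ (fun n _ => by positivity) hgeo)
  have h2n : (1 : ℝ) ≤ 2 ^ n := one_le_pow₀ one_le_two
  calc ∑ γ ∈ F with k γ = n, zetaWeight γ * (1 + |γ|) ^ (-(3 / 2) : ℝ)
      ≤ ∑ γ ∈ F with k γ = n, zetaWeight γ * ((2 : ℝ) ^ n / 2) ^ (-(3 / 2) : ℝ) := by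
        refine Finset.sum_le_sum fun γ hγ => mul_le_mul_of_nonneg_left ?_ (zetaWeight_nonneg γ)
        obtain ⟨h1, h2⟩ := Finset.mem_filter.mp hγ
        obtain ⟨h3, h4⟩ := hk γ (hF γ h1).2
        rw [abs_of_pos (hF γ h1).2]
        rw [h2] at h4
        exact Real.rpow_le_rpow_of_nonpos (by positivity) (by linarith) (by norm_num)
    _ ≤ C * ((2 : ℝ) ^ n) ^ θ * ((2 : ℝ) ^ n / 2) ^ (-(3 / 2) : ℝ) := by
        rw [← Finset.sum_mul]
        refine mul_le_mul_of_nonneg_right (hpart _ h2n _ fun γ hγ => ?_) (by positivity)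
        obtain ⟨h1, h2⟩ := Finset.mem_filter.mp hγ
        exact ⟨(hF γ h1).1, (hF γ h1).2, h2 ▸ (hk γ (hF γ h1).2).1⟩
    _ = D * r ^ n := by
        rw [hD, hr, Real.div_rpow (by positivity) two_pos.le, ← Real.rpow_natCast 2 n,
          ← Real.rpow_natCast, ← Real.rpow_mul two_pos.le, ← Real.rpow_mul two_pos.le,
          ← Real.rpow_mul two_pos.le, div_eq_mul_inv, ← Real.rpow_neg two_pos.le, neg_neg]
        have : (2 : ℝ) ^ ((θ - 3 / 2) * n) = 2 ^ ((n : ℝ) * θ) * 2 ^ ((n : ℝ) * -(3 / 2)) := by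
          rw [← Real.rpow_add two_pos]; ring_nf
        rw [this]; ring

/-- The weights `|ζ'(ρ)|⁻² (1 + |γ|)^(-3/2)` are summable over all zeros. -/
lemma summable_zetaWeight {θ C : ℝ} (hθ : θ < 3 / 2)
    (hJ : ∀ T : ℝ, 1 ≤ T →
      (∑' γ : {γ : ℝ // 0 < γ ∧ γ ≤ T ∧ riemannZeta (1 / 2 + γ * Complex.I) = 0},
        1 / ‖deriv riemannZeta (1 / 2 + (γ : ℝ) * Complex.I)‖ ^ 2) ≤ C * T ^ θ) :
    Summable fun γ : zetaOrdinates => zetaWeight γ * (1 + |(γ : ℝ)|) ^ (-(3 / 2) : ℝ) := by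
  obtain ⟨B, hB, h⟩ := sum_zetaWeight_pos_le hθ hJ
  have h0 : ∀ γ : ℝ, 0 ≤ zetaWeight γ * (1 + |γ|) ^ (-(3 / 2) : ℝ) := fun γ =>
    mul_nonneg (zetaWeight_nonneg γ) (by positivity)
  refine summable_of_sum_le (c := 2 * B) (fun γ => h0 γ) fun F => ?_
  set F' : Finset ℝ := F.map (Function.Embedding.subtype _) with hF'
  have hFZ : ∀ γ ∈ F', γ ∈ zetaOrdinates := fun γ hγ => by
    obtain ⟨x, -, rfl⟩ := Finset.mem_map.mp hγ
    exact x.2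
  have e : ∑ γ ∈ F, zetaWeight γ * (1 + |(γ : ℝ)|) ^ (-(3 / 2) : ℝ) =
      ∑ γ ∈ F', zetaWeight γ * (1 + |γ|) ^ (-(3 / 2) : ℝ) := by
    rw [hF', Finset.sum_map]; rfl
  rw [e, ← Finset.sum_filter_add_sum_filter_not F' (fun γ => 0 < γ), two_mul]
  refine add_le_add (h _ fun γ hγ => ?_) ?_
  · obtain ⟨h1, h2⟩ := Finset.mem_filter.mp hγ
    exact ⟨hFZ γ h1, h2⟩
  · have e2 : ∑ γ ∈ F' with ¬ 0 < γ, zetaWeight γ * (1 + |γ|) ^ (-(3 / 2) : ℝ) =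
        ∑ γ ∈ (F'.filter fun γ => ¬ 0 < γ).image Neg.neg,
          zetaWeight γ * (1 + |γ|) ^ (-(3 / 2) : ℝ) := by
      rw [Finset.sum_image (neg_injective.injOn)]
      exact Finset.sum_congr rfl fun γ _ => by rw [zetaWeight_neg, abs_neg]
    rw [e2]
    refine h _ fun γ hγ => ?_
    obtain ⟨x, hx, rfl⟩ := Finset.mem_image.mp hγ
    obtain ⟨h1, h2⟩ := Finset.mem_filter.mp hx
    have hx0 : x ≠ 0 := fun h => zero_notMem_zetaOrdinates (h ▸ hFZ x h1)
    refine ⟨neg_mem_zetaOrdinates (hFZ x h1), ?_⟩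
    have := lt_of_le_of_ne (not_lt.mp h2) hx0
    linarith

/-- Gaussian sums over zeros. -/
lemma exists_sum_gaussian_le :
    ∃ C, 0 < C ∧ ∀ (t : ℝ) (F : Finset ℝ), ↑F ⊆ zetaOrdinates →
      ∑ γ ∈ F, Real.exp (-((t - γ) ^ 2 / 4)) ≤ C * (1 + |t|) ^ (1 / 10 : ℝ) := by
  obtain ⟨C, hC, h⟩ := exists_card_zetaOrdinates_le
  have hgeo : Summable fun k : ℤ => Real.exp (-(|(k : ℝ)| / 2)) := by
    have h1 : Summable fun n : ℕ => Real.exp (-((n : ℝ) / 2)) := by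
      have := Real.summable_exp_nat_mul_iff (a := -(1 / 2)) |>.mpr (by norm_num)
      refine this.congr fun n => ?_
      congr 1; ring
    refine Summable.of_nat_of_neg ?_ ?_
    · simpa using h1
    · simpa using h1
  set A : ℝ := ∑' k : ℤ, Real.exp (-(|(k : ℝ)| / 2)) with hA
  have hA0 : 0 ≤ A := tsum_nonneg fun k => (Real.exp_pos _).le
  refine ⟨2 * C * Real.exp (3 / 2) * A + 1, by positivity, fun t F hF => ?_⟩
  have ht1 : 0 ≤ (1 + |t|) ^ (1 / 10 : ℝ) := by positivity
  rw [← Finset.sum_fiberwise_of_maps_to (t := F.image fun γ => round (γ - t))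
    (g := fun γ => round (γ - t)) fun γ hγ => Finset.mem_image_of_mem _ hγ]
  have hfib : ∀ k : ℤ, ∑ γ ∈ F with round (γ - t) = k, Real.exp (-((t - γ) ^ 2 / 4)) ≤
      2 * C * Real.exp (3 / 2) * (1 + |t|) ^ (1 / 10 : ℝ) * Real.exp (-(|(k : ℝ)| / 2)) := by
    intro k
    have hmem : ∀ γ ∈ F.filter (fun γ => round (γ - t) = k), γ ∈ zetaOrdinates ∧
        |γ - (t + k)| ≤ 1 / 2 := by
      intro γ hγ
      obtain ⟨h1, h2⟩ := Finset.mem_filter.mp hγ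
      refine ⟨hF (Finset.mem_coe.mpr h1), ?_⟩
      have := abs_sub_round (γ - t)
      rw [h2] at this
      rwa [← sub_sub]
    have hcard := h (t + k) _ hmem
    have hpt : ∀ γ ∈ F.filter (fun γ => round (γ - t) = k),
        Real.exp (-((t - γ) ^ 2 / 4)) ≤ Real.exp (3 / 2) * Real.exp (-|(k : ℝ)|) := by
      intro γ hγ
      rw [← Real.exp_add]
      gcongr
      have h1 := (hmem γ hγ).2
      have h2 : |(k : ℝ)| ≤ |t - γ| + 1 / 2 := by
        have := abs_sub_le (k : ℝ) (γ - t) 0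
        rw [sub_zero, sub_zero, abs_sub_comm γ t] at this
        have e : |(k : ℝ) - (γ - t)| = |γ - (t + k)| := by rw [← abs_neg]; ring_nf
        linarith
      nlinarith [sq_nonneg (|t - γ| - 2), sq_abs (t - γ)]
    have h3 : (1 + |t + k|) ^ (1 / 10 : ℝ) ≤
        (1 + |t|) ^ (1 / 10 : ℝ) * (2 * Real.exp (|(k : ℝ)| / 2)) := by
      have h4 : 1 + |t + k| ≤ (1 + |t|) * (1 + |(k : ℝ)|) := by
        have := abs_add_le t k
        have := mul_nonneg (abs_nonneg t) (abs_nonneg (k : ℝ))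
        nlinarith
      have h5 : (1 + |(k : ℝ)|) ^ (1 / 10 : ℝ) ≤ 2 * Real.exp (|(k : ℝ)| / 2) := by
        have h6 : (1 + |(k : ℝ)|) ^ (1 / 10 : ℝ) ≤ (1 + |(k : ℝ)|) ^ (1 : ℝ) :=
          Real.rpow_le_rpow_of_exponent_le (by linarith [abs_nonneg (k : ℝ)]) (by norm_num)
        rw [Real.rpow_one] at h6
        linarith [Real.add_one_le_exp (|(k : ℝ)| / 2)]
      calc (1 + |t + k|) ^ (1 / 10 : ℝ) ≤ ((1 + |t|) * (1 + |(k : ℝ)|)) ^ (1 / 10 : ℝ) := by gcongr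
        _ = (1 + |t|) ^ (1 / 10 : ℝ) * (1 + |(k : ℝ)|) ^ (1 / 10 : ℝ) :=
          Real.mul_rpow (by positivity) (by positivity)
        _ ≤ _ := by gcongr
    calc _ ≤ ∑ γ ∈ F with round (γ - t) = k, Real.exp (3 / 2) * Real.exp (-|(k : ℝ)|) :=
          Finset.sum_le_sum hpt
      _ = ((F.filter fun γ => round (γ - t) = k).card : ℝ) *
          (Real.exp (3 / 2) * Real.exp (-|(k : ℝ)|)) := by rw [Finset.sum_const, nsmul_eq_mul]
      _ ≤ (C * ((1 + |t|) ^ (1 / 10 : ℝ) * (2 * Real.exp (|(k : ℝ)| / 2)))) *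
          (Real.exp (3 / 2) * Real.exp (-|(k : ℝ)|)) := by
          refine mul_le_mul_of_nonneg_right (hcard.trans ?_) (by positivity)
          exact mul_le_mul_of_nonneg_left h3 hC.le
      _ = 2 * C * Real.exp (3 / 2) * (1 + |t|) ^ (1 / 10 : ℝ) *
          (Real.exp (|(k : ℝ)| / 2) * Real.exp (-|(k : ℝ)|)) := by ring
      _ = _ := by rw [← Real.exp_add]; ring_nf
  refine (Finset.sum_le_sum fun k _ => hfib k).trans ?_
  rw [← Finset.mul_sum]
  have hsum := hgeo.sum_le_tsum (F.image fun γ => round (γ - t)) (fun k _ => (Real.exp_pos _).le)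
  calc _ ≤ 2 * C * Real.exp (3 / 2) * (1 + |t|) ^ (1 / 10 : ℝ) * A := by gcongr
    _ ≤ _ := by nlinarith

lemma summable_div_norm_sq {b : zetaOrdinates → ℝ} (hb : ∀ γ, 0 ≤ b γ) (hs : Summable b) {s : ℂ}
    (h : 0 < s.re) : Summable fun γ : zetaOrdinates => b γ / ‖s - (γ : ℝ) * Complex.I‖ ^ 2 := by
  refine Summable.of_nonneg_of_le (fun γ => div_nonneg (hb γ) (by positivity)) (fun γ => ?_)
    (hs.mul_right (1 / s.re ^ 2))
  rw [div_eq_mul_one_div]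
  refine mul_le_mul_of_nonneg_left ?_ (hb γ)
  have : s.re ≤ ‖s - (γ : ℝ) * Complex.I‖ := by
    refine le_trans (le_of_eq ?_) (Complex.re_le_norm _)
    simp
  gcongr

/-- Mean-square form of the bound for `1/ζ` near the critical line. -/
lemma exists_norm_inv_zeta_sq_le
    (hRH : ∀ ρ : ℂ, riemannZeta ρ = 0 → 0 < ρ.re → ρ.re < 1 → ρ.re = 1 / 2)
    (hsimple : ∀ ρ : ℂ, riemannZeta ρ = 0 → 0 < ρ.re → ρ.re < 1 → deriv riemannZeta ρ ≠ 0)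
    {θ C : ℝ} (hθ : θ < 3 / 2)
    (hJ : ∀ T : ℝ, 1 ≤ T →
      (∑' γ : {γ : ℝ // 0 < γ ∧ γ ≤ T ∧ riemannZeta (1 / 2 + γ * Complex.I) = 0},
        1 / ‖deriv riemannZeta (1 / 2 + (γ : ℝ) * Complex.I)‖ ^ 2) ≤ C * T ^ θ) :
    ∃ b : zetaOrdinates → ℝ, (∀ γ, 0 ≤ b γ) ∧ Summable b ∧ ∃ C, 0 < C ∧
      ∀ s : ℂ, 0 < s.re → s.re < 1 → ‖(s - 1 / 2) / riemannZeta₁ (1 / 2 + s)‖ ^ 2 ≤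
        C + C * (1 + |s.im|) ^ (8 / 5 : ℝ) *
          ∑' γ : zetaOrdinates, b γ / ‖s - (γ : ℝ) * Complex.I‖ ^ 2 := by
  have hb0 : ∀ γ : zetaOrdinates, 0 ≤ zetaWeight γ * (1 + |(γ : ℝ)|) ^ (-(3 / 2) : ℝ) := fun γ =>
    mul_nonneg (zetaWeight_nonneg γ) (by positivity)
  refine ⟨_, hb0, summable_zetaWeight hθ hJ, ?_⟩
  obtain ⟨C₁, hC₁, h₁⟩ := exists_norm_inv_zeta_le hRH hsimple
  obtain ⟨C₂, hC₂, h₂⟩ := exists_sum_gaussian_le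
  refine ⟨2 * C₁ ^ 2 + 16 * C₁ ^ 2 * C₂, by positivity, fun s hs0 hs1 => ?_⟩
  have hsum := summable_div_norm_sq hb0 (summable_zetaWeight hθ hJ) hs0
  set t : ℝ := s.im with ht
  obtain ⟨F, hFZ, hF⟩ := h₁ (1 / 2 + s) (by simpa using hs0) (by simp; linarith)
  have him : (1 / 2 + s : ℂ).im = t := by simp [ht]
  rw [him] at hF
  have e1 : ∀ γ : ℝ, (1 / 2 + s : ℂ) - (1 / 2 + γ * Complex.I) = s - γ * Complex.I :=
    fun γ => by ring
  have e2 : (1 / 2 + s : ℂ) - 1 = s - 1 / 2 := by ring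
  simp only [e1, e2] at hF
  set W : ℝ := ∑' γ : zetaOrdinates, zetaWeight γ * (1 + |(γ : ℝ)|) ^ (-(3 / 2) : ℝ) /
    ‖s - (γ : ℝ) * Complex.I‖ ^ 2 with hW
  have hW0 : 0 ≤ W := tsum_nonneg fun γ => div_nonneg (hb0 γ) (by positivity)
  set X : ℝ := ∑ γ ∈ F, ‖deriv riemannZeta (1 / 2 + γ * Complex.I)‖⁻¹ *
    Real.exp (-((t - γ) ^ 2 / 4)) / ‖s - γ * Complex.I‖ with hX
  have hX0 : 0 ≤ X := Finset.sum_nonneg fun γ _ => by positivity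
  have hmain : ∑ γ ∈ F, zetaWeight γ * Real.exp (-((t - γ) ^ 2 / 4)) / ‖s - γ * Complex.I‖ ^ 2 ≤
      8 * (1 + |t|) ^ (3 / 2 : ℝ) * W := by
    have hle : ∑ γ ∈ F, zetaWeight γ * (1 + |γ|) ^ (-(3 / 2) : ℝ) / ‖s - γ * Complex.I‖ ^ 2 ≤ W := by
      classical
      rw [← Finset.sum_subtype_of_mem (p := fun γ => γ ∈ zetaOrdinates)
        (fun γ : ℝ => zetaWeight γ * (1 + |γ|) ^ (-(3 / 2) : ℝ) / ‖s - γ * Complex.I‖ ^ 2)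
        (fun γ hγ => hFZ (Finset.mem_coe.mpr hγ))]
      exact hsum.sum_le_tsum _ fun γ _ => div_nonneg (hb0 γ) (by positivity)
    refine le_trans ?_ (mul_le_mul_of_nonneg_left hle (by positivity))
    rw [Finset.mul_sum]
    refine Finset.sum_le_sum fun γ _ => ?_
    rw [← mul_div_assoc, mul_left_comm]
    refine div_le_div_of_nonneg_right ?_ (by positivity)
    refine mul_le_mul_of_nonneg_left ?_ (zetaWeight_nonneg γ)
    rw [Real.rpow_neg (by positivity), ← div_eq_mul_inv, le_div_iff₀ (by positivity)]
    have h3 : 1 + |γ| ≤ (1 + |t|) * (1 + |t - γ|) := by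
      have h4 : |γ| ≤ |t| + |t - γ| := by
        have := abs_sub t (t - γ)
        rwa [sub_sub_cancel] at this
      nlinarith [mul_nonneg (abs_nonneg t) (abs_nonneg (t - γ))]
    have h5 : (1 + |t - γ|) ^ (3 / 2 : ℝ) ≤ 8 * Real.exp ((t - γ) ^ 2 / 4) := by
      have h6 : (1 + |t - γ|) ^ (3 / 2 : ℝ) ≤ (1 + |t - γ|) ^ (2 : ℝ) :=
        Real.rpow_le_rpow_of_exponent_le (by linarith [abs_nonneg (t - γ)]) (by norm_num)
      rw [Real.rpow_two] at h6
      have := Real.add_one_le_exp ((t - γ) ^ 2 / 4)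
      nlinarith [sq_nonneg (|t - γ| - 1), sq_abs (t - γ)]
    calc Real.exp (-((t - γ) ^ 2 / 4)) * (1 + |γ|) ^ (3 / 2 : ℝ)
        ≤ Real.exp (-((t - γ) ^ 2 / 4)) * ((1 + |t|) * (1 + |t - γ|)) ^ (3 / 2 : ℝ) := by gcongr
      _ = Real.exp (-((t - γ) ^ 2 / 4)) * ((1 + |t|) ^ (3 / 2 : ℝ) * (1 + |t - γ|) ^ (3 / 2 : ℝ)) := by
          rw [Real.mul_rpow (by positivity) (by positivity)]
      _ ≤ Real.exp (-((t - γ) ^ 2 / 4)) * ((1 + |t|) ^ (3 / 2 : ℝ) *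
            (8 * Real.exp ((t - γ) ^ 2 / 4))) := by gcongr
      _ = 8 * (1 + |t|) ^ (3 / 2 : ℝ) *
            (Real.exp (-((t - γ) ^ 2 / 4)) * Real.exp ((t - γ) ^ 2 / 4)) := by ring
      _ = _ := by rw [← Real.exp_add]; simp
  have hCS : X ^ 2 ≤ (8 * (1 + |t|) ^ (3 / 2 : ℝ) * W) * (C₂ * (1 + |t|) ^ (1 / 10 : ℝ)) := by
    have h3 := Finset.sum_mul_sq_le_sq_mul_sq F
      (fun γ : ℝ => ‖deriv riemannZeta (1 / 2 + γ * Complex.I)‖⁻¹ *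
        Real.exp (-((t - γ) ^ 2 / 8)) / ‖s - γ * Complex.I‖)
      (fun γ => Real.exp (-((t - γ) ^ 2 / 8)))
    have hexp : ∀ γ : ℝ, Real.exp (-((t - γ) ^ 2 / 4)) = Real.exp (-((t - γ) ^ 2 / 8)) ^ 2 := by
      intro γ
      rw [← Real.exp_nat_mul]; congr 1; push_cast; ring
    have a1 : ∑ γ ∈ F, ‖deriv riemannZeta (1 / 2 + γ * Complex.I)‖⁻¹ *
        Real.exp (-((t - γ) ^ 2 / 8)) / ‖s - γ * Complex.I‖ * Real.exp (-((t - γ) ^ 2 / 8)) = X :=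
      Finset.sum_congr rfl fun γ _ => by rw [hexp]; ring
    have a2 : ∑ γ ∈ F, (‖deriv riemannZeta (1 / 2 + γ * Complex.I)‖⁻¹ *
        Real.exp (-((t - γ) ^ 2 / 8)) / ‖s - γ * Complex.I‖) ^ 2 = ∑ γ ∈ F,
          zetaWeight γ * Real.exp (-((t - γ) ^ 2 / 4)) / ‖s - γ * Complex.I‖ ^ 2 :=
      Finset.sum_congr rfl fun γ _ => by rw [hexp, zetaWeight]; ring
    have a3 : ∑ γ ∈ F, Real.exp (-((t - γ) ^ 2 / 8)) ^ 2 =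
        ∑ γ ∈ F, Real.exp (-((t - γ) ^ 2 / 4)) := Finset.sum_congr rfl fun γ _ => (hexp γ).symm
    rw [a1, a2, a3] at h3
    refine h3.trans (mul_le_mul hmain (h₂ t F hFZ) (Finset.sum_nonneg fun γ _ => by positivity) ?_)
    positivity
  have hpow : (1 + |t|) ^ (3 / 2 : ℝ) * (1 + |t|) ^ (1 / 10 : ℝ) = (1 + |t|) ^ (8 / 5 : ℝ) := by
    rw [← Real.rpow_add (by positivity)]; norm_num
  calc ‖(s - 1 / 2) / riemannZeta₁ (1 / 2 + s)‖ ^ 2 ≤ (C₁ + C₁ * X) ^ 2 :=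
        pow_le_pow_left₀ (norm_nonneg _) hF 2
    _ ≤ 2 * C₁ ^ 2 + 2 * C₁ ^ 2 * X ^ 2 := by nlinarith [sq_nonneg (C₁ - C₁ * X)]
    _ ≤ 2 * C₁ ^ 2 + 2 * C₁ ^ 2 *
        ((8 * (1 + |t|) ^ (3 / 2 : ℝ) * W) * (C₂ * (1 + |t|) ^ (1 / 10 : ℝ))) := by gcongr
    _ = 2 * C₁ ^ 2 + 16 * C₁ ^ 2 * C₂ * (1 + |t|) ^ (8 / 5 : ℝ) * W := by rw [← hpow]; ring
    _ ≤ _ := by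
      have : 0 ≤ (1 + |t|) ^ (8 / 5 : ℝ) * W := by positivity
      have : 0 ≤ 16 * C₁ ^ 2 * C₂ := by positivity
      have : 0 ≤ 2 * C₁ ^ 2 * ((1 + |t|) ^ (8 / 5 : ℝ) * W) := by positivity
      nlinarith

lemma lintegral_inv_sq_add_sq {σ : ℝ} (hσ : 0 < σ) (γ : ℝ) :
    ∫⁻ t : ℝ, ENNReal.ofReal (1 / ‖(σ + t * Complex.I : ℂ) - γ * Complex.I‖ ^ 2) =
      ENNReal.ofReal (Real.pi / σ) := by
  have e : ∀ t : ℝ, 1 / ‖(σ + t * Complex.I : ℂ) - γ * Complex.I‖ ^ 2 =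
      1 / σ ^ 2 * (1 + ((t - γ) / σ) ^ 2)⁻¹ := by
    intro t
    have : ‖(σ + t * Complex.I : ℂ) - γ * Complex.I‖ ^ 2 = σ ^ 2 + (t - γ) ^ 2 := by
      rw [Complex.sq_norm, Complex.normSq_apply]; simp; ring
    rw [this]
    field_simp
  simp only [e]
  rw [← ofReal_integral_eq_lintegral_ofReal]
  · congr 1
    rw [integral_const_mul, integral_sub_right_eq_self (fun t : ℝ => (1 + (t / σ) ^ 2)⁻¹) γ,
      Measure.integral_comp_div (fun t : ℝ => (1 + t ^ 2)⁻¹) σ, integral_univ_inv_one_add_sq,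
      abs_of_pos hσ, smul_eq_mul]
    field_simp
  · refine Integrable.const_mul ?_ _
    exact ((integrable_inv_one_add_sq.comp_div hσ.ne').comp_sub_right γ)
  · exact Eventually.of_forall fun t => by positivity

/-- Tails on vertical lines of a function controlled by `∑ b_i / |s - iγ_i|²`. -/
lemma exists_forall_lintegral_tail_le {ι : Type*} [Countable ι] {b γ : ι → ℝ} (hb : ∀ i, 0 ≤ b i)
    (hs : Summable b) {C K : ℝ} (hC : 0 ≤ C) {G : ℂ → ℂ}
    (hG : ∀ s : ℂ, 0 < s.re → s.re ≤ K → 1 ≤ |s.im| → ‖G s‖ ^ 2 ≤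
      C * (1 + |s.im|) ^ (-(9 / 5) : ℝ) + C * (1 + |s.im|) ^ (-(1 / 5) : ℝ) *
        ∑' i, b i / ‖s - γ i * Complex.I‖ ^ 2) {ε : ℝ} (hε : 0 < ε) :
    ∃ T₀, 1 ≤ T₀ ∧ ∀ T, T₀ ≤ T → ∀ σ : ℝ, 0 < σ → σ ≤ K →
      ∫⁻ t in {t : ℝ | T < |t|}, ‖G (σ + t * Complex.I)‖ₑ ^ 2 ≤ ENNReal.ofReal (ε / σ) := by
  rcases lt_or_ge 0 K with hK | hK
  swap
  · exact ⟨1, le_rfl, fun T _ σ h1 h2 => absurd (h1.trans_le h2) (not_lt.mpr hK)⟩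
  have hI : Integrable fun t : ℝ => (1 + ‖t‖) ^ (-(8 / 5) : ℝ) :=
    integrable_one_add_norm (by simp; norm_num)
  set I : ℝ := ∫ t : ℝ, (1 + ‖t‖) ^ (-(8 / 5) : ℝ) with hIdef
  have hI0 : 0 ≤ I := integral_nonneg fun t => by positivity
  set B : ℝ := ∑' i, b i with hB
  have hB0 : 0 ≤ B := tsum_nonneg hb
  have hlim : Tendsto (fun T : ℝ => C * (1 + T) ^ (-(1 / 5) : ℝ) * (I * K + B * Real.pi)) atTop
      (𝓝 0) := by
    have h1 : Tendsto (fun T : ℝ => (1 + T) ^ (-(1 / 5) : ℝ)) atTop (𝓝 0) :=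
      (tendsto_rpow_neg_atTop (by norm_num)).comp (tendsto_atTop_add_const_left _ 1 tendsto_id)
    simpa using (h1.const_mul C).mul_const (I * K + B * Real.pi)
  obtain ⟨T₁, hT₁⟩ := eventually_atTop.mp (hlim.eventually_le_const hε)
  refine ⟨max T₁ 1, le_max_right _ _, fun T hT σ hσ hσK => ?_⟩
  have hT1 : 1 ≤ T := (le_max_right _ _).trans hT
  have hε' := hT₁ T ((le_max_left _ _).trans hT)
  set c : ℝ := C * (1 + T) ^ (-(1 / 5) : ℝ) with hc
  have hc0 : 0 ≤ c := by positivity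
  have hnorm : ∀ t : ℝ, ∀ i, σ ^ 2 ≤ ‖(σ + t * Complex.I : ℂ) - γ i * Complex.I‖ ^ 2 := by
    intro t i
    rw [Complex.sq_norm, Complex.normSq_apply]
    simp
    nlinarith [mul_self_nonneg (t - γ i)]
  have hpt : ∀ t ∈ {t : ℝ | T < |t|}, ‖G (σ + t * Complex.I)‖ₑ ^ 2 ≤
      ENNReal.ofReal (c * (1 + ‖t‖) ^ (-(8 / 5) : ℝ)) + ENNReal.ofReal c *
        ∑' i, ENNReal.ofReal (b i) *
          ENNReal.ofReal (1 / ‖(σ + t * Complex.I : ℂ) - γ i * Complex.I‖ ^ 2) := by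
    intro t ht
    have ht : T < |t| := ht
    have h1 := hG (σ + t * Complex.I) (by simpa using hσ) (by simpa using hσK)
      (by simp; linarith)
    have him : (σ + t * Complex.I : ℂ).im = t := by simp
    rw [him] at h1
    have hsum : Summable fun i => b i / ‖(σ + t * Complex.I : ℂ) - γ i * Complex.I‖ ^ 2 := by
      refine Summable.of_nonneg_of_le (fun i => div_nonneg (hb i) (by positivity)) (fun i => ?_)
        (hs.mul_right (1 / σ ^ 2))
      rw [div_eq_mul_one_div]
      have := hnorm t i
      have := hb i
      gcongr
    set X : ℝ := ∑' i, b i / ‖(σ + t * Complex.I : ℂ) - γ i * Complex.I‖ ^ 2 with hX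
    have hX0 : 0 ≤ X := tsum_nonneg fun i => div_nonneg (hb i) (by positivity)
    have h2 : (1 + |t|) ^ (-(1 / 5) : ℝ) ≤ (1 + T) ^ (-(1 / 5) : ℝ) :=
      Real.rpow_le_rpow_of_nonpos (by linarith) (by linarith) (by norm_num)
    have h3 : (1 + |t|) ^ (-(9 / 5) : ℝ) = (1 + |t|) ^ (-(1 / 5) : ℝ) * (1 + |t|) ^ (-(8 / 5) : ℝ) := by
      rw [← Real.rpow_add (by positivity)]; norm_num
    have h4 : ‖G (σ + t * Complex.I)‖ ^ 2 ≤ c * (1 + ‖t‖) ^ (-(8 / 5) : ℝ) + c * X := by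
      refine h1.trans ?_
      rw [h3, hc, ← mul_assoc, Real.norm_eq_abs]
      gcongr
    have h5 : ‖G (σ + t * Complex.I)‖ₑ ^ 2 = ENNReal.ofReal (‖G (σ + t * Complex.I)‖ ^ 2) := by
      rw [← ofReal_norm, ENNReal.ofReal_pow (norm_nonneg _)]
    have h6 : ∑' i, ENNReal.ofReal (b i) *
        ENNReal.ofReal (1 / ‖(σ + t * Complex.I : ℂ) - γ i * Complex.I‖ ^ 2) =
        ENNReal.ofReal X := by
      rw [hX, ENNReal.ofReal_tsum_of_nonneg (fun i => div_nonneg (hb i) (by positivity)) hsum]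
      exact tsum_congr fun i => by rw [← ENNReal.ofReal_mul (hb i), mul_one_div]
    rw [h5, h6, ← ENNReal.ofReal_mul hc0, ← ENNReal.ofReal_add (by positivity) (by positivity)]
    exact ENNReal.ofReal_le_ofReal h4
  have hmeas : MeasurableSet {t : ℝ | T < |t|} := measurableSet_lt measurable_const (by fun_prop)
  calc ∫⁻ t in {t : ℝ | T < |t|}, ‖G (σ + t * Complex.I)‖ₑ ^ 2
      ≤ ∫⁻ t in {t : ℝ | T < |t|}, (ENNReal.ofReal (c * (1 + ‖t‖) ^ (-(8 / 5) : ℝ)) +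
          ENNReal.ofReal c * ∑' i, ENNReal.ofReal (b i) *
          ENNReal.ofReal (1 / ‖(σ + t * Complex.I : ℂ) - γ i * Complex.I‖ ^ 2)) :=
        setLIntegral_mono' hmeas hpt
    _ ≤ ∫⁻ t : ℝ, (ENNReal.ofReal (c * (1 + ‖t‖) ^ (-(8 / 5) : ℝ)) +
          ENNReal.ofReal c * ∑' i, ENNReal.ofReal (b i) *
          ENNReal.ofReal (1 / ‖(σ + t * Complex.I : ℂ) - γ i * Complex.I‖ ^ 2)) :=
        setLIntegral_le_lintegral _ _
    _ = ENNReal.ofReal (c * I) + ENNReal.ofReal c *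
          ∑' i, ENNReal.ofReal (b i) * ENNReal.ofReal (Real.pi / σ) := by
        rw [lintegral_add_left (by fun_prop), lintegral_const_mul _ (by fun_prop),
          lintegral_tsum (fun i => by fun_prop)]
        congr 1
        · rw [← ofReal_integral_eq_lintegral_ofReal (hI.const_mul c)
            (Eventually.of_forall fun t => by positivity), integral_const_mul]
        · congr 1
          refine tsum_congr fun i => ?_
          rw [lintegral_const_mul _ (by fun_prop), lintegral_inv_sq_add_sq hσ]
    _ = ENNReal.ofReal (c * I + c * (B * (Real.pi / σ))) := by
        rw [ENNReal.tsum_mul_right, ← ENNReal.ofReal_tsum_of_nonneg hb hs,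
          ← ENNReal.ofReal_mul hB0, ← ENNReal.ofReal_mul hc0,
          ← ENNReal.ofReal_add (by positivity) (by positivity)]
    _ ≤ _ := by
        apply ENNReal.ofReal_le_ofReal
        rw [le_div_iff₀ hσ]
        have h1 : c * I * σ ≤ c * I * K := by gcongr
        have h2 : (c * I + c * (B * (Real.pi / σ))) * σ = c * I * σ + c * (B * Real.pi) := by
          field_simp
        rw [h2]
        linarith

/-- A function that is bounded near each point of a compact segment of the imaginary axis, from
the right, is bounded on a rectangle to the right of the segment. -/
lemma exists_forall_norm_le_of_isBigO {F : ℂ → ℂ} {T : ℝ}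
    (h : ∀ u : ℝ, |u| ≤ T → F =O[𝓝[{s | 0 < s.re}] (u * Complex.I)] fun _ => (1 : ℝ)) :
    ∃ B δ : ℝ, 0 ≤ B ∧ 0 < δ ∧ ∀ σ : ℝ, 0 < σ → σ < δ → ∀ t : ℝ, |t| ≤ T →
      ‖F (σ + t * Complex.I)‖ ≤ B := by
  have key : ∃ B δ : ℝ, 0 ≤ B ∧ 0 < δ ∧ ∀ σ : ℝ, 0 < σ → σ < δ → ∀ t ∈ Set.Icc (-T) T,
      ‖F (σ + t * Complex.I)‖ ≤ B := by
    refine isCompact_Icc.induction_on (p := fun S : Set ℝ => ∃ B δ : ℝ, 0 ≤ B ∧ 0 < δ ∧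
      ∀ σ : ℝ, 0 < σ → σ < δ → ∀ t ∈ S, ‖F (σ + t * Complex.I)‖ ≤ B) ?_ ?_ ?_ ?_
    · exact ⟨0, 1, le_rfl, one_pos, fun σ _ _ t ht => absurd ht (Set.notMem_empty t)⟩
    · rintro S S' hSS ⟨B, δ, hB, hδ, H⟩
      exact ⟨B, δ, hB, hδ, fun σ h1 h2 t ht => H σ h1 h2 t (hSS ht)⟩
    · rintro S S' ⟨B, δ, hB, hδ, H⟩ ⟨B', δ', hB', hδ', H'⟩
      refine ⟨max B B', min δ δ', hB.trans (le_max_left _ _), lt_min hδ hδ', ?_⟩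
      rintro σ h1 h2 t (ht | ht)
      · exact (H σ h1 (h2.trans_le (min_le_left _ _)) t ht).trans (le_max_left _ _)
      · exact (H' σ h1 (h2.trans_le (min_le_right _ _)) t ht).trans (le_max_right _ _)
    · intro u hu
      obtain ⟨B, hB, hBF⟩ := (h u (abs_le.mpr hu)).exists_pos
      rw [Asymptotics.isBigOWith_iff, eventually_nhdsWithin_iff, Metric.eventually_nhds_iff] at hBF
      obtain ⟨η, hη, H⟩ := hBF
      refine ⟨Metric.ball u (η / 2), mem_nhdsWithin_of_mem_nhds (Metric.ball_mem_nhds u (by positivity)),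
        B, η / 2, hB.le, by positivity, fun σ h1 h2 t ht => ?_⟩
      have := H (y := σ + t * Complex.I) ?_ (by simpa using h1)
      · simpa using this
      · rw [dist_eq_norm]
        have h3 : |t - u| < η / 2 := by rwa [Metric.mem_ball, Real.dist_eq] at ht
        refine (Complex.norm_le_abs_re_add_abs_im _).trans_lt ?_
        have e1 : ((σ + t * Complex.I : ℂ) - u * Complex.I).re = σ := by simp
        have e2 : ((σ + t * Complex.I : ℂ) - u * Complex.I).im = t - u := by simp
        rw [e1, e2, abs_of_pos h1]
        linarith
  obtain ⟨B, δ, hB, hδ, H⟩ := key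
  exact ⟨B, δ, hB, hδ, fun σ h1 h2 t ht => H σ h1 h2 t (abs_le.mp ht)⟩

lemma star_expChar (γ : ℝ) : star (expChar γ) = expChar (-γ) := by
  ext y
  simp only [BoundedContinuousFunction.star_apply, expChar_apply, Complex.star_def,
    ← Complex.exp_conj]
  congr 1
  simp

lemma sum_smul_expChar_mem (S : Finset ℝ) (r : ℝ → ℂ) :
    ∑ u ∈ S, r u • expChar u ∈ trigAlg :=
  Subalgebra.sum_mem _ fun u _ =>
    Subalgebra.smul_mem _ (Algebra.subset_adjoin (Set.mem_range_self u)) _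

lemma star_sum_smul_expChar_mem (S : Finset ℝ) (r : ℝ → ℂ) :
    star (∑ u ∈ S, r u • expChar u) ∈ trigAlg := by
  rw [star_sum]
  refine Subalgebra.sum_mem _ fun u _ => ?_
  rw [star_smul, star_expChar]
  exact Subalgebra.smul_mem _ (Algebra.subset_adjoin (Set.mem_range_self _)) _

lemma integrableOn_expChar_mul (u : ℝ) {s : ℂ} (hs : 0 < s.re) :
    IntegrableOn (fun y : ℝ => expChar u y * Complex.exp (-s * y)) (Set.Ioi 0) := by
  have : (fun y : ℝ => expChar u y * Complex.exp (-s * y)) =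
      fun y : ℝ => Complex.exp ((u * Complex.I - s) * y) := by
    ext y
    rw [expChar_apply, ← Complex.exp_add]
    congr 1; push_cast; ring
  rw [this]
  exact integrableOn_exp_mul_complex_Ioi (by simpa) 0

lemma integral_expChar_mul (u : ℝ) {s : ℂ} (hs : 0 < s.re) :
    ∫ y in Set.Ioi (0:ℝ), expChar u y * Complex.exp (-s * y) = 1 / (s - u * Complex.I) := by
  have : (fun y : ℝ => expChar u y * Complex.exp (-s * y)) =
      fun y : ℝ => Complex.exp ((u * Complex.I - s) * y) := by
    ext y
    rw [expChar_apply, ← Complex.exp_add]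
    congr 1; push_cast; ring
  rw [this, integral_exp_mul_complex_Ioi (by simpa) 0]
  simp only [Complex.ofReal_zero, mul_zero, Complex.exp_zero]
  rw [← neg_sub s, neg_div_neg_eq]

lemma sub_ne_zero_of_re_pos (u : ℝ) {s : ℂ} (hs : 0 < s.re) : s - u * Complex.I ≠ 0 := by
  intro h
  have := congrArg Complex.re h
  simp at this
  linarith

lemma exists_norm_sum_div_le {S : Finset ℝ} {r : ℝ → ℂ} {T : ℝ} (hT : 1 ≤ T)
    (hS : ∀ u ∈ S, |u| < T) :
    ∃ D, 0 ≤ D ∧ ∀ s : ℂ, T < |s.im| →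
      ‖∑ u ∈ S, r u / (s - u * Complex.I)‖ ^ 2 ≤ D * (1 + s.im ^ 2)⁻¹ := by
  set D₀ : ℝ := ∑ u ∈ S, ‖r u‖ / (1 - |u| / T) with hD₀
  have hpos : ∀ u ∈ S, 0 < 1 - |u| / T := fun u hu => by
    rw [sub_pos, div_lt_one (by linarith)]; exact hS u hu
  have hD : 0 ≤ D₀ := Finset.sum_nonneg fun u hu => div_nonneg (norm_nonneg _) (hpos u hu).le
  refine ⟨2 * D₀ ^ 2, by positivity, fun s hs => ?_⟩
  have h0 : 0 < |s.im| := by linarith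
  have h1 : ‖∑ u ∈ S, r u / (s - u * Complex.I)‖ ≤ D₀ / |s.im| := by
    refine (norm_sum_le _ _).trans ?_
    rw [hD₀, Finset.sum_div]
    refine Finset.sum_le_sum fun u hu => ?_
    rw [norm_div, div_div]
    have h2 : (1 - |u| / T) * |s.im| ≤ ‖s - u * Complex.I‖ := by
      have h3 := Complex.abs_im_le_norm (s - u * Complex.I)
      simp only [Complex.sub_im, Complex.mul_im, Complex.ofReal_re, Complex.I_im, mul_one,
        Complex.ofReal_im, Complex.I_re, mul_zero, add_zero] at h3
      have h4 := abs_sub_abs_le_abs_sub s.im u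
      have h5 : |u| ≤ |u| / T * |s.im| := by
        rw [div_mul_eq_mul_div, le_div_iff₀ (by linarith)]
        gcongr
      linarith
    exact div_le_div_of_nonneg_left (norm_nonneg _) (mul_pos (hpos u hu) h0) h2
  calc _ ≤ (D₀ / |s.im|) ^ 2 := by gcongr
    _ = D₀ ^ 2 / s.im ^ 2 := by rw [div_pow, sq_abs]
    _ ≤ _ := by
      have h6 : 1 ≤ s.im ^ 2 := by rw [← sq_abs]; nlinarith
      rw [← div_eq_mul_inv, div_le_div_iff₀ (by positivity) (by positivity)]
      nlinarith [sq_nonneg D₀]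

lemma isBigO_one_sub_sum {G : ℂ → ℂ} {r : ℝ → ℂ} {T : ℝ} {S : Finset ℝ}
    (hS : ∀ u, u ∈ S ↔ r u ≠ 0 ∧ |u| ≤ T)
    (hpole : ∀ u : ℝ, (fun s => G s - r u / (s - u * Complex.I))
      =O[𝓝[{s : ℂ | 0 < s.re}] (u * Complex.I)] fun _ => (1:ℝ)) (u : ℝ) (hu : |u| ≤ T) :
    (fun s => G s - ∑ v ∈ S, r v / (s - v * Complex.I))
      =O[𝓝[{s : ℂ | 0 < s.re}] (u * Complex.I)] fun _ => (1:ℝ) := by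
  have h1 : ∀ s : ℂ, ∑ v ∈ S, r v / (s - v * Complex.I) =
      r u / (s - u * Complex.I) + ∑ v ∈ S.erase u, r v / (s - v * Complex.I) := by
    intro s
    by_cases h : u ∈ S
    · exact (Finset.add_sum_erase S (fun v => r v / (s - (v:ℂ) * Complex.I)) h).symm
    · have : r u = 0 := by
        by_contra h'
        exact h ((hS u).2 ⟨h', hu⟩)
      rw [Finset.erase_eq_of_notMem h, this]; simp
  have h2 : (fun s : ℂ => ∑ v ∈ S.erase u, r v / (s - v * Complex.I))
      =O[𝓝[{s : ℂ | 0 < s.re}] (u * Complex.I)] fun _ => (1:ℝ) := by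
    have hc : ContinuousAt (fun s : ℂ => ∑ v ∈ S.erase u, r v / (s - v * Complex.I))
        (u * Complex.I) := by
      refine tendsto_finsetSum _ fun v hv => ?_
      refine ContinuousAt.div (by fun_prop) (by fun_prop) ?_
      rw [← sub_mul]
      refine mul_ne_zero ?_ Complex.I_ne_zero
      rw [sub_ne_zero]
      exact_mod_cast (Finset.ne_of_mem_erase hv).symm
    exact (hc.tendsto.mono_left nhdsWithin_le_nhds).isBigO_one ℝ
  refine ((hpole u).sub h2).congr_left fun s => ?_
  rw [h1]; ring

lemma lintegral_enorm_sub_sq_le {G R : ℂ → ℂ} {σ T B D E : ℝ} (hD : 0 ≤ D) (hE : 0 ≤ E) (hT : 0 ≤ T)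
    (hG : Measurable fun t : ℝ => G (σ + t * Complex.I))
    (hB : ∀ t : ℝ, |t| ≤ T → ‖G (σ + t * Complex.I) - R (σ + t * Complex.I)‖ ≤ B)
    (hR : ∀ s : ℂ, T < |s.im| → ‖R s‖ ^ 2 ≤ D * (1 + s.im ^ 2)⁻¹)
    (hGE : ∫⁻ t : ℝ in {t : ℝ | T < |t|}, ‖G (σ + t * Complex.I)‖ₑ ^ 2 ≤ ENNReal.ofReal E) :
    ∫⁻ t : ℝ, ‖G (σ + t * Complex.I) - R (σ + t * Complex.I)‖ₑ ^ 2 ≤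
      ENNReal.ofReal (2 * E + 2 * D * Real.pi + 2 * T * B ^ 2) := by
  have hm : MeasurableSet {t : ℝ | T < |t|} := measurableSet_lt measurable_const (by fun_prop)
  rw [← lintegral_add_compl _ hm]
  have hB0 : 0 ≤ B := (norm_nonneg _).trans (hB 0 (by simpa))
  have hc : ({t : ℝ | T < |t|}ᶜ : Set ℝ) = Set.Icc (-T) T := by
    ext t; simp [abs_le]
  have h2 : ∫⁻ t : ℝ in {t : ℝ | T < |t|}ᶜ, ‖G (σ + t * Complex.I) - R (σ + t * Complex.I)‖ₑ ^ 2 ≤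
      ENNReal.ofReal (2 * T * B ^ 2) := by
    rw [hc]
    calc _ ≤ ∫⁻ t : ℝ in Set.Icc (-T) T, ENNReal.ofReal (B ^ 2) := by
          refine setLIntegral_mono measurable_const fun t ht => ?_
          rw [← ofReal_norm, ← ENNReal.ofReal_pow (norm_nonneg _)]
          exact ENNReal.ofReal_le_ofReal (pow_le_pow_left₀ (norm_nonneg _) (hB t (abs_le.2 ht)) 2)
      _ = _ := by
          rw [setLIntegral_const, Real.volume_Icc, ← ENNReal.ofReal_mul (by positivity)]
          congr 1; ring
  have h1 : ∫⁻ t : ℝ in {t : ℝ | T < |t|}, ‖G (σ + t * Complex.I) - R (σ + t * Complex.I)‖ₑ ^ 2 ≤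
      ENNReal.ofReal (2 * E + 2 * D * Real.pi) := by
    calc _ ≤ ∫⁻ t : ℝ in {t : ℝ | T < |t|}, (2 * ‖G (σ + t * Complex.I)‖ₑ ^ 2 +
          ENNReal.ofReal (2 * D * (1 + t ^ 2)⁻¹)) := by
          refine setLIntegral_mono (((hG.enorm.pow_const 2).const_mul 2).add (by fun_prop)) fun t ht => ?_
          have h3 := hR (σ + t * Complex.I) (by simpa using ht)
          simp only [Complex.add_im, Complex.ofReal_im, Complex.mul_im, Complex.ofReal_re,
            Complex.I_im, mul_one, Complex.I_re, mul_zero, add_zero, zero_add] at h3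
          rw [← ofReal_norm, ← ofReal_norm, ← ENNReal.ofReal_pow (norm_nonneg _),
            ← ENNReal.ofReal_pow (norm_nonneg _),
            show (2 : ENNReal) = ENNReal.ofReal 2 by simp, ← ENNReal.ofReal_mul (by norm_num),
            ← ENNReal.ofReal_add (by positivity) (by positivity)]
          apply ENNReal.ofReal_le_ofReal
          have h4 := norm_sub_le (G (σ + t * Complex.I)) (R (σ + t * Complex.I))
          have h5 := pow_le_pow_left₀ (norm_nonneg _) h4 2
          nlinarith [sq_nonneg (‖G (σ + t * Complex.I)‖ - ‖R (σ + t * Complex.I)‖)]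
      _ ≤ 2 * ENNReal.ofReal E + ∫⁻ t : ℝ, ENNReal.ofReal (2 * D * (1 + t ^ 2)⁻¹) := by
          rw [lintegral_add_right _ (by fun_prop), lintegral_const_mul _ (hG.enorm.pow_const 2)]
          gcongr
          exact Measure.restrict_le_self
      _ = _ := by
          rw [← ofReal_integral_eq_lintegral_ofReal (integrable_inv_one_add_sq.const_mul _)
            (Eventually.of_forall fun t => by positivity), integral_const_mul,
            integral_univ_inv_one_add_sq, show (2 : ENNReal) = ENNReal.ofReal 2 by simp,
            ← ENNReal.ofReal_mul (by norm_num), ← ENNReal.ofReal_add (by positivity) (by positivity)]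
  refine (add_le_add h1 h2).trans ?_
  rw [← ENNReal.ofReal_add (by positivity) (by positivity)]

lemma exists_norm_le_of_tail {ι : Type*} {b γ : ι → ℝ} (hb : ∀ i, 0 ≤ b i) (hs : Summable b)
    {C K : ℝ} (hC : 0 ≤ C) {G : ℂ → ℂ}
    (hd : ∀ s : ℂ, 0 < s.re → s.re ≤ K → DifferentiableAt ℂ G s)
    (hG : ∀ s : ℂ, 0 < s.re → s.re ≤ K → 1 ≤ |s.im| → ‖G s‖ ^ 2 ≤
      C * (1 + |s.im|) ^ (-(9 / 5) : ℝ) + C * (1 + |s.im|) ^ (-(1 / 5) : ℝ) *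
        ∑' i, b i / ‖s - γ i * Complex.I‖ ^ 2) {σ : ℝ} (hσ : 0 < σ) :
    ∃ A, 0 ≤ A ∧ ∀ s : ℂ, σ ≤ s.re → s.re ≤ K → ‖G s‖ ≤ A := by
  have hcomp : IsCompact (Set.Icc σ K ×ℂ Set.Icc (-1) 1) := isCompact_Icc.reProdIm isCompact_Icc
  obtain ⟨A₁, hA₁⟩ := hcomp.exists_bound_of_continuousOn (f := G) fun s hs =>
    (hd s (hσ.trans_le hs.1.1) hs.1.2).continuousAt.continuousWithinAt
  set A₂ : ℝ := C + C * ((∑' i, b i) / σ ^ 2) with hA₂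
  have hA₂0 : 0 ≤ A₂ := by
    have : 0 ≤ ∑' i, b i := tsum_nonneg hb
    positivity
  refine ⟨max |A₁| (1 + A₂), le_max_of_le_left (abs_nonneg _), fun s h1 h2 => ?_⟩
  by_cases h : |s.im| ≤ 1
  · exact le_max_of_le_left ((hA₁ s ⟨⟨h1, h2⟩, abs_le.1 h⟩).trans (le_abs_self _))
  · apply le_max_of_le_right
    have h0 : 0 < s.re := hσ.trans_le h1
    have h3 := hG s h0 h2 (not_le.1 h).le
    have h4 : ∀ i, b i / ‖s - γ i * Complex.I‖ ^ 2 ≤ b i / σ ^ 2 := fun i => by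
      have h5 : σ ≤ ‖s - γ i * Complex.I‖ := by
        have := Complex.re_le_norm (s - γ i * Complex.I)
        simp at this
        linarith
      have := hb i
      gcongr
    have h6 : ∑' i, b i / ‖s - γ i * Complex.I‖ ^ 2 ≤ (∑' i, b i) / σ ^ 2 := by
      rw [← tsum_div_const]
      exact (Summable.of_nonneg_of_le (fun i => by have := hb i; positivity) h4
        (hs.div_const _)).tsum_le_tsum h4 (hs.div_const _)
    have h7 : ∀ p : ℝ, p ≤ 0 → (1 + |s.im|) ^ p ≤ 1 := fun p hp =>
      Real.rpow_le_one_of_one_le_of_nonpos (by linarith [abs_nonneg s.im]) hp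
    have h8 : ‖G s‖ ^ 2 ≤ A₂ := by
      refine h3.trans ?_
      have h9 : 0 ≤ ∑' i, b i / ‖s - γ i * Complex.I‖ ^ 2 :=
        tsum_nonneg fun i => by have := hb i; positivity
      refine add_le_add (mul_le_of_le_one_right hC (h7 _ (by norm_num))) ?_
      exact mul_le_mul (mul_le_of_le_one_right hC (h7 _ (by norm_num))) h6 h9 hC
    nlinarith [norm_nonneg (G s)]

lemma lintegral_comp_two_pi_mul_le {f : ℝ → ENNReal} (hf : Measurable f) :
    ∫⁻ w : ℝ, f (2 * Real.pi * w) ≤ ∫⁻ t : ℝ, f t := by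
  have h2 : (2 * Real.pi) ≠ 0 := by positivity
  have h1 : ∫⁻ w : ℝ, f (2 * Real.pi * w) =
      ∫⁻ t, f t ∂(Measure.map (fun w => 2 * Real.pi * w) volume) :=
    (lintegral_map hf (by fun_prop)).symm
  rw [h1, Real.map_volume_mul_left h2, lintegral_smul_measure]
  refine mul_le_of_le_one_left' ?_
  rw [ENNReal.ofReal_le_one, abs_of_pos (by positivity)]
  apply inv_le_one_of_one_le₀
  linarith [Real.pi_gt_three]

/-- The part on `(0, ∞)` of the difference between `φ` and a trigonometric polynomial. -/
noncomputable def cutDiff (φ : ℝ → ℝ) (P : BoundedContinuousFunction ℝ ℂ) : ℝ → ℂ :=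
  (Set.Ioi 0).indicator fun y => (φ y : ℂ) - P y

lemma measurable_cutDiff {φ : ℝ → ℝ} (hm : Measurable φ) (P : BoundedContinuousFunction ℝ ℂ) :
    Measurable (cutDiff φ P) :=
  Measurable.indicator ((Complex.measurable_ofReal.comp hm).sub P.continuous.measurable)
    measurableSet_Ioi

lemma ae_continuousAt_cutDiff {φ : ℝ → ℝ} (hcont : ∀ᵐ y : ℝ, 0 < y → ContinuousAt φ y)
    (P : BoundedContinuousFunction ℝ ℂ) : ∀ᵐ y, ContinuousAt (cutDiff φ P) y := by
  filter_upwards [hcont, Measure.ae_ne volume (0:ℝ)] with y hy hy0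
  rcases lt_or_gt_of_ne hy0 with h | h
  · refine (continuousAt_const (y := (0:ℂ))).congr ?_
    filter_upwards [Iio_mem_nhds h] with z hz
    exact (Set.indicator_of_notMem (by simpa using (Set.mem_Iio.1 hz).le) _).symm
  · refine ((Complex.continuous_ofReal.continuousAt.comp (hy h)).sub
      P.continuous.continuousAt).congr ?_
    filter_upwards [Ioi_mem_nhds h] with z hz
    exact (Set.indicator_of_mem hz _).symm

lemma cutDiff_mul (φ : ℝ → ℝ) (P : BoundedContinuousFunction ℝ ℂ) (g : ℝ → ℂ) :
    (fun y => cutDiff φ P y * g y) =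
      (Set.Ioi 0).indicator fun y => (φ y : ℂ) * g y - P y * g y := by
  ext y
  by_cases h : y ∈ Set.Ioi (0:ℝ)
  · simp only [cutDiff, Set.indicator_of_mem h]; ring
  · simp only [cutDiff, Set.indicator_of_notMem h, zero_mul]

lemma sum_smul_expChar_mul (S : Finset ℝ) (r : ℝ → ℂ) (y : ℝ) (z : ℂ) :
    (∑ u ∈ S, r u • expChar u) y * z = ∑ u ∈ S, r u * (expChar u y * z) := by
  rw [BoundedContinuousFunction.coe_sum, Finset.sum_apply, Finset.sum_mul]
  refine Finset.sum_congr rfl fun u _ => ?_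
  simp only [BoundedContinuousFunction.coe_smul, smul_eq_mul]; ring

lemma integrableOn_sum_smul_expChar_mul (S : Finset ℝ) (r : ℝ → ℂ) {s : ℂ} (hs : 0 < s.re) :
    IntegrableOn (fun y : ℝ => (∑ u ∈ S, r u • expChar u) y * Complex.exp (-s * y))
      (Set.Ioi 0) := by
  simp only [sum_smul_expChar_mul]
  exact integrable_finsetSum _ fun u _ => (integrableOn_expChar_mul u hs).const_mul _

lemma integral_sum_smul_expChar_mul (S : Finset ℝ) (r : ℝ → ℂ) {s : ℂ} (hs : 0 < s.re) :
    ∫ y in Set.Ioi (0:ℝ), (∑ u ∈ S, r u • expChar u) y * Complex.exp (-s * y) =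
      ∑ u ∈ S, r u / (s - u * Complex.I) := by
  simp only [sum_smul_expChar_mul]
  rw [integral_finsetSum _ fun u _ => (integrableOn_expChar_mul u hs).const_mul _]
  refine Finset.sum_congr rfl fun u _ => ?_
  rw [integral_const_mul, integral_expChar_mul u hs, mul_one_div]

lemma exists_gt_forall_support_abs_ne {r : ℝ → ℂ}
    (hr : ∀ T : ℝ, {u | r u ≠ 0 ∧ |u| ≤ T}.Finite) (T₀ : ℝ) :
    ∃ T, T₀ < T ∧ ∀ u, r u ≠ 0 → |u| ≠ T := by
  have hc : {u | r u ≠ 0}.Countable := by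
    have : {u | r u ≠ 0} ⊆ ⋃ n : ℕ, {u | r u ≠ 0 ∧ |u| ≤ n} := fun u hu => by
      obtain ⟨n, hn⟩ := exists_nat_ge |u|
      exact Set.mem_iUnion.2 ⟨n, hu, hn⟩
    exact (Set.countable_iUnion fun n : ℕ => (hr n).countable).mono this
  have hc2 : ((fun u : ℝ => |u|) '' {u | r u ≠ 0}).Countable := hc.image _
  obtain ⟨T, hT, hT1, -⟩ := (hc2.dense_compl ℝ).exists_between (lt_add_one T₀)
  exact ⟨T, hT1, fun u hu h => hT ⟨u, hu, h⟩⟩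

/-- A function whose Laplace transform has only simple poles on the imaginary axis, with square
mean control of the transform at large height, has a limiting distribution. -/
theorem hasLimitingDist_of_laplace {ι : Type*} [Countable ι] {φ : ℝ → ℝ} {G : ℂ → ℂ}
    {r : ℝ → ℂ} {b γ : ι → ℝ} {C K : ℝ} (hm : Measurable φ)
    (hφ : ∀ Y, ∃ B, ∀ y ∈ Set.Icc 0 Y, |φ y| ≤ B)
    (hcont : ∀ᵐ y : ℝ, 0 < y → ContinuousAt φ y) (hK : 0 < K)
    (hint : IntegrableOn (fun y : ℝ => (φ y : ℂ) * Complex.exp (-(K : ℂ) * y)) (Set.Ioi 0))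
    (hL : ∀ t : ℝ, G (K + t * Complex.I) =
      ∫ y in Set.Ioi (0:ℝ), (φ y : ℂ) * Complex.exp (-(K + t * Complex.I) * y))
    (hd : ∀ s : ℂ, 0 < s.re → s.re ≤ K → DifferentiableAt ℂ G s)
    (hr : ∀ T : ℝ, {u | r u ≠ 0 ∧ |u| ≤ T}.Finite)
    (hpole : ∀ u : ℝ, (fun s => G s - r u / (s - u * Complex.I))
      =O[𝓝[{s : ℂ | 0 < s.re}] (u * Complex.I)] fun _ => (1:ℝ))
    (hb : ∀ i, 0 ≤ b i) (hs : Summable b) (hC : 0 ≤ C)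
    (hG : ∀ s : ℂ, 0 < s.re → s.re ≤ K → 1 ≤ |s.im| → ‖G s‖ ^ 2 ≤
      C * (1 + |s.im|) ^ (-(9 / 5) : ℝ) + C * (1 + |s.im|) ^ (-(1 / 5) : ℝ) *
        ∑' i, b i / ‖s - γ i * Complex.I‖ ^ 2) : HasLimitingDist φ := by
  refine hasLimitingDist_of_approx hm hφ fun ε hε => ?_
  set η : ℝ := ε ^ 2 / (4 * Real.exp 2) with hη
  have hη0 : 0 < η := by positivity
  obtain ⟨T₀, hT₀, htail⟩ := exists_forall_lintegral_tail_le hb hs hC hG (ε := η / 4) (by positivity)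
  obtain ⟨T, hT, hTr⟩ := exists_gt_forall_support_abs_ne hr T₀
  set S : Finset ℝ := (hr T).toFinset with hS
  have hmem : ∀ u, u ∈ S ↔ r u ≠ 0 ∧ |u| ≤ T := fun u => by simp [hS]
  set R : ℂ → ℂ := fun s => ∑ u ∈ S, r u / (s - u * Complex.I) with hR
  set P : BoundedContinuousFunction ℝ ℂ := ∑ u ∈ S, r u • expChar u with hP
  refine ⟨P, sum_smul_expChar_mem S r, star_sum_smul_expChar_mem S r, ?_⟩
  obtain ⟨D, hD, hRD⟩ := exists_norm_sum_div_le (S := S) (r := r) (T := T) (by linarith)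
    fun u hu => lt_of_le_of_ne ((hmem u).1 hu).2 (hTr u ((hmem u).1 hu).1)
  obtain ⟨B, δ, hB, hδ, hFB⟩ := exists_forall_norm_le_of_isBigO (F := fun s => G s - R s) (T := T)
    (isBigO_one_sub_sum hmem hpole)
  have hRd : ∀ s : ℂ, 0 < s.re → DifferentiableAt ℂ R s := fun s hs => by
    refine DifferentiableAt.fun_sum fun u _ => ?_
    exact (differentiableAt_const _).div (by fun_prop) (sub_ne_zero_of_re_pos u hs)
  filter_upwards [eventually_gt_atTop (0:ℝ), eventually_gt_atTop (1 / K),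
    eventually_gt_atTop (1 / δ),
    eventually_ge_atTop ((2 * D * Real.pi + 2 * T * B ^ 2) / (η / 2))] with Y hY hYK hYδ hYη
  have hσ : 0 < 1 / Y := by positivity
  have hσK : 1 / Y ≤ K := by rw [div_le_iff₀ hY]; rw [div_lt_iff₀ hK] at hYK; linarith
  have hσδ : 1 / Y < δ := by rw [div_lt_iff₀ hY]; rw [div_lt_iff₀ hδ] at hYδ; linarith
  obtain ⟨A, hA, hGA⟩ := exists_norm_le_of_tail hb hs hC hd hG hσ
  have hcs : ∀ F : ℂ → ℂ, (∀ s : ℂ, 0 < s.re → s.re ≤ K → DifferentiableAt ℂ F s) →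
      Continuous fun t : ℝ => F ((1 / Y : ℝ) + t * Complex.I) := fun F hF => by
    refine continuous_iff_continuousAt.2 fun t => ?_
    exact ContinuousAt.comp (f := fun t : ℝ => ((1 / Y : ℝ) + t * Complex.I : ℂ))
      (hF _ (by simpa using hY) (by simpa using hσK)).continuousAt (by fun_prop)
  have hint2 : ∀ t : ℝ, IntegrableOn
      (fun y : ℝ => (φ y : ℂ) * Complex.exp (-(K + t * Complex.I) * y)) (Set.Ioi 0) := by
    intro t
    refine Integrable.mono hint ?_ (Eventually.of_forall fun y => le_of_eq ?_)
    · exact ((Complex.measurable_ofReal.comp hm).mul (by fun_prop)).aestronglyMeasurable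
    · simp [Complex.norm_exp]
  have hX : ∫⁻ y : ℝ, ‖cutDiff φ P y * Complex.exp (-((1 / Y : ℝ) : ℂ) * y)‖ₑ ^ 2 ≤
      ENNReal.ofReal (η * Y) := by
    refine (lintegral_laplace_le (G := fun s => G s - R s)
      (A := A + ∑ u ∈ S, ‖r u‖ / (1 / Y)) hσK ?_ (ae_continuousAt_cutDiff hcont P) ?_ ?_ ?_).trans ?_
    · rw [cutDiff_mul, integrable_indicator_iff measurableSet_Ioi]
      exact Integrable.sub hint (integrableOn_sum_smul_expChar_mul S r (by simpa))
    · intro s h1 h2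
      exact (hd s (hσ.trans_le h1) h2).sub (hRd s (hσ.trans_le h1))
    · intro t
      have hK' : 0 < (K + t * Complex.I : ℂ).re := by simpa
      rw [cutDiff_mul φ P fun y : ℝ => Complex.exp (-(K + t * Complex.I) * y),
        integral_indicator measurableSet_Ioi, integral_sub (hint2 t)
          (integrableOn_sum_smul_expChar_mul S r hK'), integral_sum_smul_expChar_mul S r hK', hL]
    · intro s h1 h2
      have h3 : ‖R s‖ ≤ ∑ u ∈ S, ‖r u‖ / (1 / Y) := by
        refine (norm_sum_le _ _).trans (Finset.sum_le_sum fun u _ => ?_)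
        rw [norm_div]
        have h5 : 1 / Y ≤ ‖s - u * Complex.I‖ := by
          have := Complex.re_le_norm (s - u * Complex.I)
          simp only [Complex.sub_re, Complex.mul_re, Complex.ofReal_re, Complex.I_re, mul_zero,
            Complex.ofReal_im, Complex.I_im, zero_mul, sub_zero] at this
          linarith
        gcongr
      have h4 : (0:ℝ) ≤ A + ∑ u ∈ S, ‖r u‖ / (1 / Y) :=
        add_nonneg hA (Finset.sum_nonneg fun u _ => by positivity)
      calc _ ≤ ‖G s‖ + ‖R s‖ := norm_sub_le _ _
        _ ≤ A + ∑ u ∈ S, ‖r u‖ / (1 / Y) := add_le_add (hGA s h1 h2) h3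
        _ ≤ _ := le_mul_of_one_le_right h4 (Real.one_le_exp (abs_nonneg _))
    · have hGc := hcs G hd
      have hRc := hcs R fun s h _ => hRd s h
      refine (lintegral_comp_two_pi_mul_le
        (f := fun t : ℝ => ‖G ((1 / Y : ℝ) + t * Complex.I) - R ((1 / Y : ℝ) + t * Complex.I)‖ₑ ^ 2)
        ((hGc.sub hRc).measurable.enorm.pow_const 2)).trans ?_
      refine (lintegral_enorm_sub_sq_le (E := η / 4 / (1 / Y)) hD (by positivity) (by linarith)
        hGc.measurable (hFB _ hσ hσδ) hRD (htail T hT.le _ hσ hσK)).trans ?_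
      apply ENNReal.ofReal_le_ofReal
      rw [div_le_iff₀ (by positivity)] at hYη
      have : η / 4 / (1 / Y) = η / 4 * Y := by field_simp
      rw [this]
      linarith
  have hfin := intervalIntegral_norm_le_of_lintegral (measurable_cutDiff hm P) (δ := ε / 2) hY hη0.le
    (by positivity) hX
  have he : ε / 2 + Real.exp 2 * η / (ε / 2) = ε := by
    rw [hη]; field_simp; ring
  rw [he] at hfin
  refine le_trans (le_of_eq ?_) hfin
  rw [intervalIntegral.integral_of_le hY.le, intervalIntegral.integral_of_le hY.le]
  refine setIntegral_congr_fun measurableSet_Ioc fun y hy => ?_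
  simp only [cutDiff, Set.indicator_of_mem (Set.mem_Ioi.2 hy.1)]

lemma liouville_mul {m n : ℕ} (hm : m ≠ 0) (hn : n ≠ 0) :
    liouville (m * n) = liouville m * liouville n := by
  simp only [liouville, ArithmeticFunction.cardFactors_mul hm hn, pow_add]

lemma abs_liouville (n : ℕ) : |liouville n| = 1 := by simp [liouville]

/-- The completely multiplicative function `n ↦ λ(n) n^{-s}`. -/
noncomputable def liouvilleHom {s : ℂ} (hs : s ≠ 0) : ℕ →*₀ ℂ where
  toFun n := liouville n * (n : ℂ) ^ (-s)
  map_zero' := by simp [hs]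
  map_one' := by simp [liouville]
  map_mul' m n := by
    rcases eq_or_ne m 0 with rfl | hm
    · simp [hs]
    rcases eq_or_ne n 0 with rfl | hn
    · simp [hs]
    rw [liouville_mul hm hn, Nat.cast_mul, Complex.natCast_mul_natCast_cpow]
    push_cast; ring

lemma norm_liouville_mul_cpow {s : ℂ} (hs : 0 < s.re) (n : ℕ) :
    ‖(liouville n : ℂ) * (n : ℂ) ^ (-s)‖ = (n : ℝ) ^ (-s.re) := by
  rw [norm_mul, Complex.norm_real, Real.norm_eq_abs, abs_liouville, one_mul]
  rcases eq_or_ne n 0 with rfl | hn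
  · have : s ≠ 0 := by rintro rfl; simp at hs
    simp [this, hs.ne']
  · rw [Complex.norm_natCast_cpow_of_pos (Nat.pos_of_ne_zero hn), Complex.neg_re]

lemma tsum_liouville_mul_cpow {s : ℂ} (hs : 1 < s.re) :
    ∑' n : ℕ, (liouville n : ℂ) * (n : ℂ) ^ (-s) = riemannZeta (2 * s) / riemannZeta s := by
  have hs0 : s ≠ 0 := by rintro rfl; simp at hs; linarith
  have hsum : Summable fun n => ‖liouvilleHom hs0 n‖ := by
    refine (Real.summable_nat_rpow.2 (by linarith : -s.re < -1)).congr fun n => ?_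
    exact (norm_liouville_mul_cpow (by linarith) n).symm
  have h1 := EulerProduct.eulerProduct_completely_multiplicative_hasProd hsum
  have h2 := riemannZeta_eulerProduct_hasProd hs
  have h3 := riemannZeta_eulerProduct_hasProd (s := 2 * s) (by simp; linarith)
  have h4 := (h1.mul h2).unique (h3.congr_fun fun p => ?_)
  · rw [eq_div_iff (riemannZeta_ne_zero_of_one_lt_re hs)]
    exact h4
  · have h5 : liouvilleHom hs0 (p : ℕ) = -((p : ℕ) : ℂ) ^ (-s) := by
      simp [liouvilleHom, liouville, ArithmeticFunction.cardFactors_apply_prime p.2]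
    have h6 : ((p : ℕ) : ℂ) ^ (-(2 * s)) = ((p : ℕ) : ℂ) ^ (-s) * ((p : ℕ) : ℂ) ^ (-s) := by
      rw [← Complex.cpow_add _ _ (by exact_mod_cast p.2.ne_zero)]
      congr 1; ring
    rw [h5, h6, ← mul_inv]
    congr 1; ring

lemma exists_abs_Lweight_le : ∃ Z, 0 ≤ Z ∧ ∀ α x : ℝ, α ≤ 1 → 0 < x →
    |Lweight α x| ≤ Z * x ^ (11 / 10 - α) := by
  have hs : Summable fun n : ℕ => (n : ℝ) ^ (-(11 / 10) : ℝ) :=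
    Real.summable_nat_rpow.2 (by norm_num)
  refine ⟨∑' n : ℕ, (n : ℝ) ^ (-(11 / 10) : ℝ), tsum_nonneg fun n => by positivity,
    fun α x hα hx => ?_⟩
  rw [Lweight, ← tsum_mul_right]
  refine (Finset.abs_sum_le_sum_abs _ _).trans ?_
  refine le_trans (Finset.sum_le_sum fun n hn => ?_)
    ((hs.mul_right _).sum_le_tsum (Finset.Icc 1 ⌊x⌋₊) fun n _ => by positivity)
  rw [Finset.mem_Icc] at hn
  have hn0 : (0:ℝ) < n := by exact_mod_cast hn.1
  have hnx : (n:ℝ) ≤ x := (Nat.le_floor_iff hx.le).1 hn.2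
  rw [abs_div, abs_liouville, abs_of_pos (by positivity), one_div, ← Real.rpow_neg hn0.le]
  calc (n:ℝ) ^ (-α) = (n:ℝ) ^ (-(11 / 10) : ℝ) * (n:ℝ) ^ (11 / 10 - α) := by
        rw [← Real.rpow_add hn0]; congr 1; ring
    _ ≤ _ := by gcongr; linarith

/-- The coefficients `λ(n)/n^α`, set to zero at `n = 0`. -/
noncomputable def liouvilleCoeff (α : ℝ) (n : ℕ) : ℝ :=
  if n = 0 then 0 else liouville n / (n : ℝ) ^ α

lemma hasSum_Lweight (α y : ℝ) (g : ℂ) :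
    HasSum (fun n : ℕ => (Set.Ici (Real.log n)).indicator (fun _ => (liouvilleCoeff α n : ℂ) * g) y)
      (Lweight α (Real.exp y) * g) := by
  have h : (Lweight α (Real.exp y) * g : ℂ) = ∑ n ∈ Finset.Icc 1 ⌊Real.exp y⌋₊,
      (Set.Ici (Real.log n)).indicator (fun _ => (liouvilleCoeff α n : ℂ) * g) y := by
    rw [Lweight, Complex.ofReal_sum, Finset.sum_mul]
    refine Finset.sum_congr rfl fun n hn => ?_
    rw [Finset.mem_Icc] at hn
    have hn0 : (0:ℝ) < n := by exact_mod_cast hn.1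
    rw [Set.indicator_of_mem, liouvilleCoeff, if_neg (by omega)]
    rw [Set.mem_Ici, Real.log_le_iff_le_exp hn0]
    exact (Nat.le_floor_iff (Real.exp_pos y).le).1 hn.2
  rw [h]
  refine hasSum_sum_of_ne_finset_zero fun n hn => ?_
  rcases Nat.eq_zero_or_pos n with rfl | hn0
  · simp [liouvilleCoeff]
  · refine Set.indicator_of_notMem (fun hy => hn ?_) _
    rw [Finset.mem_Icc]
    refine ⟨hn0, (Nat.le_floor_iff (Real.exp_pos y).le).2 ?_⟩
    rwa [← Real.log_le_iff_le_exp (by exact_mod_cast hn0)]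

lemma setIntegral_indicator_Ici {E : Type*} [NormedAddCommGroup E] [NormedSpace ℝ E] {a : ℝ}
    (ha : 0 ≤ a) (f : ℝ → E) :
    ∫ y in Set.Ioi (0:ℝ), (Set.Ici a).indicator f y = ∫ y in Set.Ioi a, f y := by
  rw [setIntegral_indicator measurableSet_Ici]
  refine setIntegral_congr_set ?_
  have h : (Set.Ioi 0 ∩ Set.Ici a : Set ℝ) =ᵐ[volume] (Set.Ioi 0 ∩ Set.Ioi a : Set ℝ) :=
    (ae_eq_refl _).inter Ioi_ae_eq_Ici.symm
  rwa [Set.Ioi_inter_Ioi, max_eq_right ha] at h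

/-- The Laplace transform of `e^{y(α-1/2)} L_α(e^y)`. -/
lemma integral_Lweight_mul_exp {α : ℝ} (hα : α ≤ 1) {s : ℂ} (hs : 1 / 2 < s.re) :
    ∫ y in Set.Ioi (0:ℝ), (Lweight α (Real.exp y) : ℂ) *
        Complex.exp ((((α - 1 / 2 : ℝ) : ℂ) - s) * y) =
      riemannZeta (1 + 2 * s) / riemannZeta (1 / 2 + s) / (s - ((α - 1 / 2 : ℝ) : ℂ)) := by
  set z : ℂ := ((α - 1 / 2 : ℝ) : ℂ) - s with hz
  have hzre : z.re = α - 1 / 2 - s.re := by rw [hz, Complex.sub_re, Complex.ofReal_re]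
  have hz0 : z.re < 0 := by rw [hzre]; linarith
  have hzne : z ≠ 0 := by rintro h; rw [h] at hz0; simp at hz0
  set F : ℕ → ℝ → ℂ := fun n y =>
    (Set.Ici (Real.log n)).indicator (fun y => (liouvilleCoeff α n : ℂ) * Complex.exp (z * y)) y
    with hF
  have hFint : ∀ n, Integrable (F n) (volume.restrict (Set.Ioi 0)) := fun n =>
    Integrable.indicator (((integrableOn_exp_mul_complex_Ioi hz0 0).const_mul _)) measurableSet_Ici
  have hFI : ∀ n, ∫ y in Set.Ioi (0:ℝ), F n y =
      (liouville n : ℂ) * (n:ℂ) ^ (-(1 / 2 + s)) * (-1 / z) := by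
    intro n
    rw [setIntegral_indicator_Ici (Real.log_natCast_nonneg n), integral_const_mul,
      integral_exp_mul_complex_Ioi hz0]
    rcases Nat.eq_zero_or_pos n with rfl | hn
    · have : (1 / 2 + s) ≠ 0 := by
        intro h
        have := congrArg Complex.re h
        simp at this; linarith
      have h0 : ((0:ℕ) : ℂ) ^ (-(1 / 2 + s)) = 0 := by
        rw [Nat.cast_zero, Complex.zero_cpow (neg_ne_zero.2 this)]
      rw [h0]
      simp [liouvilleCoeff]
    · have hn0 : (n:ℂ) ≠ 0 := by exact_mod_cast hn.ne'
      have h1 : Complex.exp (z * (Real.log n : ℝ)) = (n:ℂ) ^ z := by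
        rw [Complex.cpow_def_of_ne_zero hn0, mul_comm, Complex.ofReal_log (by positivity)]; simp
      have h2 : ((liouvilleCoeff α n : ℝ) : ℂ) = liouville n * (n:ℂ) ^ (-(α:ℂ)) := by
        rw [liouvilleCoeff, if_neg hn.ne', Complex.ofReal_div, Complex.ofReal_cpow (by positivity),
          Complex.cpow_neg, div_eq_mul_inv]; simp
      have h3 : (n:ℂ) ^ (-(1 / 2 + s)) = (n:ℂ) ^ (-(α:ℂ)) * (n:ℂ) ^ z := by
        rw [← Complex.cpow_add _ _ hn0]; congr 1; rw [hz]; push_cast; ring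
      rw [h1, h2, h3]; ring
  have hnorm : ∀ n, ∫ y in Set.Ioi (0:ℝ), ‖F n y‖ = (n:ℝ) ^ (-(1 / 2 + s.re)) * (-1 / z.re) := by
    intro n
    have h0 : ∀ y, ‖F n y‖ = (Set.Ici (Real.log n)).indicator
        (fun y => |liouvilleCoeff α n| * Real.exp (z.re * y)) y := fun y => by
      rw [hF, norm_indicator_eq_indicator_norm]
      congr 1; ext y
      rw [norm_mul, Complex.norm_real, Complex.norm_exp]
      simp
    simp only [h0]
    rw [setIntegral_indicator_Ici (Real.log_natCast_nonneg n), integral_const_mul,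
      integral_exp_mul_Ioi hz0]
    rcases Nat.eq_zero_or_pos n with rfl | hn
    · rw [Nat.cast_zero, Real.zero_rpow (by linarith)]
      simp [liouvilleCoeff]
    · have hn0 : (0:ℝ) < n := by exact_mod_cast hn
      have h1 : Real.exp (z.re * Real.log n) = (n:ℝ) ^ z.re := by
        rw [Real.rpow_def_of_pos hn0, mul_comm]
      have h2 : |liouvilleCoeff α n| = (n:ℝ) ^ (-α) := by
        rw [liouvilleCoeff, if_neg hn.ne', abs_div, abs_liouville, abs_of_pos (by positivity),
          Real.rpow_neg hn0.le, one_div]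
      have h3 : (n:ℝ) ^ (-(1 / 2 + s.re)) = (n:ℝ) ^ (-α) * (n:ℝ) ^ z.re := by
        rw [← Real.rpow_add hn0]; congr 1; rw [hzre]; ring
      rw [h1, h2, h3]; ring
  have hsum := hasSum_integral_of_summable_integral_norm hFint (by
    simp only [hnorm]
    exact (Real.summable_nat_rpow.2 (by linarith)).mul_right _)
  have h1 : ∀ y : ℝ, ∑' n, F n y = (Lweight α (Real.exp y) : ℂ) * Complex.exp (z * y) := fun y =>
    (hasSum_Lweight α y (Complex.exp (z * y))).tsum_eq
  simp only [h1] at hsum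
  rw [← hsum.tsum_eq]
  simp only [hFI]
  rw [tsum_mul_right, tsum_liouville_mul_cpow (by simp; linarith),
    show (2 * (1 / 2 + s) : ℂ) = 1 + 2 * s by ring,
    show s - ((α - 1 / 2 : ℝ) : ℂ) = -z by rw [hz]; ring,
    div_neg, mul_div_assoc', mul_neg_one, neg_div]

/-- `F(s) - c/(s - iu)` stays bounded as `s → iu` from the right half-plane. -/
def HasPolarPart (F : ℂ → ℂ) (u : ℝ) (c : ℂ) : Prop :=
  (fun s => F s - c / (s - u * Complex.I)) =O[𝓝[{s : ℂ | 0 < s.re}] (u * Complex.I)] fun _ => (1:ℝ)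

lemma eventually_ne_mul_I (u : ℝ) :
    ∀ᶠ s in 𝓝[{s : ℂ | 0 < s.re}] (u * Complex.I), s ≠ u * Complex.I := by
  filter_upwards [self_mem_nhdsWithin] with s hs h
  rw [h] at hs
  simp at hs

lemma HasPolarPart.congr {F F' : ℂ → ℂ} {u : ℝ} {c : ℂ} (h : HasPolarPart F u c)
    (he : F =ᶠ[𝓝[{s : ℂ | 0 < s.re}] (u * Complex.I)] F') : HasPolarPart F' u c :=
  Asymptotics.IsBigO.congr' h (by filter_upwards [he] with s hs; rw [hs]) EventuallyEq.rfl

lemma hasPolarPart_zero {F : ℂ → ℂ} {u : ℝ} (h : ContinuousAt F (u * Complex.I)) :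
    HasPolarPart F u 0 := by
  unfold HasPolarPart
  simp only [zero_div, sub_zero]
  exact (h.tendsto.mono_left nhdsWithin_le_nhds).isBigO_one ℝ

lemma HasPolarPart.add {F F' : ℂ → ℂ} {u : ℝ} {c c' : ℂ} (h : HasPolarPart F u c)
    (h' : HasPolarPart F' u c') : HasPolarPart (fun s => F s + F' s) u (c + c') := by
  refine (Asymptotics.IsBigO.add h h').congr_left fun s => ?_
  rw [add_div]; ring

lemma isBigO_one_slope {f : ℂ → ℂ} {u : ℝ} (hf : DifferentiableAt ℂ f (u * Complex.I)) :
    (fun s => (f s - f (u * Complex.I)) / (s - u * Complex.I))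
      =O[𝓝[{s : ℂ | 0 < s.re}] (u * Complex.I)] fun _ => (1:ℝ) := by
  have hc : ContinuousAt (dslope f (u * Complex.I)) (u * Complex.I) := continuousAt_dslope_same.2 hf
  refine ((hc.tendsto.mono_left nhdsWithin_le_nhds).isBigO_one ℝ).congr' ?_ EventuallyEq.rfl
  filter_upwards [eventually_ne_mul_I u] with s hs
  rw [dslope_of_ne _ hs, slope_def_field]

lemma hasPolarPart_div {f : ℂ → ℂ} {u : ℝ} (hf : DifferentiableAt ℂ f (u * Complex.I)) :
    HasPolarPart (fun s => f s / (s - u * Complex.I)) u (f (u * Complex.I)) := by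
  refine (isBigO_one_slope hf).congr_left fun s => ?_
  rw [sub_div]

lemma HasPolarPart.mul {F w : ℂ → ℂ} {u : ℝ} {c : ℂ} (h : HasPolarPart F u c)
    (hw : DifferentiableAt ℂ w (u * Complex.I)) :
    HasPolarPart (fun s => F s * w s) u (c * w (u * Complex.I)) := by
  have h1 : w =O[𝓝[{s : ℂ | 0 < s.re}] (u * Complex.I)] fun _ => (1:ℝ) :=
    (hw.continuousAt.tendsto.mono_left nhdsWithin_le_nhds).isBigO_one ℝ
  have h2 := (Asymptotics.IsBigO.mul h h1).add ((isBigO_one_slope hw).const_mul_left c |>.congr_right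
    fun _ => (one_mul (1:ℝ)).symm)
  refine Asymptotics.IsBigO.congr h2 (fun s => ?_) fun s => one_mul (1:ℝ)
  ring

/-- The regularised quotient `s * ζ(1 + 2 * s) / ζ(1/2 + s)`. -/
noncomputable def zetaQuot (s : ℂ) : ℂ :=
  riemannZeta₁ (1 + 2 * s) / 2 * ((s - 1 / 2) / riemannZeta₁ (1 / 2 + s))

lemma zetaQuot_div {s : ℂ} (h0 : s ≠ 0) (h1 : s ≠ 1 / 2) :
    zetaQuot s / s = riemannZeta (1 + 2 * s) / riemannZeta (1 / 2 + s) := by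
  have h2 : s - 1 / 2 ≠ 0 := sub_ne_zero.2 h1
  have h3 : 1 / 2 + s ≠ 1 := fun h => h2 (by linear_combination h)
  rw [zetaQuot, riemannZeta₁_eq (by simpa using h0), riemannZeta₁_eq h3,
    show 1 / 2 + s - 1 = s - 1 / 2 by ring, div_mul_eq_div_div, div_self h2]
  field_simp
  ring

lemma zetaQuot_half : zetaQuot (1 / 2) = 0 := by simp [zetaQuot]

lemma zetaQuot_zero : zetaQuot 0 = 1 / (2 * riemannZeta (1 / 2)) := by
  rw [zetaQuot, add_zero, riemannZeta₁_eq (s := 1 / 2) (by norm_num)]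
  have := riemannZeta_half_ne_zero
  simp only [mul_zero, add_zero, riemannZeta₁_one]
  field_simp
  norm_num

lemma differentiableAt_zetaQuot {s : ℂ} (h : riemannZeta₁ (1 / 2 + s) ≠ 0) :
    DifferentiableAt ℂ zetaQuot s := by
  have hd := differentiable_riemannZeta₁
  have h1 : DifferentiableAt ℂ (fun s : ℂ => riemannZeta₁ (1 + 2 * s)) s :=
    (hd _).comp s (f := fun s : ℂ => 1 + 2 * s) (by fun_prop)
  have h2 : DifferentiableAt ℂ (fun s : ℂ => riemannZeta₁ (1 / 2 + s)) s :=
    (hd _).comp s (f := fun s : ℂ => 1 / 2 + s) (by fun_prop)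
  exact (h1.div_const 2).mul (DifferentiableAt.div (by fun_prop) h2 h)

lemma differentiableAt_zetaQuot_of_re_pos
    (hRH : ∀ ρ : ℂ, riemannZeta ρ = 0 → 0 < ρ.re → ρ.re < 1 → ρ.re = 1 / 2)
    {s : ℂ} (hs : 0 < s.re) : DifferentiableAt ℂ zetaQuot s := by
  refine differentiableAt_zetaQuot fun h => ?_
  have := re_eq_half_of_riemannZeta₁_eq_zero hRH h (by simp; linarith)
  norm_num at this
  linarith

lemma differentiableAt_zetaQuot_mul_I {u : ℝ} (hu : u ∉ zetaOrdinates) :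
    DifferentiableAt ℂ zetaQuot (u * Complex.I) :=
  differentiableAt_zetaQuot fun h => hu (riemannZeta_eq_zero_of_riemannZeta₁ h)

lemma exists_hasPolarPart_zetaQuot
    (hsimple : ∀ ρ : ℂ, riemannZeta ρ = 0 → 0 < ρ.re → ρ.re < 1 → deriv riemannZeta ρ ≠ 0) (u : ℝ) :
    ∃ c, HasPolarPart zetaQuot u c ∧ (c ≠ 0 → u ∈ zetaOrdinates) := by
  by_cases hu : u ∈ zetaOrdinates
  swap
  · exact ⟨0, hasPolarPart_zero (differentiableAt_zetaQuot_mul_I hu).continuousAt, by simp⟩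
  set a : ℂ := u * Complex.I with ha
  set f : ℂ → ℂ := fun s => riemannZeta₁ (1 / 2 + s) with hf
  have hd := differentiable_riemannZeta₁
  have hfd : Differentiable ℂ f := hd.comp (by fun_prop : Differentiable ℂ fun s : ℂ => 1 / 2 + s)
  have hfa : f a = 0 := riemannZeta₁_eq_zero_of_mem hu
  have hf' : deriv f a ≠ 0 := by
    rw [hf, deriv_comp_const_add, deriv_riemannZeta₁ (half_add_mul_I_ne_one u) hu]
    refine mul_ne_zero (sub_ne_zero.2 (half_add_mul_I_ne_one u)) (hsimple _ hu ?_ ?_) <;> norm_num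
  have hgd : DifferentiableAt ℂ (dslope f a) a :=
    ((Complex.differentiableOn_dslope univ_mem).2 hfd.differentiableOn).differentiableAt univ_mem
  have hga : dslope f a a ≠ 0 := by rwa [dslope_same]
  have h1 : DifferentiableAt ℂ (fun s : ℂ => riemannZeta₁ (1 + 2 * s)) a :=
    (hd _).comp a (f := fun s : ℂ => 1 + 2 * s) (by fun_prop)
  have h2 : DifferentiableAt ℂ
      (fun s => riemannZeta₁ (1 + 2 * s) / 2 * ((s - 1 / 2) / dslope f a s)) a :=
    (h1.div_const 2).mul (DifferentiableAt.div (by fun_prop) hgd hga)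
  refine ⟨_, (hasPolarPart_div h2).congr ?_, fun _ => hu⟩
  filter_upwards [eventually_ne_mul_I u] with s hs
  have h3 : f s = (s - a) * dslope f a s := by
    have := sub_smul_dslope f a s
    rw [hfa, sub_zero, smul_eq_mul] at this
    exact this.symm
  rw [zetaQuot, show riemannZeta₁ (1 / 2 + s) = f s from rfl, h3, mul_div_assoc, div_div,
    mul_comm (dslope f a s)]

lemma exists_norm_zetaQuot_div_sq_le
    (hRH : ∀ ρ : ℂ, riemannZeta ρ = 0 → 0 < ρ.re → ρ.re < 1 → ρ.re = 1 / 2)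
    (hsimple : ∀ ρ : ℂ, riemannZeta ρ = 0 → 0 < ρ.re → ρ.re < 1 → deriv riemannZeta ρ ≠ 0)
    {θ C : ℝ} (hθ : θ < 3 / 2)
    (hJ : ∀ T : ℝ, 1 ≤ T →
      (∑' γ : {γ : ℝ // 0 < γ ∧ γ ≤ T ∧ riemannZeta (1 / 2 + γ * Complex.I) = 0},
        1 / ‖deriv riemannZeta (1 / 2 + (γ : ℝ) * Complex.I)‖ ^ 2) ≤ C * T ^ θ) :
    ∃ b : zetaOrdinates → ℝ, (∀ γ, 0 ≤ b γ) ∧ Summable b ∧ ∃ C, 0 < C ∧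
      ∀ s : ℂ, 0 < s.re → s.re ≤ 9 / 10 → 1 ≤ |s.im| → ‖zetaQuot s / s‖ ^ 2 ≤
        C * (1 + |s.im|) ^ (1 / 5 : ℝ) + C * (1 + |s.im|) ^ (9 / 5 : ℝ) *
          ∑' γ : zetaOrdinates, b γ / ‖s - (γ : ℝ) * Complex.I‖ ^ 2 := by
  obtain ⟨b, hb, hbs, C₁, hC₁, h⟩ := exists_norm_inv_zeta_sq_le hRH hsimple hθ hJ
  obtain ⟨C₂, hC₂, hz⟩ := exists_norm_riemannZeta₁_le (p := 1 / 10) (σ := 1) (by norm_num)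
    (by norm_num) (by norm_num)
  refine ⟨b, hb, hbs, (1 + 3 * C₂) ^ 2 * C₁, by positivity, fun s h0 h1 him => ?_⟩
  have hx : 0 < 1 + |s.im| := by positivity
  have hs1 : 1 ≤ ‖s‖ := him.trans (Complex.abs_im_le_norm s)
  have hs2 : ‖s‖ ≤ 1 + |s.im| := by
    have := Complex.norm_le_abs_re_add_abs_im s
    rw [abs_of_pos h0] at this
    linarith
  have hA : ‖riemannZeta₁ (1 + 2 * s) / 2 / s‖ ≤ (1 + 3 * C₂) * (1 + |s.im|) ^ (1 / 10 : ℝ) := by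
    have h2 := hz (1 + 2 * s) (by simp; linarith)
    have h3 : ‖1 + 2 * s - 1‖ = 2 * ‖s‖ := by simp
    have h4 : ‖1 + 2 * s‖ ≤ 3 * (1 + |s.im|) := by
      have := norm_add_le (1:ℂ) (2 * s)
      rw [norm_one, norm_mul, Complex.norm_two] at this
      linarith
    have h5 : ‖1 + 2 * s‖ ^ (1 / 10 : ℝ) ≤ 3 * (1 + |s.im|) ^ (1 / 10 : ℝ) := by
      refine (Real.rpow_le_rpow (norm_nonneg _) h4 (by norm_num)).trans ?_
      rw [Real.mul_rpow (by norm_num) hx.le]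
      gcongr
      exact Real.rpow_le_self_of_one_le (by norm_num) (by norm_num)
    have h6 : 1 ≤ (1 + |s.im|) ^ (1 / 10 : ℝ) :=
      Real.one_le_rpow (by linarith [abs_nonneg s.im]) (by norm_num)
    rw [norm_div, norm_div, Complex.norm_two, div_div, div_le_iff₀ (by positivity)]
    rw [h3] at h2
    refine h2.trans ?_
    have h7 : C₂ * (2 * ‖s‖ * ‖1 + 2 * s‖ ^ (1 / 10 : ℝ)) ≤
        C₂ * (2 * ‖s‖ * (3 * (1 + |s.im|) ^ (1 / 10 : ℝ))) := by gcongr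
    have h8 : 1 ≤ (1 + |s.im|) ^ (1 / 10 : ℝ) * (2 * ‖s‖) := by nlinarith
    linarith
  have hB := h s h0 (by linarith)
  have he : zetaQuot s / s =
      riemannZeta₁ (1 + 2 * s) / 2 / s * ((s - 1 / 2) / riemannZeta₁ (1 / 2 + s)) := by
    rw [zetaQuot]; ring
  rw [he, norm_mul, mul_pow]
  calc _ ≤ ((1 + 3 * C₂) * (1 + |s.im|) ^ (1 / 10 : ℝ)) ^ 2 * _ :=
        mul_le_mul (pow_le_pow_left₀ (norm_nonneg _) hA 2) hB (by positivity) (by positivity)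
    _ = _ := by
      have e1 : ((1 + |s.im|) ^ (1 / 10 : ℝ)) ^ 2 = (1 + |s.im|) ^ (1 / 5 : ℝ) := by
        rw [← Real.rpow_natCast, ← Real.rpow_mul hx.le]; norm_num
      have e2 : (1 + |s.im|) ^ (9 / 5 : ℝ) =
          (1 + |s.im|) ^ (1 / 5 : ℝ) * (1 + |s.im|) ^ (8 / 5 : ℝ) := by
        rw [← Real.rpow_add hx]; norm_num
      rw [mul_pow, e1, e2]; ring

lemma integrableOn_of_norm_le_exp {g : ℝ → ℂ} (hm : Measurable g) {A c : ℝ} (hc : c < 0)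
    (h : ∀ y, 0 < y → ‖g y‖ ≤ A * Real.exp (c * y)) : IntegrableOn g (Set.Ioi 0) := by
  refine Integrable.mono' ((integrableOn_exp_mul_Ioi hc 0).const_mul A) hm.aestronglyMeasurable ?_
  filter_upwards [ae_restrict_mem measurableSet_Ioi] with y hy using h y hy

lemma measurable_Lweight_exp (α : ℝ) : Measurable fun y : ℝ => Lweight α (Real.exp y) :=
  (measurable_from_top (f := fun n : ℕ => ∑ k ∈ Finset.Icc 1 n, liouville k / (k : ℝ) ^ α)).comp
    (Nat.measurable_floor.comp Real.measurable_exp)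

lemma ae_continuousAt_Lweight_exp (α : ℝ) :
    ∀ᵐ y : ℝ, ContinuousAt (fun y : ℝ => Lweight α (Real.exp y)) y := by
  have hc : (Real.exp ⁻¹' Set.range ((↑) : ℕ → ℝ)).Countable :=
    (Set.countable_range _).preimage Real.exp_injective
  filter_upwards [hc.ae_notMem volume] with y hy
  have h1 : (⌊Real.exp y⌋₊ : ℝ) < Real.exp y :=
    lt_of_le_of_ne (Nat.floor_le (Real.exp_pos y).le) fun h => hy ⟨_, h⟩
  have h2 : Real.exp y < ⌊Real.exp y⌋₊ + 1 := Nat.lt_floor_add_one _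
  refine (continuousAt_const (y := Lweight α (Real.exp y))).congr ?_
  filter_upwards [Real.continuous_exp.continuousAt (Ioo_mem_nhds h1 h2)] with z hz
  have : ⌊Real.exp z⌋₊ = ⌊Real.exp y⌋₊ :=
    (Nat.floor_eq_iff (Real.exp_pos z).le).2 ⟨hz.1.le, hz.2⟩
  rw [Lweight, Lweight, this]

lemma exists_abs_exp_mul_Lweight_le {α : ℝ} (hα : α ≤ 1) : ∃ Z, 0 ≤ Z ∧ ∀ y : ℝ,
    Real.exp (y * (α - 1 / 2)) * |Lweight α (Real.exp y)| ≤ Z * Real.exp (3 / 5 * y) := by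
  obtain ⟨Z, hZ, h⟩ := exists_abs_Lweight_le
  refine ⟨Z, hZ, fun y => ?_⟩
  calc _ ≤ Real.exp (y * (α - 1 / 2)) * (Z * Real.exp y ^ (11 / 10 - α)) := by
        gcongr; exact h α _ hα (Real.exp_pos y)
    _ = Z * Real.exp (3 / 5 * y) := by
        rw [← Real.exp_mul, mul_left_comm, ← Real.exp_add]
        congr 2; ring

lemma integrableOn_Lweight_mul_exp {α : ℝ} (hα : α ≤ 1) {s : ℂ} (hs : 3 / 5 < s.re) :
    IntegrableOn (fun y : ℝ => (Lweight α (Real.exp y) : ℂ) *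
        Complex.exp ((((α - 1 / 2 : ℝ) : ℂ) - s) * y)) (Set.Ioi 0) := by
  obtain ⟨Z, hZ, h⟩ := exists_abs_exp_mul_Lweight_le hα
  refine integrableOn_of_norm_le_exp (A := Z) (c := 3 / 5 - s.re)
    ((Complex.measurable_ofReal.comp (measurable_Lweight_exp α)).mul (by fun_prop))
    (by linarith) fun y _ => ?_
  have h1 : ‖Complex.exp ((((α - 1 / 2 : ℝ) : ℂ) - s) * y)‖ =
      Real.exp (y * (α - 1 / 2)) * Real.exp (-s.re * y) := by
    rw [Complex.norm_exp, ← Real.exp_add, Complex.re_mul_ofReal, Complex.sub_re, Complex.ofReal_re]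
    congr 1; ring
  rw [norm_mul, Complex.norm_real, Real.norm_eq_abs, h1, ← mul_assoc,
    mul_comm |Lweight α (Real.exp y)|]
  calc _ ≤ Z * Real.exp (3 / 5 * y) * Real.exp (-s.re * y) :=
        mul_le_mul_of_nonneg_right (h y) (Real.exp_pos _).le
    _ = _ := by rw [mul_assoc, ← Real.exp_add]; congr 2; ring

lemma le_two_mul_exp (y : ℝ) : y ≤ 2 * Real.exp (3 / 5 * y) := by
  have := Real.add_one_le_exp (3 / 5 * y)
  have := Real.exp_pos (3 / 5 * y)
  linarith

lemma integrableOn_ofReal_mul_exp {s : ℂ} (hs : 3 / 5 < s.re) :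
    IntegrableOn (fun y : ℝ => (y : ℂ) * Complex.exp (-s * y)) (Set.Ioi 0) := by
  refine integrableOn_of_norm_le_exp (A := 2) (c := 3 / 5 - s.re) (by fun_prop) (by linarith)
    fun y hy => ?_
  rw [norm_mul, Complex.norm_real, Real.norm_eq_abs, abs_of_pos hy, Complex.norm_exp,
    Complex.re_mul_ofReal, Complex.neg_re]
  calc _ ≤ 2 * Real.exp (3 / 5 * y) * Real.exp (-s.re * y) := by gcongr; exact le_two_mul_exp y
    _ = _ := by rw [mul_assoc, ← Real.exp_add]; congr 2; ring

lemma integral_ofReal_mul_exp {s : ℂ} (hs : 3 / 5 < s.re) :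
    ∫ y in Set.Ioi (0:ℝ), (y : ℂ) * Complex.exp (-s * y) = 1 / s ^ 2 := by
  have hs0 : s ≠ 0 := by rintro rfl; norm_num at hs
  have hderiv : ∀ y ∈ Set.Ici (0:ℝ), HasDerivAt
      (fun y : ℝ => -((y : ℂ) / s + 1 / s ^ 2) * Complex.exp (-s * y))
      ((y : ℂ) * Complex.exp (-s * y)) y := by
    intro y _
    have h1 : HasDerivAt (fun y : ℝ => (y : ℂ)) 1 y := Complex.ofRealCLM.hasDerivAt
    have h2 := (((h1.div_const s).add_const (1 / s ^ 2)).neg).mul ((h1.const_mul (-s)).cexp)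
    refine h2.congr_deriv ?_
    simp only [Pi.neg_apply]
    field_simp
    ring
  have hlim : Tendsto (fun y : ℝ => -((y : ℂ) / s + 1 / s ^ 2) * Complex.exp (-s * y)) atTop
      (𝓝 0) := by
    rw [tendsto_zero_iff_norm_tendsto_zero]
    have h3 : Tendsto (fun y : ℝ => (2 / ‖s‖ + 1 / ‖s‖ ^ 2) * Real.exp (-(s.re - 3 / 5) * y)) atTop
        (𝓝 0) := by
      have h5 : Tendsto (fun y : ℝ => -(s.re - 3 / 5) * y) atTop atBot :=
        tendsto_id.const_mul_atTop_of_neg (by linarith)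
      simpa only [mul_zero, Function.comp_def] using
        (Real.tendsto_exp_atBot.comp h5).const_mul (2 / ‖s‖ + 1 / ‖s‖ ^ 2)
    refine squeeze_zero' (Eventually.of_forall fun _ => norm_nonneg _) ?_ h3
    filter_upwards [eventually_ge_atTop 0] with y hy
    have h4 : ‖(y : ℂ) / s + 1 / s ^ 2‖ ≤
        (2 / ‖s‖ + 1 / ‖s‖ ^ 2) * Real.exp (3 / 5 * y) := by
      refine (norm_add_le _ _).trans ?_
      rw [norm_div, norm_div, norm_pow, norm_one, Complex.norm_real, Real.norm_eq_abs,
        abs_of_nonneg hy, add_mul]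
      refine add_le_add ?_ (le_mul_of_one_le_right (by positivity) (Real.one_le_exp (by positivity)))
      rw [div_mul_eq_mul_div]
      gcongr
      exact le_two_mul_exp y
    rw [norm_mul, norm_neg, Complex.norm_exp, Complex.re_mul_ofReal, Complex.neg_re]
    calc _ ≤ (2 / ‖s‖ + 1 / ‖s‖ ^ 2) * Real.exp (3 / 5 * y) * Real.exp (-s.re * y) := by gcongr
      _ = _ := by rw [mul_assoc, ← Real.exp_add]; congr 2; ring
  rw [integral_Ioi_of_hasDerivAt_of_tendsto' hderiv (integrableOn_ofReal_mul_exp hs) hlim]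
  simp

lemma add_sq_div_sq_le {q D t C S : ℝ} (hC : 0 ≤ C) (ht : 1 ≤ t)
    (hq : q ^ 2 ≤ C * (1 + t) ^ (1 / 5 : ℝ) + C * (1 + t) ^ (9 / 5 : ℝ) * S) (hS : 0 ≤ S) :
    ((q + D) / t) ^ 2 ≤ 8 * (C + D ^ 2) * (1 + t) ^ (-(9 / 5) : ℝ) +
      8 * (C + D ^ 2) * (1 + t) ^ (-(1 / 5) : ℝ) * S := by
  have hx : 0 < 1 + t := by linarith
  have e1 : (1 + t) ^ (1 / 5 : ℝ) = (1 + t) ^ (-(9 / 5) : ℝ) * (1 + t) ^ 2 := by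
    rw [← Real.rpow_natCast, ← Real.rpow_add hx]; norm_num
  have e2 : (1 + t) ^ (9 / 5 : ℝ) = (1 + t) ^ (-(1 / 5) : ℝ) * (1 + t) ^ 2 := by
    rw [← Real.rpow_natCast, ← Real.rpow_add hx]; norm_num
  have e3 : 1 ≤ (1 + t) ^ (1 / 5 : ℝ) := Real.one_le_rpow (by linarith) (by norm_num)
  rw [div_pow, div_le_iff₀ (by positivity)]
  rw [e1, e2] at hq
  rw [e1] at e3
  set a := (1 + t) ^ (-(9 / 5) : ℝ) with ha
  set c := (1 + t) ^ (-(1 / 5) : ℝ) with hc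
  have ha0 : 0 ≤ a := by positivity
  have hc0 : 0 ≤ c := by positivity
  have h4 : (1 + t) ^ 2 ≤ 4 * t ^ 2 := by nlinarith
  calc (q + D) ^ 2 ≤ 2 * q ^ 2 + 2 * D ^ 2 := by nlinarith [sq_nonneg (q - D)]
    _ ≤ 2 * (C * (a * (1 + t) ^ 2) + C * (c * (1 + t) ^ 2) * S) +
        2 * D ^ 2 * (a * (1 + t) ^ 2 + c * (1 + t) ^ 2 * S) := by
      have h5 : 0 ≤ c * (1 + t) ^ 2 * S := by positivity
      have h6 : D ^ 2 * 1 ≤ D ^ 2 * (a * (1 + t) ^ 2 + c * (1 + t) ^ 2 * S) := by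
        gcongr; linarith
      linarith
    _ = (2 * (C + D ^ 2) * a + 2 * (C + D ^ 2) * c * S) * (1 + t) ^ 2 := by ring
    _ ≤ (2 * (C + D ^ 2) * a + 2 * (C + D ^ 2) * c * S) * (4 * t ^ 2) := by gcongr
    _ = _ := by ring

/-- Existence of a limiting distribution for a function whose Laplace transform is, away from the
origin, a regular multiple of `zetaQuot` plus a regular function. -/
theorem hasLimitingDist_of_zetaQuot
    (hRH : ∀ ρ : ℂ, riemannZeta ρ = 0 → 0 < ρ.re → ρ.re < 1 → ρ.re = 1 / 2)
    (hsimple : ∀ ρ : ℂ, riemannZeta ρ = 0 → 0 < ρ.re → ρ.re < 1 → deriv riemannZeta ρ ≠ 0)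
    {θ C : ℝ} (hθ : θ < 3 / 2)
    (hJ : ∀ T : ℝ, 1 ≤ T →
      (∑' γ : {γ : ℝ // 0 < γ ∧ γ ≤ T ∧ riemannZeta (1 / 2 + γ * Complex.I) = 0},
        1 / ‖deriv riemannZeta (1 / 2 + (γ : ℝ) * Complex.I)‖ ^ 2) ≤ C * T ^ θ)
    {φ : ℝ → ℝ} {G : ℂ → ℂ} {A D : ℝ} (hm : Measurable φ)
    (hA : ∀ y, 0 ≤ y → |φ y| ≤ A * Real.exp (3 / 5 * y))
    (hcont : ∀ᵐ y : ℝ, ContinuousAt φ y)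
    (hL : ∀ s : ℂ, s.re = 9 / 10 →
      G s = ∫ y in Set.Ioi (0:ℝ), (φ y : ℂ) * Complex.exp (-s * y))
    (hd : ∀ s : ℂ, 0 < s.re → DifferentiableAt ℂ G s)
    (h0 : ∃ c, HasPolarPart G 0 c)
    (hpole : ∀ u : ℝ, u ≠ 0 → ∃ w v : ℂ → ℂ, DifferentiableAt ℂ w (u * Complex.I) ∧
      ContinuousAt v (u * Complex.I) ∧
      ∀ᶠ s in 𝓝 (u * Complex.I : ℂ), zetaQuot s * w s + v s = G s)
    (hG : ∀ s : ℂ, 0 < s.re → 1 ≤ |s.im| → ‖G s‖ ≤ (‖zetaQuot s / s‖ + D) / |s.im|) :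
    HasLimitingDist φ := by
  have hA0 : 0 ≤ A := by
    have := (abs_nonneg _).trans (hA 0 le_rfl)
    simpa using this
  have hres : ∀ u : ℝ, ∃ c, HasPolarPart G u c ∧ (c ≠ 0 → u ∈ insert 0 zetaOrdinates) := by
    intro u
    rcases eq_or_ne u 0 with rfl | hu
    · obtain ⟨c, hc⟩ := h0
      exact ⟨c, hc, fun _ => Set.mem_insert _ _⟩
    · obtain ⟨w, v, hw, hv, he⟩ := hpole u hu
      obtain ⟨c, hc, hcu⟩ := exists_hasPolarPart_zetaQuot hsimple u
      refine ⟨_, ((hc.mul hw).add (hasPolarPart_zero hv)).congr (he.filter_mono nhdsWithin_le_nhds),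
        fun h => Set.mem_insert_of_mem _ (hcu ?_)⟩
      rintro rfl
      simp at h
  choose r hr hr' using hres
  obtain ⟨b, hb, hbs, C₁, hC₁, hq⟩ := exists_norm_zetaQuot_div_sq_le hRH hsimple hθ hJ
  have : Countable zetaOrdinates := countable_zetaOrdinates.to_subtype
  refine hasLimitingDist_of_laplace (K := 9 / 10) (G := G) (r := r) (b := b)
    (γ := fun γ : zetaOrdinates => (γ : ℝ)) (C := 8 * (C₁ + D ^ 2)) hm ?_
    (hcont.mono fun y hy _ => hy) (by norm_num) ?_ ?_ (fun s hs _ => hd s hs) ?_ hr hb hbs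
    (by positivity) ?_
  · refine fun Y => ⟨A * Real.exp (3 / 5 * Y), fun y hy => (hA y hy.1).trans ?_⟩
    have := hy.2
    gcongr
  · refine integrableOn_of_norm_le_exp (A := A) (c := -(3 / 10))
      ((Complex.measurable_ofReal.comp hm).mul (by fun_prop)) (by norm_num) fun y hy => ?_
    rw [norm_mul, Complex.norm_real, Real.norm_eq_abs, Complex.norm_exp, Complex.re_mul_ofReal,
      Complex.neg_re, Complex.ofReal_re]
    calc _ ≤ A * Real.exp (3 / 5 * y) * Real.exp (-(9 / 10) * y) := by gcongr; exact hA y hy.le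
      _ = _ := by rw [mul_assoc, ← Real.exp_add]; congr 2; ring
  · exact fun t => hL _ (by simp)
  · refine fun T => (((zetaOrdinates_inter_finite T).insert 0)).subset ?_
    rintro u ⟨hu, huT⟩
    rcases hr' u hu with h | h
    · exact Or.inl h
    · exact Or.inr ⟨h, huT⟩
  · intro s hs hsK him
    refine (pow_le_pow_left₀ (norm_nonneg _) (hG s hs him) 2).trans ?_
    exact add_sq_div_sq_le hC₁.le him (hq s hs hsK him)
      (tsum_nonneg fun γ => by have := hb γ; positivity)

lemma mul_I_ne_ofReal {u : ℝ} (hu : u ≠ 0) (b : ℝ) : (u * Complex.I : ℂ) ≠ b := by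
  intro h
  have := congrArg Complex.im h
  simp at this
  exact hu this

lemma abs_im_le_norm_sub_ofReal (s : ℂ) (b : ℝ) : |s.im| ≤ ‖s - b‖ := by
  simpa using Complex.abs_im_le_norm (s - b)

lemma ofReal_re_of_conj {z : ℂ} (h : starRingEnd ℂ z = z) : ((z.re : ℝ) : ℂ) = z :=
  Complex.conj_eq_iff_re.1 h

lemma integral_exp_mul_Lweight_sub {α : ℝ} (hα : α ≤ 1) (κ : ℝ) {s : ℂ} (hs : 3 / 5 < s.re) :
    ∫ y in Set.Ioi (0:ℝ),
        ((Real.exp (y * (α - 1 / 2)) * (Lweight α (Real.exp y) - κ) : ℝ) : ℂ) *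
          Complex.exp (-s * y) =
      (zetaQuot s / s - κ) / (s - ((α - 1 / 2 : ℝ) : ℂ)) := by
  have hz0 : (((α - 1 / 2 : ℝ) : ℂ) - s).re < 0 := by
    rw [Complex.sub_re, Complex.ofReal_re]; linarith
  have he : ∀ y : ℝ, ((Real.exp (y * (α - 1 / 2)) * (Lweight α (Real.exp y) - κ) : ℝ) : ℂ) *
      Complex.exp (-s * y) = (Lweight α (Real.exp y) : ℂ) *
        Complex.exp ((((α - 1 / 2 : ℝ) : ℂ) - s) * y) -
          κ * Complex.exp ((((α - 1 / 2 : ℝ) : ℂ) - s) * y) := by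
    intro y
    have : Complex.exp ((((α - 1 / 2 : ℝ) : ℂ) - s) * y) =
        (Real.exp (y * (α - 1 / 2)) : ℂ) * Complex.exp (-s * y) := by
      rw [Complex.ofReal_exp, ← Complex.exp_add]; congr 1; push_cast; ring
    rw [this]; push_cast; ring
  have hs0 : s ≠ 0 := by rintro rfl; norm_num at hs
  have hs1 : s ≠ 1 / 2 := by rintro rfl; norm_num at hs
  simp only [he]
  rw [integral_sub (integrableOn_Lweight_mul_exp hα hs)
      ((integrableOn_exp_mul_complex_Ioi hz0 0).const_mul _),
    integral_Lweight_mul_exp hα (by linarith), integral_const_mul,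
    integral_exp_mul_complex_Ioi hz0, zetaQuot_div hs0 hs1, Complex.ofReal_zero, mul_zero,
    Complex.exp_zero, ← neg_sub s, neg_div_neg_eq]
  ring

theorem hasLimitingDist_exp_mul_Lweight_sub
    (hRH : ∀ ρ : ℂ, riemannZeta ρ = 0 → 0 < ρ.re → ρ.re < 1 → ρ.re = 1 / 2)
    (hsimple : ∀ ρ : ℂ, riemannZeta ρ = 0 → 0 < ρ.re → ρ.re < 1 → deriv riemannZeta ρ ≠ 0)
    {θ C : ℝ} (hθ : θ < 3 / 2)
    (hJ : ∀ T : ℝ, 1 ≤ T →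
      (∑' γ : {γ : ℝ // 0 < γ ∧ γ ≤ T ∧ riemannZeta (1 / 2 + γ * Complex.I) = 0},
        1 / ‖deriv riemannZeta (1 / 2 + (γ : ℝ) * Complex.I)‖ ^ 2) ≤ C * T ^ θ)
    {α κ : ℝ} (hα : α ≤ 1) (hα2 : α ≠ 1 / 2) {G : ℂ → ℂ}
    (hG : ∀ s : ℂ, s ≠ ((α - 1 / 2 : ℝ) : ℂ) →
      G s = (zetaQuot s / s - κ) / (s - ((α - 1 / 2 : ℝ) : ℂ)))
    (hd : ∀ s : ℂ, 0 < s.re → DifferentiableAt ℂ G s) :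
    HasLimitingDist fun y => Real.exp (y * (α - 1 / 2)) * (Lweight α (Real.exp y) - κ) := by
  obtain ⟨Z, hZ, hZb⟩ := exists_abs_exp_mul_Lweight_le hα
  have hβ0 : ((α - 1 / 2 : ℝ) : ℂ) ≠ 0 := by
    rw [Complex.ofReal_ne_zero, sub_ne_zero]; exact hα2
  have hβh : α - 1 / 2 ≤ 1 / 2 := by linarith
  have hint := fun s : ℂ => integral_exp_mul_Lweight_sub hα κ (s := s)
  have hexp : ∀ y : ℝ, 0 ≤ y → Real.exp (y * (α - 1 / 2)) ≤ Real.exp (3 / 5 * y) := fun y hy => by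
    rw [Real.exp_le_exp]; nlinarith
  generalize hβ : α - 1 / 2 = β at *
  have hLm : Measurable fun y : ℝ => Lweight α (Real.exp y) - κ :=
    (measurable_Lweight_exp α).sub_const κ
  refine hasLimitingDist_of_zetaQuot hRH hsimple hθ hJ (A := Z + |κ|) (D := |κ|) (G := G)
    (Measurable.mul (by fun_prop) hLm) ?_ ?_ ?_ hd ?_ ?_ ?_
  · intro y hy
    rw [abs_mul, abs_of_pos (Real.exp_pos _)]
    calc _ ≤ Real.exp (y * β) * (|Lweight α (Real.exp y)| + |κ|) := by
          gcongr; exact abs_sub _ _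
      _ = Real.exp (y * β) * |Lweight α (Real.exp y)| + |κ| * Real.exp (y * β) := by ring
      _ ≤ Z * Real.exp (3 / 5 * y) + |κ| * Real.exp (3 / 5 * y) := by
          exact add_le_add (hZb y) (mul_le_mul_of_nonneg_left (hexp y hy) (abs_nonneg κ))
      _ = _ := by ring
  · filter_upwards [ae_continuousAt_Lweight_exp α] with y hy
    exact ContinuousAt.mul (by fun_prop) (hy.sub continuousAt_const)
  · intro s hs
    have hsβ : s ≠ (β : ℂ) := by
      rintro rfl
      rw [Complex.ofReal_re] at hs
      linarith
    rw [hG s hsβ, hint s (by rw [hs]; norm_num)]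
  · have h1 : DifferentiableAt ℂ (fun s : ℂ => zetaQuot s / (s - β)) ((0:ℝ) * Complex.I) := by
      refine (differentiableAt_zetaQuot_mul_I zero_notMem_zetaOrdinates).div (by fun_prop) ?_
      simpa using hβ0
    have h2 : ContinuousAt (fun s : ℂ => -(κ : ℂ) / (s - β)) ((0:ℝ) * Complex.I) := by
      refine ContinuousAt.div (by fun_prop) (by fun_prop) ?_
      simpa using hβ0
    refine ⟨_, ((hasPolarPart_div h1).add (hasPolarPart_zero h2)).congr ?_⟩
    have h3 : ∀ᶠ s in 𝓝 (((0:ℝ) : ℂ) * Complex.I), s ≠ (β : ℂ) := by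
      refine eventually_ne_nhds ?_
      simpa using hβ0.symm
    filter_upwards [eventually_ne_mul_I 0, h3.filter_mono nhdsWithin_le_nhds] with s hs0 hsβ
    rw [Complex.ofReal_zero, zero_mul] at hs0 ⊢
    rw [hG s hsβ, sub_zero]
    ring
  · intro u hu
    have h1 : (u * Complex.I : ℂ) - β ≠ 0 := sub_ne_zero.2 (mul_I_ne_ofReal hu β)
    have h2 : (u * Complex.I : ℂ) ≠ 0 := by simpa using hu
    refine ⟨fun s => 1 / (s * (s - β)), fun s => -(κ : ℂ) / (s - β),
      DifferentiableAt.div (by fun_prop) (by fun_prop) (mul_ne_zero h2 h1),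
      ContinuousAt.div (by fun_prop) (by fun_prop) h1, ?_⟩
    filter_upwards [eventually_ne_nhds (mul_I_ne_ofReal hu β)] with s hs
    rw [hG s hs, one_div, mul_inv]
    ring
  · intro s hs him
    have hsβ : s ≠ (β : ℂ) := by
      rintro rfl
      rw [Complex.ofReal_im, abs_zero] at him
      linarith
    rw [hG s hsβ, norm_div]
    have h1 : ‖zetaQuot s / s - κ‖ ≤ ‖zetaQuot s / s‖ + |κ| := by
      simpa using norm_sub_le (zetaQuot s / s) (κ : ℂ)
    have h2 := abs_im_le_norm_sub_ofReal s β
    gcongr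

lemma differentiableAt_zetaQuot_div
    (hRH : ∀ ρ : ℂ, riemannZeta ρ = 0 → 0 < ρ.re → ρ.re < 1 → ρ.re = 1 / 2)
    {s : ℂ} (hs : 0 < s.re) : DifferentiableAt ℂ (fun s => zetaQuot s / s) s :=
  (differentiableAt_zetaQuot_of_re_pos hRH hs).div differentiableAt_id
    (by rintro rfl; simp at hs)

lemma differentiableAt_dslope_of_differentiableAt {f : ℂ → ℂ} {U : Set ℂ} (hU : IsOpen U)
    (hf : ∀ s ∈ U, DifferentiableAt ℂ f s) {a : ℂ} (ha : a ∈ U) {s : ℂ} (hs : s ∈ U) :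
    DifferentiableAt ℂ (dslope f a) s :=
  ((Complex.differentiableOn_dslope (hU.mem_nhds ha)).2
    fun z hz => (hf z hz).differentiableWithinAt).differentiableAt (hU.mem_nhds hs)

theorem hasLimitingDist_Lweight_half_sub
    (hRH : ∀ ρ : ℂ, riemannZeta ρ = 0 → 0 < ρ.re → ρ.re < 1 → ρ.re = 1 / 2)
    (hsimple : ∀ ρ : ℂ, riemannZeta ρ = 0 → 0 < ρ.re → ρ.re < 1 → deriv riemannZeta ρ ≠ 0)
    {θ C : ℝ} (hθ : θ < 3 / 2)
    (hJ : ∀ T : ℝ, 1 ≤ T →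
      (∑' γ : {γ : ℝ // 0 < γ ∧ γ ≤ T ∧ riemannZeta (1 / 2 + γ * Complex.I) = 0},
        1 / ‖deriv riemannZeta (1 / 2 + (γ : ℝ) * Complex.I)‖ ^ 2) ≤ C * T ^ θ)
    {c : ℝ} (hc : (c : ℂ) = zetaQuot 0) :
    HasLimitingDist fun y => Lweight (1 / 2) (Real.exp y) - c * y := by
  obtain ⟨Z, hZ, hZb⟩ := exists_abs_exp_mul_Lweight_le (α := 1 / 2) (by norm_num)
  refine hasLimitingDist_of_zetaQuot hRH hsimple hθ hJ (A := Z + 2 * |c|) (D := |c|)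
    (G := fun s => (zetaQuot s - c) / s ^ 2)
    ((measurable_Lweight_exp _).sub (by fun_prop)) ?_ ?_ ?_ ?_ ?_ ?_ ?_
  · intro y hy
    have h1 := hZb y
    rw [sub_self, mul_zero, Real.exp_zero, one_mul] at h1
    calc _ ≤ |Lweight (1 / 2) (Real.exp y)| + |c * y| := abs_sub _ _
      _ = |Lweight (1 / 2) (Real.exp y)| + |c| * y := by rw [abs_mul, abs_of_nonneg hy]
      _ ≤ Z * Real.exp (3 / 5 * y) + |c| * (2 * Real.exp (3 / 5 * y)) := by
          gcongr
          exact le_two_mul_exp y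
      _ = _ := by ring
  · filter_upwards [ae_continuousAt_Lweight_exp (1 / 2)] with y hy
    exact hy.sub (by fun_prop)
  · intro s hs
    have hs' : 3 / 5 < s.re := by rw [hs]; norm_num
    have hs0 : s ≠ 0 := by rintro rfl; norm_num at hs
    have hs1 : s ≠ 1 / 2 := by rintro rfl; norm_num at hs
    have he : ∀ y : ℝ, ((Lweight (1 / 2) (Real.exp y) - c * y : ℝ) : ℂ) * Complex.exp (-s * y) =
        (Lweight (1 / 2) (Real.exp y) : ℂ) *
          Complex.exp ((((1 / 2 - 1 / 2 : ℝ) : ℂ) - s) * y) -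
          c * (y * Complex.exp (-s * y)) := by
      intro y
      rw [sub_self, Complex.ofReal_zero, zero_sub]; push_cast; ring
    simp only [he]
    rw [integral_sub (integrableOn_Lweight_mul_exp (by norm_num) hs')
        ((integrableOn_ofReal_mul_exp hs').const_mul _),
      integral_Lweight_mul_exp (by norm_num) (by linarith), integral_const_mul,
      integral_ofReal_mul_exp hs', ← zetaQuot_div hs0 hs1, sub_self, Complex.ofReal_zero, sub_zero]
    field_simp
  · intro s hs
    have hs0 : s ≠ 0 := by rintro rfl; simp at hs
    exact ((differentiableAt_zetaQuot_of_re_pos hRH hs).sub_const _).div (by fun_prop)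
      (pow_ne_zero 2 hs0)
  · set U : Set ℂ := {s | riemannZeta₁ (1 / 2 + s) ≠ 0} with hU
    have hUo : IsOpen U := isOpen_ne.preimage
      (differentiable_riemannZeta₁.continuous.comp (by fun_prop : Continuous fun s : ℂ => 1 / 2 + s))
    have h0U : (0:ℂ) ∈ U := fun h => riemannZeta_half_ne_zero
      (by rw [add_zero] at h; exact riemannZeta_eq_zero_of_riemannZeta₁ h)
    have h1 : DifferentiableAt ℂ (dslope zetaQuot 0) ((0:ℝ) * Complex.I) := by
      rw [Complex.ofReal_zero, zero_mul]
      exact differentiableAt_dslope_of_differentiableAt hUo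
        (fun s hs => differentiableAt_zetaQuot hs) h0U h0U
    refine ⟨_, (hasPolarPart_div h1).congr ?_⟩
    filter_upwards [eventually_ne_mul_I 0] with s hs0
    rw [Complex.ofReal_zero, zero_mul] at hs0 ⊢
    rw [dslope_of_ne _ hs0, slope_def_field, hc, sub_zero, div_div, sq]
  · intro u hu
    have h2 : (u * Complex.I : ℂ) ≠ 0 := by simpa using hu
    refine ⟨fun s => 1 / s ^ 2, fun s => -(c : ℂ) / s ^ 2,
      DifferentiableAt.div (by fun_prop) (by fun_prop) (pow_ne_zero 2 h2),
      ContinuousAt.div (by fun_prop) (by fun_prop) (pow_ne_zero 2 h2),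
      Eventually.of_forall fun s => by ring⟩
  · intro s hs him
    have h1 : |s.im| ≤ ‖s‖ := Complex.abs_im_le_norm s
    have hs1 : 1 ≤ ‖s‖ := him.trans h1
    have he : (zetaQuot s - c) / s ^ 2 = (zetaQuot s / s - c / s) / s := by ring
    rw [he, norm_div]
    have h2 : ‖zetaQuot s / s - c / s‖ ≤ ‖zetaQuot s / s‖ + |c| := by
      refine (norm_sub_le _ _).trans ?_
      gcongr
      rw [norm_div, Complex.norm_real, Real.norm_eq_abs]
      exact div_le_self (abs_nonneg _) hs1
    gcongr

theorem statement11
    (hRH : ∀ ρ : ℂ, riemannZeta ρ = 0 → 0 < ρ.re → ρ.re < 1 → ρ.re = 1 / 2)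
    (hsimple : ∀ ρ : ℂ, riemannZeta ρ = 0 → 0 < ρ.re → ρ.re < 1 →
      deriv riemannZeta ρ ≠ 0)
    (θ C : ℝ) (hθ1 : 1 ≤ θ) (hθ2 : θ < 3 - Real.sqrt 3)
    (hJ : ∀ T : ℝ, 1 ≤ T →
      (∑' γ : {γ : ℝ // 0 < γ ∧ γ ≤ T ∧ riemannZeta (1 / 2 + γ * Complex.I) = 0},
        1 / ‖deriv riemannZeta (1 / 2 + (γ : ℝ) * Complex.I)‖ ^ 2) ≤ C * T ^ θ) :
    ∀ α : ℝ, 0 ≤ α → α ≤ 1 → HasLimitingDist (E₃ α) := by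
  have hθ : θ < 3 / 2 := by
    have : (3 / 2 : ℝ) < Real.sqrt 3 := Real.lt_sqrt_of_sq_lt (by norm_num)
    linarith
  intro α _ h1
  rcases lt_trichotomy α (1 / 2) with hlt | rfl | hgt
  · have hE : E₃ α =
        fun y => Real.exp (y * (α - 1 / 2)) * (Lweight α (Real.exp y) - 0) := by
      funext y
      rw [E₃, if_pos hlt, sub_zero]
    rw [hE]
    refine hasLimitingDist_exp_mul_Lweight_sub hRH hsimple hθ hJ h1 hlt.ne
      (G := fun s => (zetaQuot s / s - (0 : ℝ)) / (s - ((α - 1 / 2 : ℝ) : ℂ)))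
      (fun _ _ => rfl) fun s hs => ?_
    refine ((differentiableAt_zetaQuot_div hRH hs).sub_const _).div (by fun_prop)
      (sub_ne_zero.2 ?_)
    rintro rfl
    rw [Complex.ofReal_re] at hs
    linarith
  · have hE : E₃ (1 / 2) = fun y => Lweight (1 / 2) (Real.exp y) -
        1 / (2 * (riemannZeta (1 / 2 : ℂ)).re) * y := by
      funext y
      rw [E₃, if_neg (lt_irrefl _), if_pos rfl]
      ring
    rw [hE]
    refine hasLimitingDist_Lweight_half_sub hRH hsimple hθ hJ ?_
    have hz : ((riemannZeta (1 / 2 : ℂ)).re : ℂ) = riemannZeta (1 / 2) :=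
      ofReal_re_of_conj (by rw [← riemannZeta_conj]; simp [Complex.conj_ofNat])
    rw [zetaQuot_zero]
    push_cast
    rw [hz]
  · set κ : ℝ := if α = 1 then 0 else (riemannZeta (2 * α) / riemannZeta α).re with hκ
    have hE : E₃ α = fun y => Real.exp (y * (α - 1 / 2)) * (Lweight α (Real.exp y) - κ) := by
      funext y
      rw [E₃, if_neg hgt.not_gt, if_neg hgt.ne']
    have hβ : 0 < α - 1 / 2 := by linarith
    have hκβ : (κ : ℂ) = zetaQuot ((α - 1 / 2 : ℝ) : ℂ) / ((α - 1 / 2 : ℝ) : ℂ) := by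
      by_cases hα : α = 1
      · have : (((1:ℝ) - 1 / 2 : ℝ) : ℂ) = 1 / 2 := by push_cast; norm_num
        rw [hκ, if_pos hα, hα, this, zetaQuot_half, zero_div, Complex.ofReal_zero]
      · have hne : ((α - 1 / 2 : ℝ) : ℂ) ≠ 1 / 2 := by
          intro h
          apply hα
          have h' : ((α - 1 / 2 : ℝ) : ℂ) = ((1 / 2 : ℝ) : ℂ) := by rw [h]; push_cast; rfl
          linarith [Complex.ofReal_injective h']
        rw [zetaQuot_div (Complex.ofReal_ne_zero.2 hβ.ne') hne, hκ, if_neg hα,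
          ofReal_re_of_conj (by
            rw [map_div₀, ← riemannZeta_conj, ← riemannZeta_conj]; simp [Complex.conj_ofNat])]
        congr 2 <;> push_cast <;> ring
    rw [hE]
    refine hasLimitingDist_exp_mul_Lweight_sub hRH hsimple hθ hJ h1 hgt.ne'
      (G := dslope (fun s => zetaQuot s / s) ((α - 1 / 2 : ℝ) : ℂ)) (fun s hs => ?_)
      fun s hs => differentiableAt_dslope_of_differentiableAt
        (isOpen_lt continuous_const Complex.continuous_re)
        (fun z hz => differentiableAt_zetaQuot_div hRH hz)
        (show 0 < (((α - 1 / 2 : ℝ) : ℂ)).re by rwa [Complex.ofReal_re]) hs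
    rw [dslope_of_ne _ hs, slope_def_field, hκβ]
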